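/- Let J₁ and J₂ be two open arcs of the circle ℝ/ℤ that cover ℝ/ℤ. For every r ∈ ℕ and every η' > 0 there exist s ∈ ℕ and η > 0 such that every orientation-preserving C^∞ circle diffeomorphism f with d_s(f, id) < η can be written as f = [g₁,g'₁][g₂,g'₂][g₃,g'₃][g₄,g'₄], where g₁, g'₁, g₄, g'₄ are orientation-preserving C^∞ circle diffeomorphisms equal to the identity outside J₁, g₂, g'₂, g₃, g'₃ are orientation-preserving C^∞ circle diffeomorphisms equal to the identity outside J₂, and d_r(g_i, id) < η' and d_r(g'_i, id) < η' for i = 1,2,3,4. Here [a,b] = a∘b∘a⁻¹∘b⁻¹. -/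

import Mathlib

open Filter Set

noncomputable section

/-- A lift of an orientation-preserving `C^∞` diffeomorphism of the circle `ℝ/ℤ`. -/
structure CircleLift where
  toFun : ℝ → ℝ
  invFun : ℝ → ℝ
  smooth : ContDiff ℝ (⊤ : ℕ∞) toFun
  smooth_inv : ContDiff ℝ (⊤ : ℕ∞) invFun
  left_inv : Function.LeftInverse invFun toFun
  right_inv : Function.RightInverse invFun toFun
  mono : StrictMono toFun
  lift : ∀ x : ℝ, toFun (x + 1) = toFun x + 1

/-- The open arc of the circle `ℝ/ℤ` which is the projection of `(a, b)`, seen as the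
`ℤ`-periodic subset of `ℝ` of points whose class lies on the arc. -/
def arcSet (a b : ℝ) : Set ℝ := {x : ℝ | ∃ m : ℤ, x + m ∈ Set.Ioo a b}

/-- `d_r(f, g) < ε` for circle diffeomorphisms, computed on lifts over one period. -/
def CDistLt (r : ℕ) (ε : ℝ) (f g : ℝ → ℝ) : Prop :=
  ∀ k ≤ r, ∀ x ∈ Set.Icc (0 : ℝ) 1, |iteratedDeriv k f x - iteratedDeriv k g x| < ε

/-- The lift of the commutator `[g, g'] = g∘g'∘g⁻¹∘g'⁻¹`. -/
def commFun (g g' : CircleLift) : ℝ → ℝ :=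
  g.toFun ∘ g'.toFun ∘ g.invFun ∘ g'.invFun

/-- A circle diffeomorphism is supported in the arc `arcSet a b`. -/
def SupportedIn (g : CircleLift) (a b : ℝ) : Prop :=
  ∀ x : ℝ, x ∉ arcSet a b → g.toFun x = x

/-- All derivatives of `f` of order between `i` and `k` are bounded by `c` on the line. -/
def DerivBound (i k : ℕ) (c : ℝ) (f : ℝ → ℝ) : Prop :=
  ∀ j, i ≤ j → j ≤ k → ∀ x, |iteratedDeriv j f x| ≤ c

/-- Smooth real functions. -/
abbrev IsSmooth (f : ℝ → ℝ) : Prop := ContDiff ℝ (⊤ : ℕ∞) f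

namespace IsSmooth

variable {f g : ℝ → ℝ}

theorem at_nat (hf : IsSmooth f) (n : ℕ) (x : ℝ) : ContDiffAt ℝ n f x :=
  (hf.of_le (by exact_mod_cast le_top)).contDiffAt

theorem of_nat (hf : IsSmooth f) (n : ℕ) : ContDiff ℝ n f :=
  hf.of_le (by exact_mod_cast le_top)

theorem diff (hf : IsSmooth f) : Differentiable ℝ f :=
  hf.differentiable (by simp)

theorem diffAt (hf : IsSmooth f) (x : ℝ) : DifferentiableAt ℝ f x := hf.diff x

theorem comp_fun (hf : IsSmooth f) (hg : IsSmooth g) : IsSmooth (fun x => f (g x)) :=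
  hf.comp hg

theorem deriv' (hf : IsSmooth f) : IsSmooth (deriv f) :=
  ((contDiff_infty_iff_deriv).1 hf).2

theorem iter (hf : IsSmooth f) (n : ℕ) : IsSmooth (iteratedDeriv n f) := by
  induction n generalizing f with
  | zero => simpa [iteratedDeriv_zero] using hf
  | succ n ih => rw [iteratedDeriv_succ']; exact ih hf.deriv'

end IsSmooth

theorem deriv_comp_fun {H G : ℝ → ℝ} (hH : IsSmooth H) (hG : IsSmooth G) :
    deriv (fun x => H (G x)) = fun x => deriv H (G x) * deriv G x := by
  funext x
  exact deriv_comp x (hH.diffAt _) (hG.diffAt _)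

theorem iteratedDeriv_mul_fun {f g : ℝ → ℝ} (hf : IsSmooth f) (hg : IsSmooth g) (n : ℕ) (x : ℝ) :
    iteratedDeriv n (fun x => f x * g x) x = ∑ i ∈ Finset.range (n + 1),
      (n.choose i : ℝ) * iteratedDeriv i f x * iteratedDeriv (n - i) g x :=
  iteratedDeriv_mul (hf.at_nat n x) (hg.at_nat n x)

theorem iteratedDeriv_add_fun {f g : ℝ → ℝ} (hf : IsSmooth f) (hg : IsSmooth g) (n : ℕ) (x : ℝ) :
    iteratedDeriv n (fun x => f x + g x) x = iteratedDeriv n f x + iteratedDeriv n g x :=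
  iteratedDeriv_add (hf.at_nat n x) (hg.at_nat n x)

theorem iteratedDeriv_sub_fun {f g : ℝ → ℝ} (hf : IsSmooth f) (hg : IsSmooth g) (n : ℕ) (x : ℝ) :
    iteratedDeriv n (fun x => f x - g x) x = iteratedDeriv n f x - iteratedDeriv n g x :=
  iteratedDeriv_sub (hf.at_nat n x) (hg.at_nat n x)

namespace DerivBound

variable {i k : ℕ} {c d : ℝ} {f g : ℝ → ℝ}

theorem mono (h : DerivBound i k c f) {i' k' : ℕ} {c' : ℝ} (hi : i ≤ i') (hk : k' ≤ k)
    (hc : c ≤ c') : DerivBound i' k' c' f := fun j hj hj' x =>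
  (h j (hi.trans hj) (hj'.trans hk) x).trans hc

theorem nonneg (h : DerivBound i k c f) (hik : i ≤ k) : 0 ≤ c :=
  (abs_nonneg _).trans (h i le_rfl hik 0)

theorem succ_iff : DerivBound (i + 1) (k + 1) c f ↔ DerivBound i k c (deriv f) := by
  constructor
  · intro h j h1 h2 x
    rw [← iteratedDeriv_succ']
    exact h (j + 1) (by omega) (by omega) x
  · intro h j h1 h2 x
    obtain ⟨j, rfl⟩ : ∃ j', j = j' + 1 := ⟨j - 1, by omega⟩
    rw [iteratedDeriv_succ']
    exact h j (by omega) (by omega) x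

theorem zero_succ (h0 : ∀ x, |f x| ≤ c) (h : DerivBound 0 k c (deriv f)) :
    DerivBound 0 (k + 1) c f := by
  intro j _ h2 x
  rcases j with _ | j
  · simpa using h0 x
  · rw [iteratedDeriv_succ']
    exact h j (by omega) (by omega) x

theorem zero_zero (h0 : ∀ x, |f x| ≤ c) : DerivBound 0 0 c f := by
  intro j _ h2 x
  obtain rfl : j = 0 := by omega
  simpa using h0 x

theorem apply_zero (h : DerivBound 0 k c f) (x : ℝ) : |f x| ≤ c := by
  simpa using h 0 le_rfl (Nat.zero_le _) x

theorem add (hf : DerivBound i k c f) (hg : DerivBound i k d g) (sf : IsSmooth f)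
    (sg : IsSmooth g) : DerivBound i k (c + d) (fun x => f x + g x) := by
  intro j h1 h2 x
  rw [iteratedDeriv_add_fun sf sg]
  exact (abs_add_le _ _).trans (add_le_add (hf j h1 h2 x) (hg j h1 h2 x))

theorem sub (hf : DerivBound i k c f) (hg : DerivBound i k d g) (sf : IsSmooth f)
    (sg : IsSmooth g) : DerivBound i k (c + d) (fun x => f x - g x) := by
  intro j h1 h2 x
  rw [iteratedDeriv_sub_fun sf sg]
  exact (abs_sub _ _).trans (add_le_add (hf j h1 h2 x) (hg j h1 h2 x))

theorem mul (hf : DerivBound 0 k c f) (hg : DerivBound 0 k d g) (sf : IsSmooth f)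
    (sg : IsSmooth g) : DerivBound 0 k (2 ^ k * c * d) (fun x => f x * g x) := by
  have hc := hf.nonneg (Nat.zero_le _)
  have hd := hg.nonneg (Nat.zero_le _)
  intro j _ h2 x
  rw [iteratedDeriv_mul_fun sf sg]
  calc |∑ i ∈ Finset.range (j + 1), (j.choose i : ℝ) * iteratedDeriv i f x *
        iteratedDeriv (j - i) g x|
      ≤ ∑ i ∈ Finset.range (j + 1), (j.choose i : ℝ) * c * d := by
        refine (Finset.abs_sum_le_sum_abs _ _).trans (Finset.sum_le_sum fun i hi => ?_)
        rw [abs_mul, abs_mul, Nat.abs_cast]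
        have := Finset.mem_range.1 hi
        gcongr
        · exact hf i (Nat.zero_le _) (by omega) x
        · exact hg _ (Nat.zero_le _) (by omega) x
    _ = 2 ^ j * c * d := by
        rw [← Finset.sum_mul, ← Finset.sum_mul]
        congr 2
        exact_mod_cast Nat.sum_range_choose j
    _ ≤ 2 ^ k * c * d := by gcongr; norm_num

theorem congr_fun (hf : DerivBound i k c f) (h : ∀ x, g x = f x) : DerivBound i k c g := by
  rwa [funext h]

end DerivBound

theorem derivBound_comp (k : ℕ) (b : ℝ) : ∃ C : ℝ, 1 ≤ C ∧ ∀ (c : ℝ) (H G : ℝ → ℝ),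
    IsSmooth H → IsSmooth G → DerivBound 0 k c H → DerivBound 1 k b G →
    DerivBound 0 k (C * c) (fun x => H (G x)) := by
  induction k with
  | zero =>
    refine ⟨1, le_rfl, fun c H G _ _ h _ => DerivBound.zero_zero fun x => ?_⟩
    simpa using h.apply_zero (G x)
  | succ k ih =>
    obtain ⟨C, hC, ih⟩ := ih
    refine ⟨max C (2 ^ k * C * |b|), hC.trans (le_max_left _ _), fun c H G sH sG h hG => ?_⟩
    have hc := h.nonneg (Nat.zero_le _)
    refine DerivBound.zero_succ (fun x => ?_) ?_
    · refine (h.apply_zero (G x)).trans (le_mul_of_one_le_left hc (hC.trans (le_max_left _ _)))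
    · rw [deriv_comp_fun sH sG]
      have h1 := ih c (deriv H) G sH.deriv' sG
        (DerivBound.succ_iff.1 (h.mono (Nat.zero_le _) le_rfl le_rfl))
        (hG.mono le_rfl (Nat.le_succ _) le_rfl)
      have h2 := (DerivBound.succ_iff.1 hG).mono le_rfl le_rfl (le_abs_self b)
      refine (h1.mul h2 (sH.deriv'.comp sG) sG.deriv').mono le_rfl le_rfl ?_
      calc 2 ^ k * (C * c) * |b| = (2 ^ k * C * |b|) * c := by ring
        _ ≤ _ := by gcongr; exact le_max_right _ _

theorem derivBound_comp_one (k : ℕ) (b : ℝ) : ∃ C : ℝ, 1 ≤ C ∧ ∀ (c : ℝ) (H G : ℝ → ℝ),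
    IsSmooth H → IsSmooth G → DerivBound 1 k c H → DerivBound 1 k b G →
    DerivBound 1 k (C * c) (fun x => H (G x)) := by
  rcases k with _ | k
  · exact ⟨1, le_rfl, fun _ _ _ _ _ _ _ j h1 h2 => by omega⟩
  · obtain ⟨C, hC, h⟩ := derivBound_comp k b
    refine ⟨max 1 (2 ^ k * C * |b|), le_max_left _ _, fun c H G sH sG hH hG => ?_⟩
    have hc := hH.nonneg (by omega)
    rw [DerivBound.succ_iff, deriv_comp_fun sH sG]
    have h1 := h c (deriv H) G sH.deriv' sG (DerivBound.succ_iff.1 hH)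
        (hG.mono le_rfl (Nat.le_succ _) le_rfl)
    have h2 := (DerivBound.succ_iff.1 hG).mono le_rfl le_rfl (le_abs_self b)
    refine (h1.mul h2 (sH.deriv'.comp sG) sG.deriv').mono le_rfl le_rfl ?_
    calc 2 ^ k * (C * c) * |b| = (2 ^ k * C * |b|) * c := by ring
      _ ≤ _ := by gcongr; exact le_max_right _ _

/-- Leibniz rule with the extreme terms isolated. -/
theorem abs_iteratedDeriv_mul_sub_le {f g : ℝ → ℝ} (sf : IsSmooth f) (sg : IsSmooth g) {n : ℕ}
    {c d : ℝ} (x : ℝ) (hc : 0 ≤ c) (hd : 0 ≤ d)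
    (hf : ∀ i < n, |iteratedDeriv i f x| ≤ c)
    (hg : ∀ i, 1 ≤ i → i ≤ n → |iteratedDeriv i g x| ≤ d) :
    |iteratedDeriv n (fun x => f x * g x) x - iteratedDeriv n f x * g x| ≤ 2 ^ n * c * d := by
  rw [iteratedDeriv_mul_fun sf sg, Finset.sum_range_succ]
  simp only [Nat.choose_self, Nat.cast_one, one_mul, Nat.sub_self, iteratedDeriv_zero,
    add_sub_cancel_right]
  calc |∑ i ∈ Finset.range n, (n.choose i : ℝ) * iteratedDeriv i f x *
        iteratedDeriv (n - i) g x|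
      ≤ ∑ i ∈ Finset.range n, (n.choose i : ℝ) * c * d := by
        refine (Finset.abs_sum_le_sum_abs _ _).trans (Finset.sum_le_sum fun i hi => ?_)
        rw [abs_mul, abs_mul, Nat.abs_cast]
        have := Finset.mem_range.1 hi
        gcongr
        · exact hf i this
        · exact hg _ (by omega) (by omega)
    _ ≤ ∑ i ∈ Finset.range (n + 1), (n.choose i : ℝ) * c * d := by
        rw [Finset.sum_range_succ]
        have : 0 ≤ (n.choose n : ℝ) * c * d := by positivity
        linarith
    _ = 2 ^ n * c * d := by
        rw [← Finset.sum_mul, ← Finset.sum_mul]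
        congr 2
        exact_mod_cast Nat.sum_range_choose n

theorem comp_top (m : ℕ) (b : ℝ) (hb : 0 ≤ b) : ∃ C : ℝ, 0 ≤ C ∧ ∀ (βH βG : ℝ) (H G : ℝ → ℝ),
    0 ≤ βH → 0 ≤ βG → IsSmooth H → IsSmooth G → DerivBound 1 m βH H →
    DerivBound 2 (m + 1) βG G → DerivBound 1 (m + 1) b G → ∀ x,
    |iteratedDeriv (m + 1) (fun x => H (G x)) x -
      iteratedDeriv (m + 1) H (G x) * deriv G x ^ (m + 1)| ≤ C * βH * βG := by
  induction m with
  | zero =>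
    refine ⟨0, le_rfl, fun βH βG H G _ _ sH sG _ _ _ x => ?_⟩
    rw [zero_add, iteratedDeriv_one, deriv_comp_fun sH sG, iteratedDeriv_one]
    simp
  | succ m ih =>
    obtain ⟨C, hC, ih⟩ := ih
    obtain ⟨C₁, hC₁, h₁⟩ := derivBound_comp m b
    refine ⟨C * b + 2 ^ (m + 1) * C₁, by positivity,
      fun βH βG H G hβH hβG sH sG hH hG hGb x => ?_⟩
    have e : iteratedDeriv (m + 1 + 1) (fun x => H (G x)) x =
        iteratedDeriv (m + 1) (fun x => deriv H (G x) * deriv G x) x := by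
      rw [iteratedDeriv_succ', deriv_comp_fun sH sG]
    have k1 := h₁ βH (deriv H) G sH.deriv' sG (DerivBound.succ_iff.1 hH)
      (hGb.mono le_rfl (by omega) le_rfl)
    have k2 := abs_iteratedDeriv_mul_sub_le (f := fun x => deriv H (G x)) (g := deriv G)
      (sH.deriv'.comp sG) sG.deriv' (n := m + 1) (c := C₁ * βH) (d := βG) x (by positivity) hβG
      (fun i hi => k1 i (Nat.zero_le _) (by omega) x)
      (fun i h1 h2 => by rw [← iteratedDeriv_succ']; exact hG _ (by omega) (by omega) x)
    have k3 := ih βH βG (deriv H) G hβH hβG sH.deriv' sG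
      (DerivBound.succ_iff.1 (hH.mono (by omega) le_rfl le_rfl))
      (hG.mono le_rfl (by omega) le_rfl) (hGb.mono le_rfl (by omega) le_rfl) x
    have k4 : |deriv G x| ≤ b := by
      have := hGb 1 le_rfl (by omega) x
      rwa [iteratedDeriv_one] at this
    rw [e, iteratedDeriv_succ' (f := H)]
    set X := iteratedDeriv (m + 1) (fun x => deriv H (G x) * deriv G x) x
    set Y := iteratedDeriv (m + 1) (fun x => deriv H (G x)) x
    set Z := iteratedDeriv (m + 1) (deriv H) (G x)
    have e2 : X - Z * deriv G x ^ (m + 1 + 1) =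
        (X - Y * deriv G x) + (Y - Z * deriv G x ^ (m + 1)) * deriv G x := by ring
    rw [e2]
    refine (abs_add_le _ _).trans ?_
    rw [abs_mul]
    have k5 : |Y - Z * deriv G x ^ (m + 1)| * |deriv G x| ≤ C * βH * βG * b := by gcongr
    linarith

theorem comp_sharp (m : ℕ) (b : ℝ) (hb : 0 ≤ b) : ∃ C : ℝ, 0 ≤ C ∧ ∀ (βF βG : ℝ) (F G : ℝ → ℝ),
    0 ≤ βF → 0 ≤ βG → IsSmooth F → IsSmooth G → DerivBound 2 (m + 1) βF F →
    DerivBound 2 (m + 1) βG G → DerivBound 1 (m + 1) b G → ∀ x,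
    |iteratedDeriv (m + 2) (fun x => F (G x)) x -
      iteratedDeriv (m + 2) F (G x) * deriv G x ^ (m + 2) -
      deriv F (G x) * iteratedDeriv (m + 2) G x| ≤ C * βF * βG := by
  obtain ⟨C, hC, h₀⟩ := comp_top m b hb
  obtain ⟨C₁, hC₁, h₁⟩ := derivBound_comp_one m b
  refine ⟨C * b + 2 ^ (m + 1) * C₁, by positivity,
      fun βF βG F G hβF hβG sF sG hF hG hGb x => ?_⟩
  have e : iteratedDeriv (m + 2) (fun x => F (G x)) x =
      iteratedDeriv (m + 1) (fun x => deriv F (G x) * deriv G x) x := by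
    rw [iteratedDeriv_succ', deriv_comp_fun sF sG]
  have k1 := h₁ βF (deriv F) G sF.deriv' sG (DerivBound.succ_iff.1 hF)
      (hGb.mono le_rfl (by omega) le_rfl)
  have k3 := h₀ βF βG (deriv F) G hβF hβG sF.deriv' sG
      (DerivBound.succ_iff.1 hF) hG hGb x
  have k4 : |deriv G x| ≤ b := by
    have := hGb 1 le_rfl (by omega) x
    rwa [iteratedDeriv_one] at this
  have sFG : IsSmooth (fun x => deriv F (G x)) := sF.deriv'.comp sG
  rw [iteratedDeriv_mul_fun sFG sG.deriv', Finset.sum_range_succ, Finset.sum_range_succ'] at e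
  simp only [Nat.choose_self, Nat.cast_one, one_mul, Nat.sub_self, iteratedDeriv_zero,
    Nat.choose_zero_right, Nat.sub_zero] at e
  rw [← iteratedDeriv_succ' (f := G)] at e
  rw [e, iteratedDeriv_succ' (f := F)]
  have k2 : |∑ i ∈ Finset.range m, ((m + 1).choose (i + 1) : ℝ) *
      iteratedDeriv (i + 1) (fun x => deriv F (G x)) x *
      iteratedDeriv (m + 1 - (i + 1)) (deriv G) x| ≤ 2 ^ (m + 1) * C₁ * βF * βG := by
    calc _ ≤ ∑ i ∈ Finset.range m, ((m + 1).choose (i + 1) : ℝ) * (C₁ * βF) * βG := by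
          refine (Finset.abs_sum_le_sum_abs _ _).trans (Finset.sum_le_sum fun i hi => ?_)
          rw [abs_mul, abs_mul, Nat.abs_cast]
          have := Finset.mem_range.1 hi
          gcongr
          · exact k1 (i + 1) (by omega) (by omega) x
          · rw [← iteratedDeriv_succ']
            exact hG _ (by omega) (by omega) x
      _ = (∑ i ∈ Finset.range m, ((m + 1).choose (i + 1) : ℝ)) * (C₁ * βF * βG) := by
          rw [Finset.sum_mul]; exact Finset.sum_congr rfl fun i _ => by ring
      _ ≤ 2 ^ (m + 1) * (C₁ * βF * βG) := by
          gcongr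
          have := Nat.sum_range_choose (m + 1)
          rw [Finset.sum_range_succ, Finset.sum_range_succ'] at this
          exact_mod_cast (by omega : ∑ i ∈ Finset.range m, (m + 1).choose (i + 1) ≤ 2 ^ (m + 1))
      _ = _ := by ring
  set S := ∑ i ∈ Finset.range m, ((m + 1).choose (i + 1) : ℝ) *
      iteratedDeriv (i + 1) (fun x => deriv F (G x)) x *
      iteratedDeriv (m + 1 - (i + 1)) (deriv G) x
  set Y := iteratedDeriv (m + 1) (fun x => deriv F (G x)) x
  set Z := iteratedDeriv (m + 1) (deriv F) (G x)
  have e2 : S + deriv F (G x) * iteratedDeriv (m + 1 + 1) G x + Y * deriv G x -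
      Z * deriv G x ^ (m + 2) - deriv F (G x) * iteratedDeriv (m + 2) G x =
      S + (Y - Z * deriv G x ^ (m + 1)) * deriv G x := by ring
  rw [e2]
  refine (abs_add_le _ _).trans ?_
  rw [abs_mul]
  have k5 : |Y - Z * deriv G x ^ (m + 1)| * |deriv G x| ≤ C * βF * βG * b := by gcongr
  linarith

theorem DerivBound.zero_iff {k : ℕ} {c : ℝ} {f : ℝ → ℝ} :
    DerivBound 0 (k + 1) c f ↔ (∀ x, |f x| ≤ c) ∧ DerivBound 0 k c (deriv f) :=
  ⟨fun h => ⟨h.apply_zero, DerivBound.succ_iff.1 (h.mono (Nat.zero_le _) le_rfl le_rfl)⟩,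
    fun h => DerivBound.zero_succ h.1 h.2⟩

theorem DerivBound.deriv_le {k : ℕ} {c : ℝ} {f : ℝ → ℝ} (h : DerivBound 1 (k + 1) c f) (x : ℝ) :
    |deriv f x| ≤ c := by
  have := h 1 le_rfl (by omega) x
  rwa [iteratedDeriv_one] at this

theorem IsSmooth.lipschitz {f : ℝ → ℝ} (sf : IsSmooth f) {c : ℝ} (h : ∀ x, |deriv f x| ≤ c)
    (x y : ℝ) : |f x - f y| ≤ c * |x - y| := by
  have := Convex.norm_image_sub_le_of_norm_deriv_le (f := f) (s := univ) (C := c)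
    (fun x _ => sf.diffAt x) (fun x _ => h x) convex_univ (mem_univ y) (mem_univ x)
  simpa using this

theorem derivBound_comp_sub (k : ℕ) (b : ℝ) : ∃ C : ℝ, 1 ≤ C ∧ ∀ (c e : ℝ) (F G G' : ℝ → ℝ),
    IsSmooth F → IsSmooth G → IsSmooth G' → DerivBound 1 (k + 1) c F → DerivBound 1 k b G →
    DerivBound 1 k b G' → DerivBound 0 k e (fun x => G x - G' x) →
    DerivBound 0 k (C * c * e) (fun x => F (G x) - F (G' x)) := by
  induction k with
  | zero =>
    refine ⟨1, le_rfl, fun c e F G G' sF sG sG' hF _ _ he => DerivBound.zero_zero fun x => ?_⟩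
    have hc := hF.nonneg (by omega)
    refine (sF.lipschitz hF.deriv_le _ _).trans ?_
    rw [one_mul]
    gcongr
    exact he.apply_zero x
  | succ k ih =>
    obtain ⟨C, hC, ih⟩ := ih
    obtain ⟨C₁, hC₁, h₁⟩ := derivBound_comp k b
    refine ⟨C * 1 + 2 ^ k * C * |b| + 2 ^ k * C₁, ?_, fun c e F G G' sF sG sG' hF hG hG' he => ?_⟩
    · have : 0 ≤ 2 ^ k * C * |b| + 2 ^ k * C₁ := by positivity
      linarith
    have hc := hF.nonneg (by omega)
    have he0 := he.nonneg (by omega)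
    refine DerivBound.zero_succ (fun x => ?_) ?_
    · refine (sF.lipschitz (fun y => hF.deriv_le y) _ _).trans ?_
      have h1 : c * |G x - G' x| ≤ c * e := by gcongr; exact he.apply_zero x
      have h2 : c * e ≤ (C * 1 + 2 ^ k * C * |b| + 2 ^ k * C₁) * (c * e) := by
        refine le_mul_of_one_le_left (by positivity) ?_
        have : 0 ≤ 2 ^ k * C * |b| + 2 ^ k * C₁ := by positivity
        linarith
      linarith
    · have e1 : deriv (fun x => F (G x) - F (G' x)) = fun x =>
          (deriv F (G x) - deriv F (G' x)) * deriv G x +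
          deriv F (G' x) * deriv (fun x => G x - G' x) x := by
        funext x
        have d1 : deriv (fun x => F (G x)) x = _ := congrFun (deriv_comp_fun sF sG) x
        have d2 : deriv (fun x => F (G' x)) x = _ := congrFun (deriv_comp_fun sF sG') x
        rw [deriv_fun_sub ((sF.comp_fun sG).diffAt x) ((sF.comp_fun sG').diffAt x)]
        rw [deriv_fun_sub (sG.diffAt x) (sG'.diffAt x)]
        rw [d1, d2]; ring
      rw [e1]
      have k1 := ih c e (deriv F) G G' sF.deriv' sG sG'
        (DerivBound.succ_iff.1 (hF.mono (by omega) le_rfl le_rfl))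
        (hG.mono le_rfl (by omega) le_rfl) (hG'.mono le_rfl (by omega) le_rfl)
        (he.mono le_rfl (by omega) le_rfl)
      have k2 := (DerivBound.succ_iff.1 hG).mono le_rfl le_rfl (le_abs_self b)
      have k3 := h₁ c (deriv F) G' sF.deriv' sG'
        (DerivBound.succ_iff.1 (hF.mono le_rfl (by omega) le_rfl))
        (hG'.mono le_rfl (by omega) le_rfl)
      have k4 := (DerivBound.zero_iff.1 he).2
      have s1 : IsSmooth (fun x => deriv F (G x) - deriv F (G' x)) :=
        (sF.deriv'.comp sG).sub (sF.deriv'.comp sG')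
      have s3 : IsSmooth (fun x => deriv F (G' x)) := sF.deriv'.comp sG'
      have s4 : IsSmooth (deriv fun x => G x - G' x) := IsSmooth.deriv' (sG.sub sG')
      refine ((k1.mul k2 s1 sG.deriv').add (k3.mul k4 s3 s4) (s1.mul sG.deriv')
        (s3.mul s4)).mono le_rfl le_rfl ?_
      have : 0 ≤ C * c * e := by positivity
      nlinarith

section Inverse

variable {h I : ℝ → ℝ}

theorem deriv_inverse (sh : IsSmooth h) (sI : IsSmooth I) (hI : ∀ x, h (I x) = x) (x : ℝ) :
    deriv h (I x) * deriv I x = 1 := by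
  have := congrFun (deriv_comp_fun sh sI) x
  simp only [hI] at this
  rw [← this]; simp

theorem deriv_inverse_pos (sh : IsSmooth h) (sI : IsSmooth I) (hI : ∀ x, h (I x) = x)
    (hh : ∀ x, 1 / 2 ≤ deriv h x) (x : ℝ) : 0 < deriv I x ∧ deriv I x ≤ 2 := by
  have h1 := deriv_inverse sh sI hI x
  have h2 := hh (I x)
  have h3 : 0 < deriv I x := by
    by_contra hn
    push Not at hn
    nlinarith
  exact ⟨h3, by nlinarith⟩

theorem abs_deriv_inverse_le (sh : IsSmooth h) (sI : IsSmooth I) (hI : ∀ x, h (I x) = x)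
    (hh : ∀ x, 1 / 2 ≤ deriv h x) (x : ℝ) : |deriv I x| ≤ 2 := by
  obtain ⟨h1, h2⟩ := deriv_inverse_pos sh sI hI hh x
  rwa [abs_of_pos h1]

theorem DerivBound.one_of_two {k : ℕ} {c d : ℝ} {f : ℝ → ℝ} (h1 : ∀ x, |deriv f x| ≤ d)
    (h : DerivBound 2 k c f) (hc : 0 ≤ c) (hd : 0 ≤ d) : DerivBound 1 k (d + c) f := by
  intro j hj hj' x
  rcases Nat.lt_or_ge 1 j with h' | h'
  · exact (h j h' hj' x).trans (by linarith)
  · obtain rfl : j = 1 := by omega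
    rw [iteratedDeriv_one]
    exact (h1 x).trans (by linarith)

theorem inverse_sharp_aux (m : ℕ) (b C : ℝ) (hb : 0 ≤ b) (hC : 0 ≤ C) :
    ∃ C' : ℝ, 0 ≤ C' ∧ ∀ (β μ : ℝ) (h I : ℝ → ℝ),
    0 ≤ β → β ≤ b → IsSmooth h → IsSmooth I → (∀ x, h (I x) = x) → (∀ x, 1 / 2 ≤ deriv h x) →
    DerivBound 2 (m + 1) β h → DerivBound 2 (m + 1) (C * β) I →
    (∀ x, |iteratedDeriv (m + 2) h x| ≤ μ) →
    ∀ x, |iteratedDeriv (m + 2) I x| ≤ 2 ^ (m + 3) * μ + C' * β := by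
  obtain ⟨C₂, hC₂, h₂⟩ := comp_sharp m (2 + C * b) (by positivity)
  refine ⟨2 * (C₂ * b * C), by positivity, fun β μ h I hβ hβb sh sI hI hh hhb hIb hμ x => ?_⟩
  have hμ0 : 0 ≤ μ := (abs_nonneg _).trans (hμ x)
  have k1 := h₂ β (C * β) h I hβ (by positivity) sh sI hhb hIb
    ((DerivBound.one_of_two (abs_deriv_inverse_le sh sI hI hh) hIb (by positivity)
      (by norm_num)).mono le_rfl le_rfl (by gcongr)) x
  simp only [hI] at k1
  have k0 : iteratedDeriv (m + 2) (fun x : ℝ => x) x = 0 :=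
    (iteratedDeriv_id (𝕜 := ℝ) (n := m + 2) (x := x)).trans (by simp)
  rw [k0] at k1
  set Y := iteratedDeriv (m + 2) I x
  set D := deriv h (I x)
  have hD : 1 / 2 ≤ D := hh _
  have k2 : |iteratedDeriv (m + 2) h (I x) * deriv I x ^ (m + 2)| ≤ μ * 2 ^ (m + 2) := by
    rw [abs_mul, abs_pow]
    gcongr
    · exact hμ _
    · exact abs_deriv_inverse_le sh sI hI hh x
  have k3 : |D * Y| ≤ μ * 2 ^ (m + 2) + C₂ * β * (C * β) := by
    have e : D * Y = -(0 - iteratedDeriv (m + 2) h (I x) * deriv I x ^ (m + 2) - D * Y) -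
      iteratedDeriv (m + 2) h (I x) * deriv I x ^ (m + 2) := by ring
    rw [e]
    refine (abs_sub _ _).trans ?_
    rw [abs_neg]
    linarith
  rw [abs_mul, abs_of_pos (by linarith)] at k3
  have k4 : 1 / 2 * |Y| ≤ D * |Y| := by gcongr
  have k5 : C₂ * β * (C * β) ≤ C₂ * b * (C * β) := by gcongr
  have e3 : (2:ℝ) ^ (m + 3) = 2 * 2 ^ (m + 2) := by ring
  rw [e3]
  linarith

theorem inverse_derivBound (m : ℕ) (b : ℝ) (hb : 0 ≤ b) : ∃ C : ℝ, 0 ≤ C ∧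
    ∀ (β : ℝ) (h I : ℝ → ℝ), 0 ≤ β → β ≤ b → IsSmooth h → IsSmooth I → (∀ x, h (I x) = x) →
    (∀ x, 1 / 2 ≤ deriv h x) → DerivBound 2 (m + 1) β h → DerivBound 2 (m + 1) (C * β) I := by
  induction m with
  | zero => exact ⟨0, le_rfl, fun _ _ _ _ _ _ _ _ _ _ j h1 h2 => by omega⟩
  | succ m ih =>
    obtain ⟨C, hC, ih⟩ := ih
    obtain ⟨C', hC', h'⟩ := inverse_sharp_aux m b C hb hC
    refine ⟨C + (2 ^ (m + 3) + C'), by positivity,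
      fun β h I hβ hβb sh sI hI hh hhb => ?_⟩
    have k1 := ih β h I hβ hβb sh sI hI hh (hhb.mono le_rfl (by omega) le_rfl)
    have k2 := h' β β h I hβ hβb sh sI hI hh (hhb.mono le_rfl (by omega) le_rfl) k1
      (fun x => hhb (m + 2) (by omega) (by omega) x)
    intro j h1 h2 x
    have : 0 ≤ (2:ℝ) ^ (m + 3) * β := by positivity
    have : 0 ≤ C * β := by positivity
    have : 0 ≤ C' * β := by positivity
    rcases Nat.lt_or_ge j (m + 2) with h3 | h3
    · refine (k1 j h1 (by omega) x).trans ?_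
      linarith
    · obtain rfl : j = m + 2 := by omega
      refine (k2 x).trans ?_
      linarith

theorem inverse_sharp (m : ℕ) (b : ℝ) (hb : 0 ≤ b) : ∃ C : ℝ, 0 ≤ C ∧
    ∀ (β μ : ℝ) (h I : ℝ → ℝ), 0 ≤ β → β ≤ b → IsSmooth h → IsSmooth I → (∀ x, h (I x) = x) →
    (∀ x, 1 / 2 ≤ deriv h x) → DerivBound 2 (m + 1) β h →
    (∀ x, |iteratedDeriv (m + 2) h x| ≤ μ) → DerivBound 2 (m + 1) (C * β) I ∧
    ∀ x, |iteratedDeriv (m + 2) I x| ≤ 2 ^ (m + 3) * μ + C * β := by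
  obtain ⟨C, hC, h₁⟩ := inverse_derivBound m b hb
  obtain ⟨C', hC', h₂⟩ := inverse_sharp_aux m b C hb hC
  refine ⟨max C C', le_max_of_le_left hC, fun β μ h I hβ hβb sh sI hI hh hhb hμ => ?_⟩
  have k1 := h₁ β h I hβ hβb sh sI hI hh hhb
  refine ⟨k1.mono le_rfl le_rfl (by gcongr; exact le_max_left _ _), fun x => ?_⟩
  refine (h₂ β μ h I hβ hβb sh sI hI hh hhb k1 hμ x).trans ?_
  gcongr
  exact le_max_right _ _

/-- Continuity of inversion. -/
theorem inverse_sub (k : ℕ) (b : ℝ) (hb : 0 ≤ b) : ∃ C : ℝ, 0 ≤ C ∧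
    ∀ (d : ℝ) (h I h' I' : ℝ → ℝ), IsSmooth h → IsSmooth I → (∀ x, h (I x) = x) →
    (∀ x, I (h x) = x) → (∀ x, 1 / 2 ≤ deriv h x) → DerivBound 1 (k + 1) b h →
    IsSmooth h' → IsSmooth I' → (∀ x, h' (I' x) = x) →
    (∀ x, 1 / 2 ≤ deriv h' x) → DerivBound 1 (k + 1) b h' →
    DerivBound 0 k d (fun x => h x - h' x) → DerivBound 0 k (C * d) (fun x => I x - I' x) := by
  obtain ⟨C₀, hC₀, k₀⟩ := inverse_derivBound k b hb
  obtain ⟨C₁, hC₁, k₁⟩ := derivBound_comp_sub k b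
  obtain ⟨C₂, hC₂, k₂⟩ := derivBound_comp k (2 + C₀ * b)
  refine ⟨C₂ * (C₁ * (2 + C₀ * b)), by positivity,
    fun d h I h' I' sh sI hI hI2 hh hb1 sh' sI' hI' hh' hb1' hd => ?_⟩
  have hd' : DerivBound 0 k d (fun x => h' x - h x) := by
    intro j h1 h2 x
    have := hd j h1 h2 x
    rw [iteratedDeriv_sub_fun sh sh'] at this
    rw [iteratedDeriv_sub_fun sh' sh, abs_sub_comm]
    exact this
  have e1 : DerivBound 1 (k + 1) (2 + C₀ * b) I :=
    DerivBound.one_of_two (abs_deriv_inverse_le sh sI hI hh)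
      (k₀ b h I hb le_rfl sh sI hI hh (hb1.mono (by omega) le_rfl le_rfl)) (by positivity)
      (by norm_num)
  have e2 : DerivBound 1 (k + 1) (2 + C₀ * b) I' :=
    DerivBound.one_of_two (abs_deriv_inverse_le sh' sI' hI' hh')
      (k₀ b h' I' hb le_rfl sh' sI' hI' hh' (hb1'.mono (by omega) le_rfl le_rfl)) (by positivity)
      (by norm_num)
  have e3 := k₁ _ d I h' h sI sh' sh e1 (hb1'.mono le_rfl (by omega) le_rfl)
    (hb1.mono le_rfl (by omega) le_rfl) hd'
  have e4 := k₂ _ _ I' ((sI.comp sh').sub (sI.comp sh)) sI' e3 (e2.mono le_rfl (by omega) le_rfl)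
  refine (e4.congr_fun (g := fun x => I x - I' x) fun x => ?_).mono le_rfl le_rfl (le_of_eq ?_)
  · simp only [Function.comp_apply, hI', hI2]
  · ring

end Inverse

theorem bijective_of_deriv (h : ℝ → ℝ) (sh : IsSmooth h) (hh : ∀ x, 1 / 2 ≤ deriv h x) :
    StrictMono h ∧ Function.Bijective h := by
  have hm : StrictMono h := strictMono_of_deriv_pos fun x => by linarith [hh x]
  refine ⟨hm, hm.injective, ?_⟩
  have hm2 : Monotone (fun x => h x - x / 2) := by
    have hd : ∀ x, HasDerivAt (fun x => h x - x / 2) (deriv h x - 1 / 2) x := fun x =>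
      (sh.diffAt x).hasDerivAt.sub ((hasDerivAt_id x).div_const 2)
    refine monotone_of_deriv_nonneg (fun x => (hd x).differentiableAt) fun x => ?_
    rw [(hd x).deriv]
    linarith [hh x]
  refine sh.continuous.surjective ?_ ?_
  · refine tendsto_atTop.2 fun c => ?_
    filter_upwards [eventually_ge_atTop (max 0 (2 * (c - h 0)))] with x hx
    have h1 := hm2 (le_trans (le_max_left _ _) hx)
    have h2 := le_trans (le_max_right _ _) hx
    simp only at h1
    linarith
  · refine tendsto_atBot.2 fun c => ?_
    filter_upwards [eventually_le_atBot (min 0 (2 * (c - h 0)))] with x hx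
    have h1 := hm2 (le_trans hx (min_le_left _ _))
    have h2 := le_trans hx (min_le_right _ _)
    simp only at h1
    linarith

theorem smooth_inverse (h I : ℝ → ℝ) (sh : IsSmooth h) (hh : ∀ x, 0 < deriv h x)
    (h1 : ∀ x, h (I x) = x) : IsSmooth I := by
  have hm : StrictMono h := strictMono_of_deriv_pos fun x => hh x
  let e := (hm.orderIsoOfSurjective h fun y => ⟨I y, h1 y⟩).toHomeomorph
  have he : ∀ x, e x = h x := fun x => rfl
  have : IsSmooth e.symm := by
    refine e.contDiff_symm_deriv (f' := deriv h) (fun x => (hh x).ne') (fun x => ?_) ?_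
    · exact (sh.diffAt x).hasDerivAt
    · exact sh
  have e2 : (e.symm : ℝ → ℝ) = I := by
    funext x
    rw [Homeomorph.symm_apply_eq, he, h1]
  rwa [← e2]

/-- A smooth monotone cutoff vanishing on `(-∞, 1/4]` and equal to `1` on `[3/4, ∞)`. -/
def chi (x : ℝ) : ℝ := Real.smoothTransition (2 * x - 1 / 2)

theorem chi_smooth : IsSmooth chi :=
  Real.smoothTransition.contDiff.comp ((contDiff_const.mul contDiff_id).sub contDiff_const)

theorem chi_zero {x : ℝ} (h : x ≤ 1 / 4) : chi x = 0 :=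
  Real.smoothTransition.zero_of_nonpos (by linarith)

theorem chi_one {x : ℝ} (h : 3 / 4 ≤ x) : chi x = 1 :=
  Real.smoothTransition.one_of_one_le (by linarith)

theorem chi_nonneg (x : ℝ) : 0 ≤ chi x := Real.smoothTransition.nonneg _

theorem chi_le_one (x : ℝ) : chi x ≤ 1 := Real.smoothTransition.le_one _

theorem chi_mono : Monotone chi := fun x y h =>
  Real.smoothTransition.monotone (by linarith)

theorem exists_derivBound_of_forall {f : ℝ → ℝ} (k : ℕ)
    (h : ∀ j, ∃ C, ∀ x, |iteratedDeriv j f x| ≤ C) : ∃ C : ℝ, 1 ≤ C ∧ DerivBound 0 k C f := by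
  choose C hC using h
  refine ⟨1 + ∑ j ∈ Finset.range (k + 1), |C j|, ?_, fun j _ hj x => ?_⟩
  · have : 0 ≤ ∑ j ∈ Finset.range (k + 1), |C j| := Finset.sum_nonneg fun _ _ => abs_nonneg _
    linarith
  · have h1 : |C j| ≤ ∑ j ∈ Finset.range (k + 1), |C j| :=
      Finset.single_le_sum (f := fun j => |C j|) (fun _ _ => abs_nonneg _)
        (Finset.mem_range.2 (by omega))
    linarith [hC j x, le_abs_self (C j)]

theorem chi_derivBound (k : ℕ) : ∃ C : ℝ, 1 ≤ C ∧ DerivBound 0 k C chi := by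
  refine exists_derivBound_of_forall k fun j => ?_
  obtain ⟨C, hC⟩ := (isCompact_Icc (a := (0:ℝ)) (b := 1)).exists_bound_of_continuousOn
    (chi_smooth.iter j).continuous.continuousOn
  refine ⟨max C 1, fun x => ?_⟩
  have hconst : ∀ c : ℝ, |c| ≤ 1 → |iteratedDeriv j (fun _ : ℝ => c) x| ≤ max C 1 := by
    intro c hc
    rw [iteratedDeriv_const]
    split_ifs
    · exact hc.trans (le_max_right _ _)
    · simp
  rcases lt_or_ge x 0 with h | h
  · have : chi =ᶠ[nhds x] fun _ => 0 := by
      filter_upwards [Iio_mem_nhds h] with y hy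
      exact chi_zero (by linarith [mem_Iio.1 hy])
    rw [this.iteratedDeriv_eq]
    exact hconst 0 (by simp)
  rcases lt_or_ge 1 x with h1 | h1
  · have : chi =ᶠ[nhds x] fun _ => 1 := by
      filter_upwards [Ioi_mem_nhds h1] with y hy
      exact chi_one (by linarith [mem_Ioi.1 hy])
    rw [this.iteratedDeriv_eq]
    exact hconst 1 (by simp)
  · exact (hC x ⟨h, h1⟩).trans (le_max_left _ _)

/-- The map `id + χ V`. -/
def hmap (V : ℝ → ℝ) (x : ℝ) : ℝ := x + chi x * V x

/-- The inverse of `hmap V`. -/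
def imap (V : ℝ → ℝ) : ℝ → ℝ := Function.invFun (hmap V)

/-- The map `T h⁻¹ T⁻¹ h` where `h = hmap V` and `T` is the unit translation. -/
def amap (V : ℝ → ℝ) (x : ℝ) : ℝ := imap V (hmap V x - 1) + 1

/-- `V` is smooth and `hmap V` has derivative between `1/2` and `2`. -/
structure Admissible (V : ℝ → ℝ) : Prop where
  smooth : IsSmooth V
  half_le : ∀ x, 1 / 2 ≤ deriv (hmap V) x
  le_two : ∀ x, deriv (hmap V) x ≤ 2

theorem smooth_id : IsSmooth (fun x : ℝ => x) := contDiff_id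

theorem hmap_smooth {V : ℝ → ℝ} (h : IsSmooth V) : IsSmooth (hmap V) :=
  contDiff_id.add (chi_smooth.mul h)

theorem iteratedDeriv_hmap {V : ℝ → ℝ} (h : IsSmooth V) (n : ℕ) (x : ℝ) :
    iteratedDeriv n (hmap V) x = iteratedDeriv n (fun x => x) x +
      iteratedDeriv n (fun x => chi x * V x) x :=
  iteratedDeriv_add_fun smooth_id (chi_smooth.mul h) n x

theorem iteratedDeriv_fun_id_two {n : ℕ} (hn : 2 ≤ n) (x : ℝ) :
    iteratedDeriv n (fun x : ℝ => x) x = 0 :=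
  (iteratedDeriv_id (𝕜 := ℝ) (n := n) (x := x)).trans (by
    rw [if_neg (by omega), if_neg (by omega)])

theorem iteratedDeriv_fun_id_one (x : ℝ) :
    iteratedDeriv 1 (fun x : ℝ => x) x = 1 :=
  (iteratedDeriv_id (𝕜 := ℝ) (n := 1) (x := x)).trans (by simp)

theorem exists_admissible : ∃ e : ℝ, 0 < e ∧ ∀ V, IsSmooth V → DerivBound 0 1 e V →
    Admissible V := by
  obtain ⟨C, hC, h⟩ := chi_derivBound 1
  refine ⟨1 / (4 * C), by positivity, fun V sV hV => ?_⟩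
  have h1 := h.mul hV chi_smooth sV
  have e : 2 ^ 1 * C * (1 / (4 * C)) = 1 / 2 := by field_simp; norm_num
  rw [e] at h1
  have h2 : ∀ x, deriv (hmap V) x = 1 + iteratedDeriv 1 (fun x => chi x * V x) x := fun x => by
    rw [← iteratedDeriv_one, iteratedDeriv_hmap sV, iteratedDeriv_fun_id_one]
  refine ⟨sV, fun x => ?_, fun x => ?_⟩ <;> rw [h2] <;>
    linarith [abs_le.1 (h1 1 (by norm_num) le_rfl x)]

namespace Admissible

variable {V : ℝ → ℝ}

theorem bij (h : Admissible V) : StrictMono (hmap V) ∧ Function.Bijective (hmap V) :=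
  bijective_of_deriv _ (hmap_smooth h.smooth) h.half_le

theorem hmap_imap (h : Admissible V) (x : ℝ) : hmap V (imap V x) = x :=
  Function.rightInverse_invFun h.bij.2.2 x

theorem imap_hmap (h : Admissible V) (x : ℝ) : imap V (hmap V x) = x :=
  Function.leftInverse_invFun h.bij.2.1 x

theorem imap_smooth (h : Admissible V) : IsSmooth (imap V) :=
  smooth_inverse _ _ (hmap_smooth h.smooth) (fun x => by linarith [h.half_le x]) h.hmap_imap

theorem amap_smooth (h : Admissible V) : IsSmooth (amap V) :=
  (h.imap_smooth.comp ((hmap_smooth h.smooth).sub contDiff_const)).add contDiff_const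

theorem imap_mono (h : Admissible V) : StrictMono (imap V) := fun x y hxy => by
  rw [← h.hmap_imap x, ← h.hmap_imap y] at hxy
  exact h.bij.1.lt_iff_lt.1 hxy

theorem amap_mono (h : Admissible V) : StrictMono (amap V) := fun x y hxy => by
  have := h.imap_mono (sub_lt_sub_right (h.bij.1 hxy) 1)
  simp only [amap]; linarith

theorem imap_eq (h : Admissible V) {x y : ℝ} (e : hmap V y = x) : imap V x = y := by
  rw [← e, h.imap_hmap]

theorem amap_of_le (h : Admissible V) {x : ℝ} (hx : x ≤ 1 / 4) : amap V x = x := by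
  have h1 : hmap V x = x := by simp [hmap, chi_zero hx]
  have h2 : imap V (x - 1) = x - 1 :=
    h.imap_eq (by simp [hmap, chi_zero (show x - 1 ≤ 1 / 4 by linarith)])
  rw [amap, h1, h2]; ring

theorem amap_of_ge (h : Admissible V) (hper : ∀ x, V (x + 1) = V x) {x : ℝ} (hx : 7 / 4 ≤ x) :
    amap V x = x := by
  have h1 : hmap V x = x + V x := by simp [hmap, chi_one (show 3 / 4 ≤ x by linarith)]
  have h2 : imap V (hmap V x - 1) = x - 1 := by
    refine h.imap_eq ?_
    have := hper (x - 1)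
    rw [sub_add_cancel] at this
    rw [h1, hmap, chi_one (show 3 / 4 ≤ x - 1 by linarith), this]; ring
  rw [amap, h2]; ring

end Admissible

theorem admissible_zero : Admissible (fun _ => 0) := by
  have h : hmap (fun _ => 0) = fun x => x := by funext x; simp [hmap]
  refine ⟨contDiff_const, fun x => ?_, fun x => ?_⟩ <;> rw [h] <;> (simp; try norm_num)

theorem amap_zero (x : ℝ) : amap (fun _ => 0) x = x := by
  have h : ∀ x, hmap (fun _ => 0) x = x := fun x => by simp [hmap]
  rw [amap, h, admissible_zero.imap_eq (h (x - 1))]; ring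

theorem hmap_derivBound_two (k : ℕ) : ∃ C : ℝ, 0 ≤ C ∧ ∀ (β : ℝ) (V : ℝ → ℝ), IsSmooth V →
    DerivBound 0 k β V → DerivBound 2 k (C * β) (hmap V) := by
  obtain ⟨C, hC, h⟩ := chi_derivBound k
  refine ⟨2 ^ k * C, by positivity, fun β V sV hV j h1 h2 x => ?_⟩
  rw [iteratedDeriv_hmap sV, iteratedDeriv_fun_id_two h1, zero_add]
  exact h.mul hV chi_smooth sV j (Nat.zero_le _) h2 x

theorem Admissible.abs_deriv_hmap {V : ℝ → ℝ} (h : Admissible V) (x : ℝ) :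
    |deriv (hmap V) x| ≤ 2 := by
  rw [abs_of_pos (by linarith [h.half_le x])]; exact h.le_two x

theorem iteratedDeriv_sub_const_fun {f : ℝ → ℝ} (n : ℕ) (hn : 1 ≤ n) (c x : ℝ) :
    iteratedDeriv n (fun x => f x - c) x = iteratedDeriv n f x := by
  have := iteratedDeriv_const_add (f := f) (n := n) (x := x) (by omega) (-c)
  rw [← this]; congr 1; funext y; ring

theorem iteratedDeriv_add_const_fun {f : ℝ → ℝ} (n : ℕ) (hn : 1 ≤ n) (c x : ℝ) :
    iteratedDeriv n (fun x => f x + c) x = iteratedDeriv n f x := by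
  have := iteratedDeriv_const_add (f := f) (n := n) (x := x) (by omega) c
  rw [← this]; congr 1; funext y; ring

theorem DerivBound.sub_const {i k : ℕ} {c : ℝ} {f : ℝ → ℝ} (h : DerivBound i k c f) (hi : 1 ≤ i)
    (e : ℝ) : DerivBound i k c (fun x => f x - e) := fun j h1 h2 x => by
  rw [iteratedDeriv_sub_const_fun j (hi.trans h1)]; exact h j h1 h2 x

theorem DerivBound.add_const {i k : ℕ} {c : ℝ} {f : ℝ → ℝ} (h : DerivBound i k c f) (hi : 1 ≤ i)
    (e : ℝ) : DerivBound i k c (fun x => f x + e) := fun j h1 h2 x => by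
  rw [iteratedDeriv_add_const_fun j (hi.trans h1)]; exact h j h1 h2 x

theorem amap_sub (k : ℕ) (b : ℝ) (hb : 0 ≤ b) : ∃ C : ℝ, 0 ≤ C ∧ ∀ (d : ℝ) (V V' : ℝ → ℝ),
    Admissible V → Admissible V' → DerivBound 0 (k + 1) b V → DerivBound 0 (k + 1) b V' →
    DerivBound 0 k d (fun x => V x - V' x) →
    DerivBound 0 k (C * d) (fun x => amap V x - amap V' x) := by
  obtain ⟨Cx, hCx, hx⟩ := chi_derivBound k
  obtain ⟨Ch, hCh, hh⟩ := hmap_derivBound_two (k + 1)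
  set b1 := 2 + Ch * b with hb1
  have hb10 : 0 ≤ b1 := by positivity
  obtain ⟨C₀, hC₀, h₀⟩ := inverse_derivBound k b1 hb10
  set b2 := 2 + C₀ * b1 with hb2
  have hb20 : 0 ≤ b2 := by positivity
  obtain ⟨C₁, hC₁, h₁⟩ := inverse_sub k b1 hb10
  obtain ⟨C₂, hC₂, h₂⟩ := derivBound_comp k b1
  obtain ⟨C₃, hC₃, h₃⟩ := derivBound_comp_sub k b1
  refine ⟨C₂ * (C₁ * (2 ^ k * Cx)) + C₃ * b2 * (2 ^ k * Cx), by positivity,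
    fun d V V' aV aV' bV bV' hd => ?_⟩
  have key : ∀ V, Admissible V → DerivBound 0 (k + 1) b V →
      DerivBound 1 (k + 1) b1 (hmap V) ∧ DerivBound 1 (k + 1) b2 (imap V) := by
    intro V aV bV
    have k1 : DerivBound 1 (k + 1) b1 (hmap V) :=
      DerivBound.one_of_two aV.abs_deriv_hmap (hh b V aV.smooth bV) (by positivity) (by norm_num)
    refine ⟨k1, DerivBound.one_of_two (abs_deriv_inverse_le (hmap_smooth aV.smooth) aV.imap_smooth
      aV.hmap_imap aV.half_le) (h₀ b1 _ _ hb10 le_rfl (hmap_smooth aV.smooth) aV.imap_smooth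
      aV.hmap_imap aV.half_le (k1.mono (by omega) le_rfl le_rfl)) (by positivity) (by norm_num)⟩
  obtain ⟨k1, k2⟩ := key V aV bV
  obtain ⟨k1', k2'⟩ := key V' aV' bV'
  have sh := hmap_smooth aV.smooth
  have sh' := hmap_smooth aV'.smooth
  have k3 : DerivBound 0 k (2 ^ k * Cx * d) (fun x => hmap V x - hmap V' x) := by
    refine (hx.mul hd chi_smooth (aV.smooth.sub aV'.smooth)).congr_fun fun x => ?_
    simp only [hmap]; ring
  have k4 := h₁ _ _ _ _ _ sh aV.imap_smooth aV.hmap_imap aV.imap_hmap aV.half_le k1 sh'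
    aV'.imap_smooth aV'.hmap_imap aV'.half_le k1' k3
  have sI : IsSmooth (fun x => imap V x - imap V' x) := aV.imap_smooth.sub aV'.imap_smooth
  have sG : IsSmooth (fun x => hmap V x - 1) := sh.sub contDiff_const
  have sG' : IsSmooth (fun x => hmap V' x - 1) := sh'.sub contDiff_const
  have k1s := (k1.mono le_rfl (Nat.le_succ k) le_rfl).sub_const le_rfl 1
  have k1s' := (k1'.mono le_rfl (Nat.le_succ k) le_rfl).sub_const le_rfl 1
  have k5 := h₂ _ _ (fun x => hmap V x - 1) sI sG k4 k1s
  have k6 := h₃ b2 (2 ^ k * Cx * d) (imap V') _ _ aV'.imap_smooth sG sG' k2' k1s k1s'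
    (k3.congr_fun fun x => by ring)
  refine ((k5.add k6 (sI.comp_fun sG) ((aV'.imap_smooth.comp_fun sG).sub
    (aV'.imap_smooth.comp_fun sG'))).congr_fun fun x => ?_).mono le_rfl le_rfl (le_of_eq (by ring))
  simp only [amap]; ring

theorem amap_sub_id (k : ℕ) (b : ℝ) (hb : 0 ≤ b) : ∃ C : ℝ, 0 ≤ C ∧ ∀ (β : ℝ) (V : ℝ → ℝ),
    β ≤ b → Admissible V → DerivBound 0 (k + 1) β V →
    DerivBound 0 (k + 1) (C * β) (fun x => amap V x - x) := by
  obtain ⟨Cx, hCx, hx⟩ := chi_derivBound (k + 1)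
  obtain ⟨Ch, hCh, hh⟩ := hmap_derivBound_two (k + 1)
  obtain ⟨C₀, hC₀, h₀⟩ := inverse_derivBound k (Ch * b) (by positivity)
  obtain ⟨C₁, hC₁, h₁⟩ := derivBound_comp (k + 1) (2 + C₀ * (Ch * b))
  obtain ⟨C₂, hC₂, h₂⟩ := derivBound_comp (k + 1) (2 + Ch * b)
  set Cm : ℝ := 2 ^ (k + 1) * Cx with hCm
  have hCm0 : 0 ≤ Cm := by positivity
  refine ⟨C₂ * (C₁ * Cm) + Cm, by positivity, fun β V hβ aV bV => ?_⟩
  have hβ0 := bV.nonneg (by omega)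
  have sh := hmap_smooth aV.smooth
  have sX : IsSmooth (fun x => chi x * V x) := chi_smooth.mul aV.smooth
  have k1 : DerivBound 0 (k + 1) (Cm * β) (fun x => chi x * V x) :=
    hx.mul bV chi_smooth aV.smooth
  have kh := hh β V aV.smooth bV
  have kh1 : DerivBound 1 (k + 1) (2 + Ch * b) (hmap V) :=
    (DerivBound.one_of_two aV.abs_deriv_hmap kh (by positivity) (by norm_num)).mono le_rfl le_rfl
      (by gcongr)
  have kI1 : DerivBound 1 (k + 1) (2 + C₀ * (Ch * b)) (imap V) :=
    DerivBound.one_of_two (abs_deriv_inverse_le sh aV.imap_smooth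
      aV.hmap_imap aV.half_le) (h₀ (Ch * b) _ _ (by positivity) le_rfl sh aV.imap_smooth
      aV.hmap_imap aV.half_le (kh.mono (by omega) le_rfl (by gcongr))) (by positivity) (by norm_num)
  have k2 := h₁ _ _ (imap V) sX aV.imap_smooth k1 kI1
  have sY : IsSmooth (fun x => chi (imap V x) * V (imap V x)) := sX.comp_fun aV.imap_smooth
  have k3 := h₂ _ _ (fun x => hmap V x - 1) sY (sh.sub contDiff_const) k2 (kh1.sub_const le_rfl 1)
  have sZ : IsSmooth (fun x => chi (imap V (hmap V x - 1)) * V (imap V (hmap V x - 1))) :=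
    sY.comp_fun (sh.sub contDiff_const)
  refine ((k1.sub k3 sX sZ).congr_fun fun x => ?_).mono le_rfl le_rfl (le_of_eq (by ring))
  have := aV.hmap_imap (hmap V x - 1)
  simp only [amap]
  set y := imap V (hmap V x - 1)
  simp only [hmap] at this
  linarith

theorem DerivBound.of_sub_id {k : ℕ} {c : ℝ} {f : ℝ → ℝ} (sf : IsSmooth f)
    (h : DerivBound 0 k c (fun x => f x - x)) : DerivBound 2 k c f := fun j h1 h2 x => by
  have := h j (Nat.zero_le _) h2 x
  rwa [iteratedDeriv_sub_fun sf smooth_id, iteratedDeriv_fun_id_two h1, sub_zero] at this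

theorem amap_sharp (m : ℕ) (b : ℝ) (hb : 0 ≤ b) : ∃ C : ℝ, 0 ≤ C ∧ ∀ (β μ : ℝ) (V : ℝ → ℝ),
    β ≤ b → Admissible V → DerivBound 0 (m + 1) β V →
    (∀ x, |iteratedDeriv (m + 2) V x| ≤ μ) → DerivBound 2 (m + 1) (C * β) (amap V) ∧
    ∀ x, |iteratedDeriv (m + 2) (amap V) x| ≤ 4 * 4 ^ (m + 2) * μ + C * β := by
  obtain ⟨Cx, hCx, hx⟩ := chi_derivBound (m + 2)
  obtain ⟨Ch, hCh, hh⟩ := hmap_derivBound_two (m + 1)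
  obtain ⟨Ci, hCi, hi⟩ := inverse_sharp m (Ch * b) (by positivity)
  obtain ⟨Cc, hCc, hc⟩ := comp_sharp m (2 + Ch * b) (by positivity)
  obtain ⟨Cd, hCd, hd⟩ := amap_sub_id m b hb
  set Cm : ℝ := 2 ^ (m + 2) * Cx with hCm
  have hCm0 : 0 ≤ Cm := by positivity
  refine ⟨max Cd (4 * 4 ^ (m + 2) * Cm + 2 ^ (m + 2) * (Ci * Ch) + Cc * (Ci * Ch) * (Ch * b)),
    le_max_of_le_left hCd, fun β μ V hβ aV bV hμ => ?_⟩
  have hβ0 := bV.nonneg (by omega)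
  have hμ0 : 0 ≤ μ := (abs_nonneg _).trans (hμ 0)
  have sh := hmap_smooth aV.smooth
  constructor
  · exact (DerivBound.of_sub_id aV.amap_smooth (hd β V hβ aV bV)).mono le_rfl le_rfl
      (by gcongr; exact le_max_left _ _)
  have kh := hh β V aV.smooth bV
  have kb : Ch * β ≤ Ch * b := by gcongr
  have kh1 : DerivBound 1 (m + 1) (2 + Ch * b) (hmap V) :=
    (DerivBound.one_of_two aV.abs_deriv_hmap kh (by positivity) (by norm_num)).mono le_rfl le_rfl
      (by gcongr)
  have ktop : ∀ x, |iteratedDeriv (m + 2) (hmap V) x| ≤ μ + Cm * β := by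
    intro x
    rw [iteratedDeriv_hmap aV.smooth, iteratedDeriv_fun_id_two (by omega), zero_add]
    have h1 := abs_iteratedDeriv_mul_sub_le aV.smooth chi_smooth (n := m + 2) (c := β) (d := Cx) x
      hβ0 (by positivity) (fun i hi => bV i (Nat.zero_le _) (by omega) x)
      (fun i _ h2 => hx i (Nat.zero_le _) h2 x)
    have e : (fun x => chi x * V x) = fun x => V x * chi x := by funext x; ring
    rw [e]
    have h2 : |iteratedDeriv (m + 2) V x * chi x| ≤ μ * 1 := by
      rw [abs_mul, abs_of_nonneg (chi_nonneg x)]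
      exact mul_le_mul (hμ x) (chi_le_one x) (chi_nonneg x) hμ0
    have h3 := abs_add_le (iteratedDeriv (m + 2) (fun x => V x * chi x) x -
      iteratedDeriv (m + 2) V x * chi x) (iteratedDeriv (m + 2) V x * chi x)
    rw [sub_add_cancel] at h3
    have e2 : 2 ^ (m + 2) * β * Cx = Cm * β := by rw [hCm]; ring
    linarith
  obtain ⟨kI, kItop⟩ := hi (Ch * β) (μ + Cm * β) (hmap V) (imap V) (by positivity) kb sh
    aV.imap_smooth aV.hmap_imap aV.half_le kh ktop
  intro x
  have k5 := hc (Ci * (Ch * β)) (Ch * β) (imap V) (fun x => hmap V x - 1) (by positivity)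
    (by positivity) aV.imap_smooth (sh.sub contDiff_const) kI (kh.sub_const (by omega) 1)
    (kh1.sub_const le_rfl 1) x
  rw [iteratedDeriv_sub_const_fun (m + 2) (by omega), deriv_sub_const] at k5
  have e : iteratedDeriv (m + 2) (amap V) x =
      iteratedDeriv (m + 2) (fun x => imap V (hmap V x - 1)) x :=
    iteratedDeriv_add_const_fun (m + 2) (by omega) 1 x
  rw [e]
  set X := iteratedDeriv (m + 2) (fun x => imap V (hmap V x - 1)) x
  set y := hmap V x - 1
  set μ' := μ + Cm * β with hμ'
  have hμ'0 : 0 ≤ μ' := by positivity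
  have k6 : |iteratedDeriv (m + 2) (imap V) y * deriv (hmap V) x ^ (m + 2)| ≤
      (2 ^ (m + 3) * μ' + Ci * (Ch * β)) * 2 ^ (m + 2) := by
    rw [abs_mul, abs_pow]
    gcongr
    · exact kItop y
    · exact aV.abs_deriv_hmap x
  have k7 : |deriv (imap V) y * iteratedDeriv (m + 2) (hmap V) x| ≤ 2 * μ' := by
    rw [abs_mul]
    gcongr
    · exact abs_deriv_inverse_le sh aV.imap_smooth aV.hmap_imap aV.half_le y
    · exact ktop x
  have k8 : |X| ≤ Cc * (Ci * (Ch * β)) * (Ch * β) + (2 ^ (m + 3) * μ' + Ci * (Ch * β)) *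
      2 ^ (m + 2) + 2 * μ' := by
    rw [abs_le] at k5 k6 k7 ⊢
    constructor <;> linarith [k5.1, k5.2, k6.1, k6.2, k7.1, k7.2]
  have k9 : Cc * (Ci * (Ch * β)) * (Ch * β) ≤ Cc * (Ci * (Ch * β)) * (Ch * b) := by gcongr
  have h4 : (2:ℝ) ^ (m + 2) * 2 ^ (m + 2) = 4 ^ (m + 2) := by rw [← mul_pow]; norm_num
  have h5 : (1:ℝ) ≤ 4 ^ (m + 2) := one_le_pow₀ (by norm_num)
  have k10 : 2 ^ (m + 3) * μ' * 2 ^ (m + 2) + 2 * μ' ≤ 4 * 4 ^ (m + 2) * μ' := by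
    have : (2:ℝ) ^ (m + 3) * μ' * 2 ^ (m + 2) = 2 * 4 ^ (m + 2) * μ' := by rw [← h4]; ring
    rw [this]
    nlinarith
  have k11 : max Cd (4 * 4 ^ (m + 2) * Cm + 2 ^ (m + 2) * (Ci * Ch) + Cc * (Ci * Ch) * (Ch * b))
      * β ≥ (4 * 4 ^ (m + 2) * Cm + 2 ^ (m + 2) * (Ci * Ch) + Cc * (Ci * Ch) * (Ch * b)) * β := by
    gcongr; exact le_max_right _ _
  have e5 : 4 * 4 ^ (m + 2) * μ' = 4 * 4 ^ (m + 2) * μ + 4 * 4 ^ (m + 2) * Cm * β := by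
    rw [hμ']; ring
  nlinarith

/-- The iterates of `F` composed with the unit translation. -/
def giter (F : ℝ → ℝ) : ℕ → ℝ → ℝ
  | 0, x => x
  | i + 1, x => F (giter F i x + 1)

theorem giter_smooth {F : ℝ → ℝ} (sF : IsSmooth F) (i : ℕ) : IsSmooth (giter F i) := by
  induction i with
  | zero => exact smooth_id
  | succ i ih => exact sF.comp (ih.add contDiff_const)

theorem giter_succ_fun (F : ℝ → ℝ) (i : ℕ) : giter F (i + 1) = fun x => F (giter F i x + 1) := rfl

theorem giter_succ' (F : ℝ → ℝ) (i : ℕ) (x : ℝ) : giter F (i + 1) x = giter F i (F (x + 1)) := by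
  induction i with
  | zero => rfl
  | succ i ih => rw [giter, ih]; rfl

theorem deriv_giter_le {F : ℝ → ℝ} (sF : IsSmooth F) {κ : ℝ} (hF : ∀ x, |deriv F x| ≤ 1 + κ)
    (i : ℕ) (x : ℝ) : |deriv (giter F i) x| ≤ (1 + κ) ^ i := by
  induction i with
  | zero =>
    have : giter F 0 = fun x => x := rfl
    rw [this]; simp
  | succ i ih =>
    rw [giter_succ_fun, deriv_comp_fun sF ((giter_smooth sF i).add contDiff_const), abs_mul,
      deriv_add_const, pow_succ, mul_comm]
    exact mul_le_mul ih (hF _) (abs_nonneg _) ((abs_nonneg _).trans ih)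

theorem deriv_giter_le_two {F : ℝ → ℝ} (sF : IsSmooth F) {κ : ℝ} (hκ : 0 ≤ κ)
    (hF : ∀ x, |deriv F x| ≤ 1 + κ) {l : ℕ} (hl : (1 + κ) ^ l ≤ 2) {i : ℕ} (hi : i ≤ l) (x : ℝ) :
    |deriv (giter F i) x| ≤ 2 :=
  (deriv_giter_le sF hF i x).trans ((pow_le_pow_right₀ (by linarith) hi).trans hl)

theorem giter_top (m l : ℕ) (b C : ℝ) (hb : 0 ≤ b) (hC : 0 ≤ C) :
    ∃ C' : ℝ, 0 ≤ C' ∧ ∀ (β ν κ : ℝ) (F : ℝ → ℝ),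
    0 ≤ β → β ≤ b → 0 ≤ κ → IsSmooth F → (∀ x, |deriv F x| ≤ 1 + κ) → (1 + κ) ^ l ≤ 2 →
    DerivBound 2 (m + 1) β F → (∀ i ≤ l, DerivBound 2 (m + 1) (C * β) (giter F i)) →
    (∀ x, |iteratedDeriv (m + 2) F x| ≤ ν) → ∀ i ≤ l, ∀ x,
    |iteratedDeriv (m + 2) (giter F i) x| ≤ 2 * l * (2 ^ (m + 2) * ν + C' * β) := by
  obtain ⟨Cs, hCs, hs⟩ := comp_sharp m (2 + C * b) (by positivity)
  refine ⟨Cs * (C * b), by positivity, fun β ν κ F hβ hβb hκ sF hF hl bF bG hν => ?_⟩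
  have hν0 : 0 ≤ ν := (abs_nonneg _).trans (hν 0)
  set X := 2 ^ (m + 2) * ν + Cs * (C * b) * β with hX
  have hX0 : 0 ≤ X := by positivity
  have main : ∀ i ≤ l, ∀ x, |iteratedDeriv (m + 2) (giter F i) x| ≤ (1 + κ) ^ i * i * X := by
    intro i
    induction i with
    | zero =>
      intro _ x
      have : giter F 0 = fun x => x := rfl
      rw [this, iteratedDeriv_fun_id_two (by omega)]; simp
    | succ i ih =>
      intro hi x
      have hi' : i ≤ l := by omega
      have sG := giter_smooth sF i
      have h2 := deriv_giter_le_two sF hκ hF hl hi'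
      have k1 := hs β (C * β) F (fun x => giter F i x + 1) hβ (by positivity) sF
        (sG.add contDiff_const) bF ((bG i hi').add_const (by omega) 1)
        (((DerivBound.one_of_two h2 (bG i hi') (by positivity) (by norm_num)).mono le_rfl le_rfl
          (by gcongr)).add_const le_rfl 1) x
      rw [iteratedDeriv_add_const_fun (m + 2) (by omega), deriv_add_const,
        ← giter_succ_fun] at k1
      have k2 : |iteratedDeriv (m + 2) F (giter F i x + 1) * deriv (giter F i) x ^ (m + 2)| ≤
          ν * 2 ^ (m + 2) := by
        rw [abs_mul, abs_pow]
        gcongr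
        · exact hν _
        · exact h2 x
      have k3 : |deriv F (giter F i x + 1) * iteratedDeriv (m + 2) (giter F i) x| ≤
          (1 + κ) * ((1 + κ) ^ i * i * X) := by
        rw [abs_mul]
        gcongr
        · exact hF _
        · exact ih hi' x
      have k4 : Cs * β * (C * β) ≤ Cs * (C * b) * β := by
        calc Cs * β * (C * β) ≤ Cs * β * (C * b) := by gcongr
          _ = _ := by ring
      have k5 : |iteratedDeriv (m + 2) (giter F (i + 1)) x| ≤
          X + (1 + κ) ^ (i + 1) * i * X := by
        have e : (1 + κ) * ((1 + κ) ^ i * i * X) = (1 + κ) ^ (i + 1) * i * X := by ring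
        rw [e] at k3
        rw [abs_le] at k1 k2 k3 ⊢
        constructor <;> linarith [k1.1, k1.2, k2.1, k2.2, k3.1, k3.2]
      refine k5.trans ?_
      have k6 : 1 * X ≤ (1 + κ) ^ (i + 1) * X := by
        gcongr; exact one_le_pow₀ (by linarith)
      push_cast
      linarith
  intro i hi x
  refine (main i hi x).trans ?_
  have h1 : (1 + κ) ^ i ≤ 2 := (pow_le_pow_right₀ (by linarith) hi).trans hl
  have h2 : (i : ℝ) ≤ l := by exact_mod_cast hi
  gcongr

theorem giter_low (m l : ℕ) (b : ℝ) (hb : 0 ≤ b) :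
    ∃ C : ℝ, 0 ≤ C ∧ ∀ (β κ : ℝ) (F : ℝ → ℝ),
    0 ≤ β → β ≤ b → 0 ≤ κ → IsSmooth F → (∀ x, |deriv F x| ≤ 1 + κ) → (1 + κ) ^ l ≤ 2 →
    DerivBound 2 (m + 1) β F → ∀ i ≤ l, DerivBound 2 (m + 1) (C * β) (giter F i) := by
  induction m with
  | zero => exact ⟨0, le_rfl, fun _ _ _ _ _ _ _ _ _ _ _ _ j h1 h2 => by omega⟩
  | succ m ih =>
    obtain ⟨C, hC, ih⟩ := ih
    obtain ⟨C', hC', h'⟩ := giter_top m l b C hb hC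
    refine ⟨C + 2 * l * (2 ^ (m + 2) + C'), by positivity,
      fun β κ F hβ hβb hκ sF hF hl bF i hi => ?_⟩
    have k1 := ih β κ F hβ hβb hκ sF hF hl (bF.mono le_rfl (by omega) le_rfl)
    have k2 := h' β β κ F hβ hβb hκ sF hF hl (bF.mono le_rfl (by omega) le_rfl) k1
      (fun x => bF (m + 2) (by omega) (by omega) x)
    intro j h1 h2 x
    have h5 : 0 ≤ 2 * l * (2 ^ (m + 2) * β + C' * β) := by positivity
    have h6 : 0 ≤ C * β := by positivity
    have e : (C + 2 * l * (2 ^ (m + 2) + C')) * β =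
      C * β + 2 * l * (2 ^ (m + 2) * β + C' * β) := by ring
    rw [e]
    rcases Nat.lt_or_ge j (m + 2) with h3 | h3
    · linarith [k1 i hi j h1 (by omega) x]
    · obtain rfl : j = m + 2 := by omega
      linarith [k2 i hi x]

theorem giter_derivBound (m l : ℕ) (b : ℝ) (hb : 0 ≤ b) :
    ∃ C : ℝ, 0 ≤ C ∧ ∀ (β ν κ : ℝ) (F : ℝ → ℝ),
    0 ≤ β → β ≤ b → 0 ≤ κ → IsSmooth F → (∀ x, |deriv F x| ≤ 1 + κ) → (1 + κ) ^ l ≤ 2 →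
    DerivBound 2 (m + 1) β F → (∀ x, |iteratedDeriv (m + 2) F x| ≤ ν) → ∀ i ≤ l,
    DerivBound 2 (m + 1) (C * β) (giter F i) ∧ ∀ x,
    |iteratedDeriv (m + 2) (giter F i) x| ≤ 2 * l * (2 ^ (m + 2) * ν + C * β) := by
  obtain ⟨C, hC, h₁⟩ := giter_low m l b hb
  obtain ⟨C', hC', h₂⟩ := giter_top m l b C hb hC
  refine ⟨max C C', le_max_of_le_left hC, fun β ν κ F hβ hβb hκ sF hF hl bF hν i hi => ?_⟩
  have k1 := h₁ β κ F hβ hβb hκ sF hF hl bF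
  refine ⟨(k1 i hi).mono le_rfl le_rfl (by gcongr; exact le_max_left _ _), fun x => ?_⟩
  refine (h₂ β ν κ F hβ hβb hκ sF hF hl bF k1 hν i hi x).trans ?_
  gcongr
  exact le_max_right _ _

/-- Dependence of the iterates on the map, in `C^0` to `C^3`. -/
theorem giter_sub (l : ℕ) : ∃ C : ℝ, 0 ≤ C ∧
    ∀ (w₀ w₃ ε κ : ℝ) (F F' : ℝ → ℝ), 0 ≤ ε → ε ≤ 1 → 0 ≤ κ → κ ≤ 1 → (1 + κ) ^ l ≤ 2 →
    IsSmooth F → IsSmooth F' → (∀ x, |deriv F x| ≤ 1 + κ) → (∀ x, |deriv F' x| ≤ 1 + κ) →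
    DerivBound 2 4 ε F → DerivBound 1 4 ε (fun x => F' x - x) →
    DerivBound 0 3 w₀ (fun x => F x - F' x) →
    (∀ x, |iteratedDeriv 3 (fun x => F x - F' x) x| ≤ w₃) → ∀ i ≤ l,
    DerivBound 0 3 (C * w₀) (fun x => giter F i x - giter F' i x) ∧
    ∀ x, |iteratedDeriv 3 (fun x => giter F i x - giter F' i x) x| ≤
      l * (8 * w₃ + C * ε * w₀) := by
  obtain ⟨Cg, hCg, hg⟩ := giter_low 2 l 1 (by norm_num)
  obtain ⟨C₁, hC₁, h₁⟩ := derivBound_comp 3 (2 + Cg)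
  obtain ⟨C₂, hC₂, h₂⟩ := derivBound_comp_sub 3 (2 + Cg)
  obtain ⟨C₃, hC₃, h₃⟩ := comp_sharp 1 (2 + Cg) (by positivity)
  have main : ∀ i ≤ l, ∃ K : ℝ, 0 ≤ K ∧
    ∀ (w₀ w₃ ε κ : ℝ) (F F' : ℝ → ℝ), 0 ≤ ε → ε ≤ 1 → 0 ≤ κ → κ ≤ 1 → (1 + κ) ^ l ≤ 2 →
    IsSmooth F → IsSmooth F' → (∀ x, |deriv F x| ≤ 1 + κ) → (∀ x, |deriv F' x| ≤ 1 + κ) →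
    DerivBound 2 4 ε F → DerivBound 1 4 ε (fun x => F' x - x) →
    DerivBound 0 3 w₀ (fun x => F x - F' x) →
    (∀ x, |iteratedDeriv 3 (fun x => F x - F' x) x| ≤ w₃) →
    DerivBound 0 3 (K * w₀) (fun x => giter F i x - giter F' i x) ∧
    ∀ x, |iteratedDeriv 3 (fun x => giter F i x - giter F' i x) x| ≤
      i * (8 * w₃ + K * ε * w₀) := by
    intro i
    induction i with
    | zero =>
      intro _
      refine ⟨0, le_rfl, fun w₀ w₃ ε κ F F' hε hε1 hκ hκ1 hl sF sF' hF hF' bF bF' hw hw3 => ?_⟩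
      have e : (fun x => giter F 0 x - giter F' 0 x) = fun _ => 0 := by
        funext x; simp [giter]
      rw [e]
      constructor
      · intro j _ _ x
        rw [iteratedDeriv_const]; simp
      · intro x
        rw [iteratedDeriv_const]; simp
    | succ i ih =>
      intro hi
      have hi' : i ≤ l := by omega
      obtain ⟨K, hK, ih⟩ := ih hi'
      refine ⟨max (C₁ + K + C₂ * K) (max K (Cg + C₃ * Cg + C₂ * K)),
        le_max_of_le_left (by positivity),
        fun w₀ w₃ ε κ F F' hε hε1 hκ hκ1 hl sF sF' hF hF' bF bF' hw hw3 => ?_⟩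
      obtain ⟨ih0, ih3⟩ := ih w₀ w₃ ε κ F F' hε hε1 hκ hκ1 hl sF sF' hF hF' bF bF' hw hw3
      have hw0 := hw.nonneg (by omega)
      have hw30 : 0 ≤ w₃ := (abs_nonneg _).trans (hw3 0)
      have bF2' : DerivBound 2 4 ε F' := fun j h1 h2 x => by
        have := bF' j (by omega) h2 x
        rwa [iteratedDeriv_sub_fun sF' smooth_id, iteratedDeriv_fun_id_two h1, sub_zero] at this
      have sG := giter_smooth sF i
      have sG' := giter_smooth sF' i
      have bG := hg ε κ F hε hε1 hκ sF hF hl (bF.mono le_rfl (by omega) le_rfl) i hi'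
      have bG' := hg ε κ F' hε hε1 hκ sF' hF' hl (bF2'.mono le_rfl (by omega) le_rfl) i hi'
      have one : ∀ G : ℝ → ℝ, (∀ x, |deriv G x| ≤ 2) → DerivBound 2 (2 + 1) (Cg * ε) G →
          DerivBound 1 3 (2 + Cg) (fun x => G x + 1) := fun G h1 h2 =>
        ((DerivBound.one_of_two h1 h2 (by positivity) (by norm_num)).mono le_rfl le_rfl
          (by nlinarith)).add_const le_rfl 1
      have oG := one _ (deriv_giter_le_two sF hκ hF hl hi') bG
      have oG' := one _ (deriv_giter_le_two sF' hκ hF' hl hi') bG'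
      have sG1 : IsSmooth (fun x => giter F i x + 1) := sG.add contDiff_const
      have sG1' : IsSmooth (fun x => giter F' i x + 1) := sG'.add contDiff_const
      have sw : IsSmooth (fun x => F x - F' x) := sF.sub sF'
      have su : IsSmooth (fun x => F' x - x) := sF'.sub smooth_id
      have t1 := h₁ w₀ _ _ sw sG1 hw oG
      have t2 := h₂ ε (K * w₀) _ _ _ su sG1 sG1' bF' oG oG' (ih0.congr_fun fun x => by ring)
      have s1 := sw.comp_fun sG1
      have s2 : IsSmooth (fun x => (F' (giter F i x + 1) - (giter F i x + 1)) -
        (F' (giter F' i x + 1) - (giter F' i x + 1))) := (su.comp_fun sG1).sub (su.comp_fun sG1')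
      have s3 : IsSmooth (fun x => giter F i x - giter F' i x) := sG.sub sG'
      have s12 := s1.add s2
      have e : (fun x => giter F (i + 1) x - giter F' (i + 1) x) = fun x =>
          ((F (giter F i x + 1) - F' (giter F i x + 1)) +
          ((F' (giter F i x + 1) - (giter F i x + 1)) -
          (F' (giter F' i x + 1) - (giter F' i x + 1)))) +
          (giter F i x - giter F' i x) := by
        funext x; simp only [giter]; ring
      rw [e]
      have hC2 : C₂ * ε * (K * w₀) ≤ C₂ * K * w₀ := by
        calc C₂ * ε * (K * w₀) ≤ C₂ * 1 * (K * w₀) := by gcongr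
          _ = _ := by ring
      constructor
      · refine ((t1.add t2 s1 s2).add ih0 s12 s3).mono le_rfl le_rfl ?_
        calc _ ≤ (C₁ + K + C₂ * K) * w₀ := by linarith
          _ ≤ _ := by gcongr; exact le_max_left _ _
      · intro x
        rw [iteratedDeriv_add_fun s12 s3, iteratedDeriv_add_fun s1 s2]
        have q1 := h₃ w₀ (Cg * ε) _ _ hw0 (by positivity) sw sG1
          (hw.mono (by omega) (by omega) le_rfl) ((bG.mono le_rfl (by omega) le_rfl).add_const
          (by omega) 1) (oG.mono le_rfl (by omega) le_rfl) x
        rw [iteratedDeriv_add_const_fun (1 + 2) (by omega), deriv_add_const] at q1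
        have q2 : |iteratedDeriv 3 (fun x => F x - F' x) (giter F i x + 1) *
            deriv (giter F i) x ^ 3| ≤ w₃ * 8 := by
          rw [abs_mul, abs_pow, show (8 : ℝ) = 2 ^ 3 by norm_num]
          gcongr
          · exact hw3 _
          · exact deriv_giter_le_two sF hκ hF hl hi' x
        have q3 : |deriv (fun x => F x - F' x) (giter F i x + 1) *
            iteratedDeriv 3 (giter F i) x| ≤ w₀ * (Cg * ε) := by
          rw [abs_mul]
          gcongr
          · have := hw 1 (by omega) (by omega) (giter F i x + 1)
            rwa [iteratedDeriv_one] at this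
          · exact bG 3 (by omega) (by omega) x
        have q4 := t2 3 (by omega) (by omega) x
        have q5 := ih3 x
        norm_num only at q1
        set M := max (C₁ + K + C₂ * K) (max K (Cg + C₃ * Cg + C₂ * K)) with hM
        have m1 : K * (ε * w₀) ≤ M * (ε * w₀) := by
          gcongr; exact (le_max_left _ _).trans (le_max_right _ _)
        have m2 : (Cg + C₃ * Cg + C₂ * K) * (ε * w₀) ≤ M * (ε * w₀) := by
          gcongr; exact (le_max_right _ _).trans (le_max_right _ _)
        have m3 : (i:ℝ) * (K * (ε * w₀)) ≤ i * (M * (ε * w₀)) := by gcongr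
        have z1 := abs_add_three (iteratedDeriv 3 (fun x => F (giter F i x + 1) -
          F' (giter F i x + 1)) x) (iteratedDeriv 3 (fun x => F' (giter F i x + 1) -
          (giter F i x + 1) - (F' (giter F' i x + 1) - (giter F' i x + 1))) x)
          (iteratedDeriv 3 (fun x => giter F i x - giter F' i x) x)
        have z2 : |iteratedDeriv 3 (fun x => F (giter F i x + 1) - F' (giter F i x + 1)) x| ≤
            w₃ * 8 + w₀ * (Cg * ε) + C₃ * w₀ * (Cg * ε) := by
          rw [abs_le] at q1 q2 q3 ⊢
          constructor <;> linarith [q1.1, q1.2, q2.1, q2.2, q3.1, q3.2]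
        push_cast
        linarith
  choose! K hK hmain using main
  refine ⟨∑ i ∈ Finset.range (l + 1), |K i|, Finset.sum_nonneg fun _ _ => abs_nonneg _,
    fun w₀ w₃ ε κ F F' hε hε1 hκ hκ1 hl sF sF' hF hF' bF bF' hw hw3 i hi => ?_⟩
  have hw0 := hw.nonneg (by omega)
  have hw30 : 0 ≤ w₃ := (abs_nonneg _).trans (hw3 0)
  have h1 : K i ≤ ∑ i ∈ Finset.range (l + 1), |K i| := (le_abs_self _).trans
    (Finset.single_le_sum (f := fun j => |K j|) (fun _ _ => abs_nonneg _)
        (Finset.mem_range.2 (by omega)))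
  obtain ⟨r1, r2⟩ := hmain i hi w₀ w₃ ε κ F F' hε hε1 hκ hκ1 hl sF sF' hF hF' bF bF' hw hw3
  refine ⟨r1.mono le_rfl le_rfl (by gcongr), fun x => (r2 x).trans ?_⟩
  have h2 : (i : ℝ) ≤ l := by exact_mod_cast hi
  have := hK i hi
  gcongr

/-- Conjugation of `f` by the homothety of ratio `A`. -/
def dilate (A : ℝ) (f : ℝ → ℝ) (x : ℝ) : ℝ := A * f (x / A)

theorem dilate_smooth (A : ℝ) {f : ℝ → ℝ} (sf : IsSmooth f) : IsSmooth (dilate A f) :=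
  contDiff_const.mul (sf.comp (contDiff_id.div_const A))

theorem iteratedDeriv_dilate (A : ℝ) {f : ℝ → ℝ} (sf : IsSmooth f) (n : ℕ) (x : ℝ) :
    iteratedDeriv n (dilate A f) x = A * (A⁻¹ ^ n * iteratedDeriv n f (x / A)) := by
  have h1 : iteratedDeriv n (dilate A f) x = A * iteratedDeriv n (fun x => f (A⁻¹ * x)) x := by
    rw [← iteratedDeriv_const_mul_field]
    congr 1; funext y; simp [dilate, div_eq_inv_mul]
  have h2 := congrFun (iteratedDeriv_comp_const_mul (sf.of_nat n) A⁻¹) x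
  rw [h1, h2]; simp [div_eq_inv_mul]

theorem dilate_iter_le {A : ℝ} (hA : 1 ≤ A) {f : ℝ → ℝ} (sf : IsSmooth f) {n : ℕ} {x c : ℝ}
    (h : |iteratedDeriv (n + 1) f (x / A)| ≤ c) :
    |iteratedDeriv (n + 1) (dilate A f) x| ≤ A⁻¹ ^ n * c := by
  rw [iteratedDeriv_dilate A sf]
  have e : A * (A⁻¹ ^ (n + 1) * iteratedDeriv (n + 1) f (x / A)) =
      A⁻¹ ^ n * iteratedDeriv (n + 1) f (x / A) := by
    rw [pow_succ]; field_simp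
  rw [e, abs_mul, abs_of_nonneg (by positivity)]
  gcongr

theorem DerivBound.dilate {A : ℝ} (hA : 1 ≤ A) {f : ℝ → ℝ} (sf : IsSmooth f) {i k : ℕ} {c : ℝ}
    (hi : 1 ≤ i) (h : DerivBound i k c f) : DerivBound i k c (dilate A f) := fun j h1 h2 x => by
  obtain ⟨n, rfl⟩ : ∃ n, j = n + 1 := ⟨j - 1, by omega⟩
  refine (dilate_iter_le hA sf (h _ h1 h2 _)).trans ?_
  refine mul_le_of_le_one_left ((abs_nonneg _).trans (h _ h1 h2 0)) ?_
  exact pow_le_one₀ (by positivity) (inv_le_one_of_one_le₀ hA)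

theorem DerivBound.dilate_zero {A : ℝ} (hA : 1 ≤ A) {f : ℝ → ℝ} (sf : IsSmooth f) {k : ℕ} {c : ℝ}
    (h : DerivBound 0 k c f) : DerivBound 0 k (A * c) (_root_.dilate A f) := fun j h1 h2 x => by
  have hc := h.nonneg (Nat.zero_le _)
  rcases j with _ | n
  · simp only [iteratedDeriv_zero, _root_.dilate]
    rw [abs_mul, abs_of_pos (by linarith)]
    gcongr
    exact h.apply_zero _
  · refine ((h.mono (Nat.zero_le 1) le_rfl le_rfl).dilate hA sf le_rfl _ (by omega) h2 x).trans ?_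
    nlinarith

/-- The periodic extension of `x ↦ giter F l x - l` from `[0, 1)`. -/
def rollMap (F : ℝ → ℝ) (l : ℕ) (x : ℝ) : ℝ := giter F l (Int.fract x) - l + ⌊x⌋

theorem rollMap_add_one (F : ℝ → ℝ) (l : ℕ) (x : ℝ) : rollMap F l (x + 1) = rollMap F l x + 1 := by
  simp [rollMap]; ring

/-- `F` is the identity near the two ends and does not move points to the left too much. -/
structure Rollable (F : ℝ → ℝ) (A : ℝ) (l : ℕ) : Prop where
  smooth : IsSmooth F
  left : ∀ x ≤ 1, F x = x
  right : ∀ x, 7 / 4 * A ≤ x → F x = x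
  lower : ∀ x, x - 1 / 8 ≤ F x
  len : 2 * A + 4 ≤ l

theorem Rollable.giter_lower {F : ℝ → ℝ} {A : ℝ} {l : ℕ} (h : Rollable F A l) (i : ℕ) (x : ℝ) :
    x + 7 / 8 * i ≤ giter F i x := by
  induction i with
  | zero => simp [giter]
  | succ i ih =>
    have := h.lower (giter F i x + 1)
    rw [giter]; push_cast; linarith

theorem Rollable.giter_add_one {F : ℝ → ℝ} {A : ℝ} {l : ℕ} (h : Rollable F A l) (hA : 0 ≤ A)
    {x : ℝ} (h1 : -1 ≤ x) (h2 : x ≤ 0) : giter F l (x + 1) = giter F l x + 1 := by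
  obtain ⟨n, rfl⟩ : ∃ n, l = n + 1 := ⟨l - 1, by
    have : (0:ℝ) < l := by linarith [h.len]
    have : 0 < l := by exact_mod_cast this
    omega⟩
  have hl := h.len
  push_cast at hl
  have e : giter F (n + 1) x = giter F n (x + 1) := by
    rw [giter_succ', h.left _ (by linarith)]
  rw [e, giter, h.right]
  linarith [h.giter_lower n (x + 1)]

theorem Rollable.rollMap_eq {F : ℝ → ℝ} {A : ℝ} {l : ℕ} (h : Rollable F A l) (hA : 0 ≤ A)
    {x : ℝ} {m : ℤ} (h1 : -1 < x - m) (h2 : x - m < 1) :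
    rollMap F l x = giter F l (x - m) - l + m := by
  rcases lt_or_ge (x - m) 0 with h0 | h0
  · have e : ⌊x⌋ = m - 1 := by
      rw [Int.floor_eq_iff]; push_cast; constructor <;> linarith
    have e2 : Int.fract x = (x - m) + 1 := by
      rw [Int.fract, e]; push_cast; ring
    rw [rollMap, e, e2, h.giter_add_one hA h1.le h0.le]
    push_cast; ring
  · have e : ⌊x⌋ = m := by
      rw [Int.floor_eq_iff]; constructor <;> linarith
    rw [rollMap, Int.fract, e]

theorem Rollable.rollMap_eventuallyEq {F : ℝ → ℝ} {A : ℝ} {l : ℕ} (h : Rollable F A l) (hA : 0 ≤ A)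
    (x : ℝ) : rollMap F l =ᶠ[nhds x] fun y => giter F l (y - ⌊x⌋) - l + ⌊x⌋ := by
  have h1 := Int.floor_le x
  have h2 := Int.lt_floor_add_one x
  filter_upwards [Ioo_mem_nhds (show (⌊x⌋:ℝ) - 1 < x by linarith) (show x < ⌊x⌋ + 1 by linarith)]
    with y hy
  exact h.rollMap_eq hA (by linarith [hy.1]) (by linarith [hy.2])

theorem Rollable.rollMap_smooth {F : ℝ → ℝ} {A : ℝ} {l : ℕ} (h : Rollable F A l) (hA : 0 ≤ A) :
    IsSmooth (rollMap F l) := by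
  refine contDiff_iff_contDiffAt.2 fun x => ?_
  refine ContDiffAt.congr_of_eventuallyEq ?_ (h.rollMap_eventuallyEq hA x)
  have : IsSmooth (fun y => giter F l (y - ⌊x⌋) - l + ⌊x⌋) :=
    (((giter_smooth h.smooth l).comp (contDiff_id.sub contDiff_const)).sub
      contDiff_const).add contDiff_const
  exact this.contDiffAt

theorem iteratedDeriv_comp_sub_fun (f : ℝ → ℝ) (n : ℕ) (c x : ℝ) :
    iteratedDeriv n (fun y => f (y - c)) x = iteratedDeriv n f (x - c) := by
  rw [iteratedDeriv_comp_sub_const]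

theorem Rollable.iteratedDeriv_rollMap {F : ℝ → ℝ} {A : ℝ} {l : ℕ} (h : Rollable F A l) (hA : 0 ≤ A)
    {n : ℕ} (hn : 1 ≤ n) (x : ℝ) :
    iteratedDeriv n (rollMap F l) x = iteratedDeriv n (giter F l) (x - ⌊x⌋) := by
  rw [(h.rollMap_eventuallyEq hA x).iteratedDeriv_eq, iteratedDeriv_add_const_fun n hn,
    iteratedDeriv_sub_const_fun n hn, iteratedDeriv_comp_sub_fun]

theorem Rollable.iteratedDeriv_rollMap_sub {F F' : ℝ → ℝ} {A : ℝ} {l : ℕ} (h : Rollable F A l)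
    (h' : Rollable F' A l) (hA : 0 ≤ A) (n : ℕ) (x : ℝ) :
    iteratedDeriv n (fun x => rollMap F l x - rollMap F' l x) x =
      iteratedDeriv n (fun x => giter F l x - giter F' l x) (x - ⌊x⌋) := by
  have : (fun x => rollMap F l x - rollMap F' l x) =ᶠ[nhds x]
      fun y => (fun x => giter F l x - giter F' l x) (y - ⌊x⌋) := by
    filter_upwards [h.rollMap_eventuallyEq hA x, h'.rollMap_eventuallyEq hA x] with y h1 h2
    rw [h1, h2]; ring
  rw [this.iteratedDeriv_eq]
  exact iteratedDeriv_comp_sub_fun (fun x => giter F l x - giter F' l x) n _ x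

theorem Rollable.rollMap_derivBound {F : ℝ → ℝ} {A : ℝ} {l : ℕ} (h : Rollable F A l) (hA : 0 ≤ A)
    {i k : ℕ} {c : ℝ} (hi : 1 ≤ i) (hb : DerivBound i k c (giter F l)) :
    DerivBound i k c (rollMap F l) := fun j h1 h2 x => by
  rw [h.iteratedDeriv_rollMap hA (hi.trans h1)]; exact hb j h1 h2 _

theorem Rollable.rollMap_sub_derivBound {F F' : ℝ → ℝ} {A : ℝ} {l : ℕ} (h : Rollable F A l)
    (h' : Rollable F' A l) (hA : 0 ≤ A)
    {i k : ℕ} {c : ℝ} (hb : DerivBound i k c (fun x => giter F l x - giter F' l x)) :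
    DerivBound i k c (fun x => rollMap F l x - rollMap F' l x) := fun j h1 h2 x => by
  rw [h.iteratedDeriv_rollMap_sub h' hA]; exact hb j h1 h2 _

/-- The dilated building block. -/
def amapS (A : ℕ) (V : ℝ → ℝ) : ℝ → ℝ := dilate A (amap V)

/-- Its rolled-up map. -/
def rollS (A : ℕ) (V : ℝ → ℝ) : ℝ → ℝ := rollMap (amapS A V) (2 * A + 4)

theorem one_add_pow_le_two {κ : ℝ} (hκ : 0 ≤ κ) {l : ℕ} (h : κ * l ≤ 1 / 2) : (1 + κ) ^ l ≤ 2 := by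
  have h1 : 1 + κ ≤ Real.exp κ := by linarith [Real.add_one_le_exp κ]
  have h2 : (1 + κ) ^ l ≤ Real.exp κ ^ l := by gcongr
  rw [← Real.exp_nat_mul, mul_comm] at h2
  have h3 : Real.exp (κ * l) ≤ Real.exp (1 / 2) := by gcongr
  have h4 := Real.exp_bound_div_one_sub_of_interval (x := 1 / 2) (by norm_num) (by norm_num)
  norm_num at h4
  linarith

/-- Basic properties of the rolling-up construction for small periodic `V`. -/
structure Tame (A : ℕ) (ε : ℝ) (V : ℝ → ℝ) : Prop where
  adm : Admissible V
  per : ∀ x, V (x + 1) = V x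
  small : DerivBound 0 4 ε (fun x => amap V x - x)

theorem exists_tame_const : ∃ C : ℝ, 1 ≤ C ∧ ∀ (A : ℕ) (e : ℝ) (V : ℝ → ℝ), C * e ≤ 1 →
    IsSmooth V → (∀ x, V (x + 1) = V x) → DerivBound 0 4 e V → Tame A (C * e) V := by
  obtain ⟨e₀, he₀, h₀⟩ := exists_admissible
  obtain ⟨C, hC, h₁⟩ := amap_sub_id 3 1 (by norm_num)
  refine ⟨1 + C + 1 / e₀, by linarith [show 0 ≤ 1 / e₀ by positivity],
    fun A e V he sV pV bV => ?_⟩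
  have he0 := bV.nonneg (by omega)
  have h2 : 0 ≤ C * e := by positivity
  have h3 : 0 ≤ 1 / e₀ * e := by positivity
  have h4 : 1 / e₀ * e ≤ 1 := by linarith
  have h5 : e ≤ e₀ := by
    rwa [one_div_mul_eq_div, div_le_one he₀] at h4
  have aV := h₀ V sV (bV.mono le_rfl (by omega) h5)
  exact ⟨aV, pV, (h₁ e V (by linarith) aV bV).mono le_rfl le_rfl (by linarith)⟩

section
variable {A : ℕ} {ε : ℝ} {V : ℝ → ℝ}

theorem Tame.amapS_smooth (h : Tame A ε V) : IsSmooth (amapS A V) :=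
  dilate_smooth _ h.adm.amap_smooth

theorem amapS_sub_id (hA : 1 ≤ A) (x : ℝ) :
    amapS A V x - x = dilate A (fun x => amap V x - x) x := by
  have : (A : ℝ) ≠ 0 := by positivity
  simp only [amapS, dilate]; field_simp

theorem Tame.derivBound_amapS (h : Tame A ε V) (hA : 1 ≤ A) :
    DerivBound 1 4 ε (fun x => amapS A V x - x) := by
  have s : IsSmooth (fun x => amap V x - x) := h.adm.amap_smooth.sub smooth_id
  exact ((h.small.mono (Nat.zero_le 1) le_rfl le_rfl).dilate (by exact_mod_cast hA) s
    le_rfl).congr_fun (amapS_sub_id hA)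

theorem Tame.derivBound_two_amapS (h : Tame A ε V) (hA : 1 ≤ A) :
    DerivBound 2 4 ε (amapS A V) := fun j h1 h2 x => by
  have := h.derivBound_amapS hA j (by omega) h2 x
  rwa [iteratedDeriv_sub_fun h.amapS_smooth smooth_id, iteratedDeriv_fun_id_two h1, sub_zero]
    at this

theorem Tame.deriv_amapS_le (h : Tame A ε V) (hA : 1 ≤ A) (x : ℝ) : |deriv (amapS A V) x| ≤ 1 + ε := by
  have := h.derivBound_amapS hA 1 le_rfl (by omega) x
  rw [iteratedDeriv_sub_fun h.amapS_smooth smooth_id, iteratedDeriv_fun_id_one,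
    iteratedDeriv_one] at this
  rw [abs_le] at this ⊢
  have := h.small.nonneg (by omega)
  constructor <;> linarith

theorem Tame.abs_amapS_sub_le (h : Tame A ε V) (hA : 1 ≤ A) (x : ℝ) : |amapS A V x - x| ≤ A * ε := by
  rw [amapS_sub_id hA, dilate, abs_mul, Nat.abs_cast]
  gcongr
  exact h.small.apply_zero _

theorem Tame.rollable (h : Tame A ε V) (hA : 4 ≤ A) (hε : A * ε ≤ 1 / 8) :
    Rollable (amapS A V) A (2 * A + 4) where
  smooth := h.amapS_smooth
  left x hx := by
    have hA' : (4:ℝ) ≤ A := by exact_mod_cast hA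
    rw [amapS, dilate, h.adm.amap_of_le]
    · field_simp
    · rw [div_le_iff₀ (by linarith)]; linarith
  right x hx := by
    have hA' : (4:ℝ) ≤ A := by exact_mod_cast hA
    rw [amapS, dilate, h.adm.amap_of_ge h.per]
    · field_simp
    · rw [le_div_iff₀ (by linarith)]; linarith
  lower x := by
    have := (abs_le.1 (h.abs_amapS_sub_le (by omega) x)).1
    linarith
  len := by push_cast; linarith

end

/-- Smooth degree one maps `φ` of the line with `|(φ - id)^{(j)}| ≤ e` for `1 ≤ j ≤ k`. -/
structure NearId (k : ℕ) (e : ℝ) (φ : ℝ → ℝ) : Prop where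
  smooth : IsSmooth φ
  add_one : ∀ x, φ (x + 1) = φ x + 1
  bound : DerivBound 1 k e (fun x => φ x - x)

theorem NearId.bound_two {k : ℕ} {e : ℝ} {φ : ℝ → ℝ} (h : NearId k e φ) :
    DerivBound 2 k e φ := fun j h1 h2 x => by
  have := h.bound j (by omega) h2 x
  rwa [iteratedDeriv_sub_fun h.smooth smooth_id, iteratedDeriv_fun_id_two h1, sub_zero] at this

theorem NearId.abs_deriv_le {k : ℕ} {e : ℝ} {φ : ℝ → ℝ} (h : NearId k e φ) (hk : 1 ≤ k)
    (x : ℝ) : |deriv φ x| ≤ 1 + e := by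
  have := h.bound 1 le_rfl hk x
  rw [iteratedDeriv_sub_fun h.smooth smooth_id, iteratedDeriv_fun_id_one,
    iteratedDeriv_one] at this
  have h0 := h.bound.nonneg hk
  rw [abs_le] at this ⊢
  constructor <;> linarith

theorem NearId.bound_one {k : ℕ} {e : ℝ} {φ : ℝ → ℝ} (h : NearId k e φ) (hk : 1 ≤ k) :
    DerivBound 1 k (1 + e) φ := fun j h1 h2 x => by
  rcases Nat.lt_or_ge 1 j with h' | h'
  · exact (h.bound_two j h' h2 x).trans (by linarith)
  · obtain rfl : j = 1 := by omega
    rw [iteratedDeriv_one]; exact h.abs_deriv_le hk x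

theorem amapS_sub_eq {A : ℕ} (V V' : ℝ → ℝ) (x : ℝ) :
    amapS A V x - amapS A V' x = dilate A (fun x => amap V x - amap V' x) x := by
  simp only [amapS, dilate]; ring

/-- Smallness conditions on `ε` that make the rolling-up construction work. -/
structure TameScale (A : ℕ) (ε : ℝ) : Prop where
  four_le : 4 ≤ A
  nonneg : 0 ≤ ε
  le_one : ε ≤ 1
  mul_le : A * ε ≤ 1 / 8
  mul_len : ε * ((2 * A + 4 : ℕ) : ℝ) ≤ 1 / 2

/-- Up to lower order terms, rolling up contracts third derivatives. -/
theorem rollS_contraction : ∃ A₀ : ℕ, ∀ A ≥ A₀, ∃ e > (0 : ℝ), e ≤ 1 ∧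
    ∃ ε C : ℝ, TameScale A ε ∧ 0 ≤ C ∧ (∀ V : ℝ → ℝ, IsSmooth V → (∀ x, V (x + 1) = V x) →
      DerivBound 0 4 e V → Tame A ε V) ∧ ∀ (V V' φ : ℝ → ℝ) (d : ℝ), IsSmooth V → IsSmooth V' → (∀ x, V (x + 1) = V x) →
    (∀ x, V' (x + 1) = V' x) → DerivBound 0 4 e V → DerivBound 0 4 e V' → NearId 3 e φ →
    DerivBound 0 3 d (fun x => V x - V' x) →
    DerivBound 0 3 (C * d) (fun x => rollS A V (φ x) - rollS A V' (φ x)) ∧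
    ∀ x, |iteratedDeriv 3 (fun x => rollS A V (φ x) - rollS A V' (φ x)) x| ≤ d / 8 := by
  obtain ⟨C1, hC1, h1⟩ := exists_tame_const
  obtain ⟨C0, hC0, h0⟩ := amap_sub 3 1 (by norm_num)
  obtain ⟨C2, hC2, h2⟩ := comp_sharp 1 2 (by norm_num)
  obtain ⟨C3, hC3, h3⟩ := derivBound_comp 3 2
  obtain ⟨A₀, hA₀⟩ := exists_nat_ge (192 * 16 * C0 + 4)
  refine ⟨A₀, fun A hA => ?_⟩
  have hA' : (192 * 16 * C0 + 4 : ℝ) ≤ A := hA₀.trans (by exact_mod_cast hA)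
  have hA4 : (4:ℝ) ≤ A := by linarith
  have hA4' : 4 ≤ A := by exact_mod_cast hA4
  obtain ⟨Cg, hCg, hg⟩ := giter_sub (2 * A + 4)
  set W := Cg * (A * C0) with hW
  have hW0 : 0 ≤ W := by positivity
  set K := 1 + 8 * C1 * (A + 4) + 16 * (24 * A * (Cg * C1 * (A * C0)) + W + C2 * W) with hK
  have hK1 : 1 ≤ K := by rw [hK]; nlinarith [show 0 ≤ 8 * C1 * (A + 4) by positivity,
    show 0 ≤ 24 * A * (Cg * C1 * (A * C0)) + W + C2 * W by positivity]
  have hKpos : 0 < K := by linarith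
  refine ⟨1 / K, by positivity, (div_le_one hKpos).2 hK1, C1 * (1 / K), C3 * W, ?_⟩
  set e := 1 / K with he
  have he0 : 0 < e := by positivity
  have hKe : K * e = 1 := by rw [he]; field_simp
  have t1 : 0 ≤ 8 * C1 * (A + 4) * e := by positivity
  have t2 : 0 ≤ 16 * (24 * A * (Cg * C1 * (A * C0)) + W + C2 * W) * e := by positivity
  have t3 : e + 8 * C1 * (A + 4) * e + 16 * (24 * A * (Cg * C1 * (A * C0)) + W + C2 * W) * e
    = 1 := by rw [← hKe, hK]; ring
  have he1 : e ≤ 1 := by linarith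
  have u0 : 0 ≤ C1 * e := by positivity
  have u1 : C1 * e ≤ 1 := by nlinarith
  have u2 : (A:ℝ) * (C1 * e) ≤ 1 / 8 := by nlinarith
  have u3 : C1 * e * ((2 * A + 4 : ℕ) : ℝ) ≤ 1 / 2 := by push_cast; nlinarith
  have S : TameScale A (C1 * e) := ⟨hA4', u0, u1, u2, u3⟩
  have hT : ∀ V : ℝ → ℝ, IsSmooth V → (∀ x, V (x + 1) = V x) → DerivBound 0 4 e V →
      Tame A (C1 * e) V := fun V sV pV bV => h1 A e V u1 sV pV bV
  refine ⟨S, by positivity, hT, fun V V' φ d sV sV' pV pV' bV bV' hφ hd => ?_⟩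
  have hd0 := hd.nonneg (by omega)
  have T := hT V sV pV bV
  have T' := hT V' sV' pV' bV'
  have R := T.rollable hA4' u2
  have R' := T'.rollable hA4' u2
  have s0 : IsSmooth (fun x => amap V x - amap V' x) :=
    T.adm.amap_smooth.sub T'.adm.amap_smooth
  have b0 := h0 d V V' T.adm T'.adm (bV.mono le_rfl le_rfl he1) (bV'.mono le_rfl le_rfl he1) hd
  have b1 : DerivBound 0 3 (A * (C0 * d)) (fun x => amapS A V x - amapS A V' x) :=
    (b0.dilate_zero (by linarith) s0).congr_fun (amapS_sub_eq V V')
  have b2 : ∀ x, |iteratedDeriv 3 (fun x => amapS A V x - amapS A V' x) x| ≤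
      (A:ℝ)⁻¹ ^ 2 * (C0 * d) := fun x => by
    rw [funext (amapS_sub_eq (A := A) V V')]
    exact dilate_iter_le (by linarith) s0 (b0 3 (by omega) le_rfl _)
  obtain ⟨g1, g2⟩ := hg (A * (C0 * d)) ((A:ℝ)⁻¹ ^ 2 * (C0 * d)) (C1 * e) (C1 * e) (amapS A V)
    (amapS A V') u0 u1 u0 u1 (one_add_pow_le_two u0 u3) T.amapS_smooth T'.amapS_smooth
    (T.deriv_amapS_le (by omega)) (T'.deriv_amapS_le (by omega))
    (T.derivBound_two_amapS (by omega)) (T'.derivBound_amapS (by omega)) b1 b2 _ le_rfl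
  have p1 : DerivBound 0 3 (W * d) (fun x => rollS A V x - rollS A V' x) :=
    (R.rollMap_sub_derivBound R' (by linarith) g1).mono le_rfl le_rfl (by rw [hW]; linarith)
  have p2 : ∀ x, |iteratedDeriv 3 (fun x => rollS A V x - rollS A V' x) x| ≤
      3 * A * (8 * ((A:ℝ)⁻¹ ^ 2 * (C0 * d)) + Cg * (C1 * e) * (A * (C0 * d))) := fun x => by
    have := g2 (x - ⌊x⌋)
    rw [← R.iteratedDeriv_rollMap_sub R' (by linarith)] at this
    refine this.trans ?_
    push_cast
    gcongr
    linarith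
  have sP : IsSmooth (fun x => rollS A V x - rollS A V' x) :=
    (R.rollMap_smooth (by linarith)).sub (R'.rollMap_smooth (by linarith))
  have sφ := hφ.smooth
  have bφ : DerivBound 1 3 2 φ := (hφ.bound_one (by omega)).mono le_rfl le_rfl (by linarith)
  refine ⟨?_, fun x => ?_⟩
  · exact (h3 (W * d) _ φ sP sφ p1 bφ).mono le_rfl le_rfl (mul_assoc _ _ _).ge
  · have q := h2 (W * d) e _ φ (by positivity) he0.le sP sφ
      (p1.mono (by omega) (by omega) le_rfl) (hφ.bound_two.mono le_rfl (by omega) le_rfl)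
      (bφ.mono le_rfl (by omega) le_rfl) x
    have q1 : |iteratedDeriv (1 + 2) (fun x => rollS A V x - rollS A V' x) (φ x) *
        deriv φ x ^ (1 + 2)| ≤
        3 * A * (8 * ((A:ℝ)⁻¹ ^ 2 * (C0 * d)) + Cg * (C1 * e) * (A * (C0 * d))) * 2 ^ 3 := by
      rw [abs_mul, abs_pow]
      have := p2 (φ x)
      have := bφ 1 le_rfl (by omega) x
      rw [iteratedDeriv_one] at this
      gcongr
    have q2 : |deriv (fun x => rollS A V x - rollS A V' x) (φ x) *
        iteratedDeriv (1 + 2) φ x| ≤ W * d * e := by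
      rw [abs_mul]
      have := p1 1 (by omega) (by omega) (φ x)
      rw [iteratedDeriv_one] at this
      gcongr
      exact hφ.bound_two 3 (by omega) le_rfl x
    have e1 : 3 * A * (8 * ((A:ℝ)⁻¹ ^ 2 * (C0 * d)) + Cg * (C1 * e) * (A * (C0 * d))) * 2 ^ 3 =
      192 * C0 / A * d + 24 * A * (Cg * C1 * (A * C0)) * e * d := by
      field_simp; ring
    have e2 : 192 * C0 / A ≤ 1 / 16 := by
      rw [div_le_iff₀ (by linarith)]; linarith
    have e3 : 192 * C0 / A * d ≤ 1 / 16 * d := by gcongr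
    have e4 : (24 * A * (Cg * C1 * (A * C0)) + W + C2 * W) * e * d ≤ 1 / 16 * d := by
      gcongr; linarith
    have q4 : ∀ a b c : ℝ, |a| ≤ |b| + |c| + |a - b - c| := fun a b c => by
      have := abs_add_three b c (a - b - c)
      rwa [show b + c + (a - b - c) = a by ring] at this
    refine (q4 _ _ _).trans ((add_le_add (add_le_add q1 q2) q).trans ?_)
    have e5 : W * d * e + C2 * (W * d) * e + 24 * A * (Cg * C1 * (A * C0)) * e * d =
      (24 * A * (Cg * C1 * (A * C0)) + W + C2 * W) * e * d := by ring
    rw [e1]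
    linarith

/-- Up to lower order terms, rolling up contracts derivatives of order at least four. -/
theorem rollS_sharp {A : ℕ} (hA : 2048 ≤ A) {m : ℕ} (hm : 2 ≤ m) {ε : ℝ} (S : TameScale A ε)
    {B : ℝ} (hB : 0 ≤ B) : ∃ C : ℝ, 0 ≤ C ∧ ∀ (V φ : ℝ → ℝ) (β μ : ℝ), Tame A ε V →
    (∀ x, |deriv φ x| ≤ 2) → NearId (m + 2) β φ → β ≤ B → DerivBound 0 (m + 1) β V →
    (∀ x, |iteratedDeriv (m + 2) V x| ≤ μ) →
    ∀ x, |iteratedDeriv (m + 2) (fun x => rollS A V (φ x)) x| ≤ μ / 2 + C * β := by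
  obtain ⟨C1, hC1, h1⟩ := amap_sharp m B hB
  obtain ⟨C2, hC2, h2⟩ := giter_derivBound m (2 * A + 4) (C1 * B) (by positivity)
  obtain ⟨C3, hC3, h3⟩ := comp_sharp m (1 + B) (by positivity)
  have hA' : (2048:ℝ) ≤ A := by exact_mod_cast hA
  have hA1 : (1:ℝ) ≤ A := by linarith
  have hA0 : (0:ℝ) < A := by linarith
  set l := 2 * A + 4 with hl
  refine ⟨2 ^ (m + 2) * (2 * l * (2 ^ (m + 2) * C1 + C2 * C1)) + 2 + C3 * (C2 * C1) * B,
    by positivity, fun V φ β μ T dφ hφ hβB bV hV x => ?_⟩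
  have hβ := bV.nonneg (by omega)
  have hμ : 0 ≤ μ := (abs_nonneg _).trans (hV 0)
  obtain ⟨a1, a2⟩ := h1 β μ V hβB T.adm bV hV
  have sa := T.adm.amap_smooth
  have b1 : DerivBound 2 (m + 1) (C1 * β) (amapS A V) := a1.dilate hA1 sa (by omega)
  have b2 : ∀ x, |iteratedDeriv (m + 2) (amapS A V) x| ≤
      (A:ℝ)⁻¹ ^ (m + 1) * (4 * 4 ^ (m + 2) * μ) + C1 * β := fun x => by
    refine (dilate_iter_le hA1 sa (a2 _)).trans ?_
    have : (A:ℝ)⁻¹ ^ (m + 1) ≤ 1 := pow_le_one₀ (by positivity) (inv_le_one_of_one_le₀ hA1)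
    have h0 : 0 ≤ C1 * β := by positivity
    nlinarith
  have hpow := one_add_pow_le_two S.nonneg S.mul_len
  have R := T.rollable S.four_le S.mul_le
  obtain ⟨g1, g2⟩ := h2 (C1 * β) _ ε (amapS A V) (by positivity) (by gcongr) S.nonneg
    T.amapS_smooth (T.deriv_amapS_le (by omega)) hpow b1 b2 _ le_rfl
  have sP : IsSmooth (rollS A V) := R.rollMap_smooth hA0.le
  have p1 : DerivBound 2 (m + 1) (C2 * (C1 * β)) (rollS A V) :=
    R.rollMap_derivBound hA0.le (by omega) g1
  have p2 : ∀ x, |iteratedDeriv (m + 2) (rollS A V) x| ≤ 2 * l *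
      (2 ^ (m + 2) * ((A:ℝ)⁻¹ ^ (m + 1) * (4 * 4 ^ (m + 2) * μ) + C1 * β) + C2 * (C1 * β)) :=
    fun x => by
      rw [rollS, R.iteratedDeriv_rollMap hA0.le (by omega)]; exact g2 _
  have p3 : ∀ x, |deriv (rollS A V) x| ≤ 2 := fun x => by
    have := R.iteratedDeriv_rollMap hA0.le le_rfl x
    rw [iteratedDeriv_one, iteratedDeriv_one] at this
    rw [rollS, this]
    exact deriv_giter_le_two T.amapS_smooth S.nonneg (T.deriv_amapS_le (by omega)) hpow le_rfl _
  have hβ1 := hφ.bound_two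
  have q := h3 (C2 * (C1 * β)) β (rollS A V) φ (by positivity) hβ sP hφ.smooth p1
    (hβ1.mono le_rfl (by omega) le_rfl)
    ((hφ.bound_one (by omega)).mono le_rfl (by omega) (by linarith)) x
  have q1 : |iteratedDeriv (m + 2) (rollS A V) (φ x) * deriv φ x ^ (m + 2)| ≤ 2 * l *
      (2 ^ (m + 2) * ((A:ℝ)⁻¹ ^ (m + 1) * (4 * 4 ^ (m + 2) * μ) + C1 * β) + C2 * (C1 * β)) *
      2 ^ (m + 2) := by
    rw [abs_mul, abs_pow]
    have := p2 (φ x)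
    have := dφ x
    gcongr
  have q2 : |deriv (rollS A V) (φ x) * iteratedDeriv (m + 2) φ x| ≤ 2 * β := by
    rw [abs_mul]
    gcongr
    · exact p3 _
    · exact hβ1 _ (by omega) le_rfl x
  have lead : 2 * (l:ℝ) * (2 ^ (m + 2) * ((A:ℝ)⁻¹ ^ (m + 1) * (4 * 4 ^ (m + 2)))) * 2 ^ (m + 2)
      ≤ 1 / 2 := by
    obtain ⟨n, rfl⟩ : ∃ n, m = n + 2 := ⟨m - 2, by omega⟩
    have hl3 : (l:ℝ) ≤ 3 * A := by rw [hl]; push_cast; linarith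
    have e1 : 2 * (3 * A:ℝ) * (2 ^ (n + 2 + 2) * ((A:ℝ)⁻¹ ^ (n + 2 + 1) *
        (4 * 4 ^ (n + 2 + 2)))) * 2 ^ (n + 2 + 2) =
        24 * 16 ^ 4 * ((A:ℝ)⁻¹ ^ 2 * (16 * (A:ℝ)⁻¹) ^ n) := by
      have hq : (A:ℝ) * (A:ℝ)⁻¹ = 1 := mul_inv_cancel₀ hA0.ne'
      generalize (A:ℝ)⁻¹ = q at hq
      rw [mul_pow, show (16:ℝ) ^ n = 2 ^ n * 2 ^ n * 4 ^ n by rw [← mul_pow, ← mul_pow]; norm_num]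
      calc _ = (A * q) * (24 * 16 ^ 4 * (q ^ 2 * (2 ^ n * 2 ^ n * 4 ^ n * q ^ n))) := by ring
        _ = _ := by rw [hq, one_mul]
    have hi : (A:ℝ)⁻¹ ≤ 1 / 2048 := by
      rw [inv_eq_one_div]; exact one_div_le_one_div_of_le (by norm_num) hA'
    have e2 : (16 * (A:ℝ)⁻¹) ^ n ≤ 1 := pow_le_one₀ (by positivity) (by linarith)
    have e3 : (A:ℝ)⁻¹ ^ 2 ≤ (1 / 2048) ^ 2 := by gcongr
    calc _ ≤ 2 * (3 * A:ℝ) * (2 ^ (n + 2 + 2) * ((A:ℝ)⁻¹ ^ (n + 2 + 1) *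
        (4 * 4 ^ (n + 2 + 2)))) * 2 ^ (n + 2 + 2) := by gcongr
      _ = _ := e1
      _ ≤ 24 * 16 ^ 4 * ((1 / 2048) ^ 2 * 1) := by gcongr
      _ ≤ 1 / 2 := by norm_num
  have lead' := mul_le_mul_of_nonneg_right lead hμ
  have q4 : ∀ a b c : ℝ, |a| ≤ |b| + |c| + |a - b - c| := fun a b c => by
    have := abs_add_three b c (a - b - c)
    rwa [show b + c + (a - b - c) = a by ring] at this
  refine (q4 _ _ _).trans ((add_le_add (add_le_add q1 q2) q).trans ?_)
  have q5 : C3 * (C2 * (C1 * β)) * β ≤ C3 * (C2 * (C1 * β)) * B := by gcongr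
  linarith

theorem periodic_iteratedDeriv {f : ℝ → ℝ} (pf : ∀ x, f (x + 1) = f x) (n : ℕ) (x : ℝ) :
    iteratedDeriv n f (x + 1) = iteratedDeriv n f x := by
  have h := congrFun (iteratedDeriv_comp_add_const n f 1) x
  rw [funext pf] at h
  exact h.symm

theorem periodic_abs_le_of_deriv {f : ℝ → ℝ} (sf : IsSmooth f) (pf : ∀ x, f (x + 1) = f x)
    {d : ℝ} (h : ∀ x, |deriv (deriv f) x| ≤ d) (x : ℝ) : |deriv f x| ≤ d := by
  obtain ⟨z, hz, hz'⟩ := exists_deriv_eq_zero (show x < x + 1 by linarith)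
    sf.continuous.continuousOn (pf x).symm
  have h1 := sf.deriv'.lipschitz h x z
  rw [hz', sub_zero] at h1
  have h2 : |x - z| ≤ 1 := by rw [abs_le]; constructor <;> linarith [hz.1, hz.2]
  have h0 := (abs_nonneg _).trans (h 0)
  nlinarith

theorem periodic_derivBound {f : ℝ → ℝ} (sf : IsSmooth f) (pf : ∀ x, f (x + 1) = f x)
    {d : ℝ} {k : ℕ} (h : ∀ x, |iteratedDeriv (k + 1) f x| ≤ d) : DerivBound 1 (k + 1) d f := by
  induction k with
  | zero =>
    intro j h1 h2 x
    obtain rfl : j = 1 := by omega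
    exact h x
  | succ k ih =>
    have h1 : ∀ x, |iteratedDeriv (k + 1) f x| ≤ d := fun x => by
      have := periodic_abs_le_of_deriv (sf.iter k) (periodic_iteratedDeriv pf k) (d := d)
      rw [← iteratedDeriv_succ, ← iteratedDeriv_succ] at this
      exact this h x
    intro j hj hj' x
    rcases Nat.lt_or_ge j (k + 2) with h' | h'
    · exact ih h1 j hj (by omega) x
    · obtain rfl : j = k + 2 := by omega
      exact h x

theorem periodic_abs_sub_le {f : ℝ → ℝ} (sf : IsSmooth f) (pf : ∀ x, f (x + 1) = f x)
    {d : ℝ} (h : ∀ x, |deriv f x| ≤ d) (x : ℝ) : |f x - f 0| ≤ d := by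
  have h0 := (abs_nonneg _).trans (h 0)
  have p : Function.Periodic f 1 := pf
  have h1 := sf.lipschitz h (Int.fract x) 0
  have h2 : f (Int.fract x) = f x := by
    have := p.sub_int_mul_eq (x := x) ⌊x⌋
    rwa [mul_one] at this
  have h3 : |Int.fract x - 0| ≤ 1 := by
    rw [sub_zero, abs_of_nonneg (Int.fract_nonneg x)]; exact (Int.fract_lt_one x).le
  rw [h2] at h1
  nlinarith

theorem periodic_derivBound_zero {f : ℝ → ℝ} (sf : IsSmooth f) (pf : ∀ x, f (x + 1) = f x)
    {d a : ℝ} {k : ℕ} (h0 : |f 0| ≤ a) (h : ∀ x, |iteratedDeriv (k + 1) f x| ≤ d) :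
    DerivBound 0 (k + 1) (a + d) f := fun j _ h2 x => by
  have h1 := periodic_derivBound sf pf h
  have ha := (abs_nonneg _).trans h0
  rcases j with _ | j
  · have := periodic_abs_sub_le sf pf h1.deriv_le x
    have := abs_add_le (f x - f 0) (f 0)
    rw [sub_add_cancel] at this
    rw [iteratedDeriv_zero]; linarith
  · exact (h1 _ (by omega) h2 x).trans (by linarith)

theorem periodic_bounded {f : ℝ → ℝ} (sf : Continuous f) (pf : ∀ x, f (x + 1) = f x) :
    ∃ C, ∀ x, |f x| ≤ C := by
  obtain ⟨C, hC⟩ := (isCompact_Icc (a := (0:ℝ)) (b := 1)).exists_bound_of_continuousOn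
    sf.continuousOn
  refine ⟨C, fun x => ?_⟩
  have p : Function.Periodic f 1 := pf
  have h2 : f (Int.fract x) = f x := by
    have := p.sub_int_mul_eq (x := x) ⌊x⌋
    rwa [mul_one] at this
  rw [← h2]
  exact hC _ ⟨Int.fract_nonneg x, (Int.fract_lt_one x).le⟩

/-- Landau's interpolation inequality, with a free parameter. -/
theorem abs_deriv_le_interpolate {f : ℝ → ℝ} (sf : IsSmooth f) {a b h : ℝ} (hh : 0 < h)
    (h0 : ∀ x, |f x| ≤ a) (h2 : ∀ x, |deriv (deriv f) x| ≤ b) (x : ℝ) :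
    |deriv f x| ≤ 2 * a / h + b * h := by
  obtain ⟨z, hz, hz'⟩ := exists_deriv_eq_slope f (show x < x + h by linarith)
    sf.continuous.continuousOn sf.diff.differentiableOn
  have h1 := sf.deriv'.lipschitz h2 x z
  have hb := (abs_nonneg _).trans (h2 0)
  have h3 : |x - z| ≤ h := by rw [abs_le]; constructor <;> linarith [hz.1, hz.2]
  have h4 : |deriv f z| ≤ 2 * a / h := by
    rw [hz', add_sub_cancel_left, abs_div, abs_of_pos hh]
    gcongr
    have := abs_sub (f (x + h)) (f x)
    linarith [h0 (x + h), h0 x]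
  have h5 := abs_add_le (deriv f x - deriv f z) (deriv f z)
  rw [sub_add_cancel] at h5
  have h6 : b * |x - z| ≤ b * h := by gcongr
  linarith

/-- The `k`-th derivatives of the sequence `u` decay geometrically. -/
def GeoDecay (u : ℕ → ℝ → ℝ) (k : ℕ) : Prop :=
  ∃ K q : ℝ, 0 ≤ K ∧ 0 < q ∧ q < 1 ∧ ∀ n x, |iteratedDeriv k (u n) x| ≤ K * q ^ n

theorem GeoDecay.succ {u : ℕ → ℝ → ℝ} {k : ℕ} (su : ∀ n, IsSmooth (u n)) (h : GeoDecay u k)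
    {B : ℝ} (hB : ∀ n x, |iteratedDeriv (k + 2) (u n) x| ≤ B) : GeoDecay u (k + 1) := by
  obtain ⟨K, q, hK, hq, hq1, h⟩ := h
  have hB0 := (abs_nonneg _).trans (hB 0 0)
  refine ⟨2 * K + B, √q, by positivity, by positivity, (Real.sqrt_lt' one_pos).2 (by linarith),
    fun n x => ?_⟩
  have h1 := abs_deriv_le_interpolate ((su n).iter k) (a := K * q ^ n) (b := B)
    (h := √q ^ n) (by positivity) (h n) (fun x => by
      rw [← iteratedDeriv_succ, ← iteratedDeriv_succ]; exact hB n x) x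
  rw [← iteratedDeriv_succ] at h1
  refine h1.trans (le_of_eq ?_)
  have h2 : q ^ n = √q ^ n * √q ^ n := by rw [← mul_pow, Real.mul_self_sqrt hq.le]
  rw [h2]
  have h3 : √q ^ n ≠ 0 := by positivity
  field_simp

theorem exists_smooth_limit {v : ℕ → ℝ → ℝ} (sv : ∀ n, IsSmooth (v n))
    (h : ∀ k, GeoDecay (fun n x => v (n + 1) x - v n x) k) :
    ∃ V : ℝ → ℝ, IsSmooth V ∧
      ∀ k x, Tendsto (fun n => iteratedDeriv k (v n) x) atTop (nhds (iteratedDeriv k V x)) := by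
  choose K q hK hq hq1 h using h
  set u := fun n x => v (n + 1) x - v n x with hu
  have su : ∀ n, IsSmooth (u n) := fun n => (sv _).sub (sv _)
  have hs : ∀ k, Summable (fun n => K k * q k ^ n) := fun k =>
    (summable_geometric_of_lt_one (hq k).le (hq1 k)).mul_left _
  have hb : ∀ k i x, ‖iteratedFDeriv ℝ k (u i) x‖ ≤ K k * q k ^ i := fun k i x => by
    rw [norm_iteratedFDeriv_eq_norm_iteratedDeriv]; exact h k i x
  have sU : IsSmooth (fun x => ∑' n, u n x) :=
    contDiff_tsum (v := fun k n => K k * q k ^ n) (N := ⊤) su (fun k _ => hs k)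
      (fun k i x _ => hb k i x)
  refine ⟨fun x => v 0 x + ∑' n, u n x, (sv 0).add sU, fun k x => ?_⟩
  have hsum : Summable (fun n => iteratedFDeriv ℝ k (u n) x) :=
    Summable.of_norm_bounded (hs k) (fun i => hb k i x)
  have e1 : iteratedDeriv k (fun x => ∑' n, u n x) x = ∑' n, iteratedDeriv k (u n) x := by
    simp only [iteratedDeriv]
    rw [iteratedFDeriv_tsum_apply (v := fun k n => K k * q k ^ n) (N := ⊤) su (fun k _ => hs k)
      (fun k i x _ => hb k i x) (by exact_mod_cast le_top)]
    exact ContinuousMultilinearMap.tsum_eval hsum _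
  have hsum' : Summable (fun n => iteratedDeriv k (u n) x) :=
    Summable.of_norm_bounded (hs k) (fun i => h k i x)
  rw [iteratedDeriv_add_fun (sv 0) sU, e1]
  have h1 := (hsum'.hasSum.tendsto_sum_nat).const_add (iteratedDeriv k (v 0) x)
  refine h1.congr fun n => ?_
  have h2 : ∀ i, iteratedDeriv k (u i) x =
      iteratedDeriv k (v (i + 1)) x - iteratedDeriv k (v i) x := fun i =>
    iteratedDeriv_sub_fun (sv _) (sv _) k x
  rw [Finset.sum_congr rfl fun i _ => h2 i, Finset.sum_range_sub (fun i => iteratedDeriv k (v i) x)]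
  ring

/-- The conclusion of `rollS_contraction`. -/
structure Contracting (A : ℕ) (e ε C : ℝ) : Prop where
  scale : TameScale A ε
  nonneg : 0 ≤ C
  le_one : e ≤ 1
  tame : ∀ V : ℝ → ℝ, IsSmooth V → (∀ x, V (x + 1) = V x) → DerivBound 0 4 e V → Tame A ε V
  contract : ∀ (V V' φ : ℝ → ℝ) (d : ℝ), IsSmooth V → IsSmooth V' → (∀ x, V (x + 1) = V x) →
    (∀ x, V' (x + 1) = V' x) → DerivBound 0 4 e V → DerivBound 0 4 e V' → NearId 3 e φ →
    DerivBound 0 3 d (fun x => V x - V' x) →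
    DerivBound 0 3 (C * d) (fun x => rollS A V (φ x) - rollS A V' (φ x)) ∧
    ∀ x, |iteratedDeriv 3 (fun x => rollS A V (φ x) - rollS A V' (φ x)) x| ≤ d / 8

/-- The conclusion of `rollS_sharp`. -/
def SharpConst (A : ℕ) (ε : ℝ) (m : ℕ) (B C : ℝ) : Prop :=
  ∀ (V φ : ℝ → ℝ) (β μ : ℝ), Tame A ε V →
    (∀ x, |deriv φ x| ≤ 2) → NearId (m + 2) β φ → β ≤ B → DerivBound 0 (m + 1) β V →
    (∀ x, |iteratedDeriv (m + 2) V x| ≤ μ) →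
    ∀ x, |iteratedDeriv (m + 2) (fun x => rollS A V (φ x)) x| ≤ μ / 2 + C * β

theorem rollS_zero {A : ℕ} (hA : 4 ≤ A) (x : ℝ) : rollS A (fun _ => 0) x = x := by
  have hA' : (A:ℝ) ≠ 0 := by positivity
  have h2 : ∀ y, amapS A (fun _ => 0) y = y := fun y => by
    rw [amapS, dilate, amap_zero]; field_simp
  have h3 : ∀ (l : ℕ) (y : ℝ), giter (amapS A (fun _ => 0)) l y = y + l := fun l y => by
    induction l with
    | zero => simp [giter]
    | succ l ih => rw [giter, h2, ih]; push_cast; ring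
  rw [rollS, rollMap, h3]
  linarith [Int.fract_add_floor x]

theorem rollS_smooth {A : ℕ} {ε : ℝ} (S : TameScale A ε) {V : ℝ → ℝ} (T : Tame A ε V) :
    IsSmooth (rollS A V) :=
  (T.rollable S.four_le S.mul_le).rollMap_smooth (Nat.cast_nonneg _)

/-- The operator whose fixed points `V` satisfy `rollS A V ∘ φ = id + V`, up to a constant. -/
def theta (A : ℕ) (φ : ℝ → ℝ) (c : ℝ) (V : ℝ → ℝ) (x : ℝ) : ℝ :=
  rollS A V (φ x) - x - rollS A V (φ 0) + c

theorem theta_zero (A : ℕ) (φ : ℝ → ℝ) (c : ℝ) (V : ℝ → ℝ) : theta A φ c V 0 = c := by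
  simp [theta]

theorem theta_periodic (A : ℕ) {φ : ℝ → ℝ} (h : ∀ x, φ (x + 1) = φ x + 1) (c : ℝ) (V : ℝ → ℝ)
    (x : ℝ) : theta A φ c V (x + 1) = theta A φ c V x := by
  rw [theta, theta, h, rollS, rollMap_add_one]; ring

theorem theta_smooth {A : ℕ} {ε : ℝ} (S : TameScale A ε) {V φ : ℝ → ℝ} (T : Tame A ε V)
    (sφ : IsSmooth φ) (c : ℝ) : IsSmooth (theta A φ c V) :=
  ((((rollS_smooth S T).comp sφ).sub contDiff_id).sub contDiff_const).add contDiff_const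

theorem iteratedDeriv_theta {A : ℕ} {ε : ℝ} (S : TameScale A ε) {V φ : ℝ → ℝ} (T : Tame A ε V)
    (sφ : IsSmooth φ) (c : ℝ) {j : ℕ} (hj : 2 ≤ j) (x : ℝ) :
    iteratedDeriv j (theta A φ c V) x = iteratedDeriv j (fun x => rollS A V (φ x)) x := by
  have e : theta A φ c V = fun x => (fun x => rollS A V (φ x)) x - x -
    (rollS A V (φ 0) - c) := by
      funext x; simp only [theta]; ring
  rw [e, iteratedDeriv_sub_const_fun j (by omega),
    iteratedDeriv_sub_fun ((rollS_smooth S T).comp_fun sφ) smooth_id, iteratedDeriv_fun_id_two hj,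
    sub_zero]

theorem iteratedDeriv_theta_sub (A : ℕ) (V V' φ : ℝ → ℝ) (c c' : ℝ) {j : ℕ} (hj : 1 ≤ j) (x : ℝ) :
    iteratedDeriv j (fun x => theta A φ c V x - theta A φ c' V' x) x =
      iteratedDeriv j (fun x => rollS A V (φ x) - rollS A V' (φ x)) x := by
  have e : (fun x => theta A φ c V x - theta A φ c' V' x) =
    fun x => (fun x => rollS A V (φ x) - rollS A V' (φ x)) x -
    (rollS A V (φ 0) - rollS A V' (φ 0) - c + c') := by
      funext x; simp only [theta]; ring
  rw [e, iteratedDeriv_sub_const_fun j hj]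

/-- Standing assumptions for solving `rollS A V ∘ φ = id + V`. -/
structure RollSetup (A : ℕ) (e ε C C₄ c₀ : ℝ) (φ : ℝ → ℝ) : Prop where
  contr : Contracting A e ε C
  sharp : SharpConst A ε 2 1 C₄
  sharp_nonneg : 0 ≤ C₄
  pos : 0 < c₀
  le : (5 / 4 + 5 / 2 * C₄) * c₀ ≤ e
  near : NearId 4 (c₀ / 16) φ
  near_zero : |φ 0| ≤ c₀ / 16

/-- The invariant set on which `theta` contracts. -/
structure InCone (C₄ c₀ c : ℝ) (V : ℝ → ℝ) : Prop where
  smooth : IsSmooth V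
  per : ∀ x, V (x + 1) = V x
  zero : V 0 = c
  third : ∀ x, |iteratedDeriv 3 V x| ≤ c₀ / 4
  fourth : ∀ x, |iteratedDeriv 4 V x| ≤ 5 / 2 * C₄ * c₀

theorem InCone.derivBound_three {C₄ c₀ c : ℝ} {V : ℝ → ℝ} (h : InCone C₄ c₀ c V) (hc : |c| ≤ c₀) :
    DerivBound 0 3 (5 / 4 * c₀) V :=
  (periodic_derivBound_zero h.smooth h.per (a := c₀) (by rw [h.zero]; exact hc) h.third).mono
    le_rfl le_rfl (by linarith)

section

variable {A : ℕ} {e ε C C₄ c₀ c : ℝ} {φ V : ℝ → ℝ}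

theorem RollSetup.e_bounds (H : RollSetup A e ε C C₄ c₀ φ) :
    5 / 4 * c₀ ≤ e ∧ 5 / 2 * C₄ * c₀ ≤ e ∧ e ≤ 1 ∧ 0 < e := by
  have h1 := H.le
  have h2 := H.pos
  have h3 : 0 ≤ 5 / 2 * C₄ * c₀ := by have := H.sharp_nonneg; positivity
  exact ⟨by linarith, by linarith, H.contr.le_one, by linarith⟩

theorem RollSetup.near_three (H : RollSetup A e ε C C₄ c₀ φ) : NearId 3 e φ :=
  ⟨H.near.smooth, H.near.add_one, H.near.bound.mono le_rfl (by omega)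
    (by linarith [H.e_bounds.1, H.pos])⟩

theorem RollSetup.derivBound_four (H : RollSetup A e ε C C₄ c₀ φ) (h : InCone C₄ c₀ c V)
    (hc : |c| ≤ c₀) : DerivBound 0 4 e V := fun j h1 h2 x => by
  obtain ⟨e1, e2, -, -⟩ := H.e_bounds
  rcases Nat.lt_or_ge j 4 with h' | h'
  · exact (h.derivBound_three hc j h1 (by omega) x).trans e1
  · obtain rfl : j = 4 := by omega
    exact (h.fourth x).trans e2

theorem RollSetup.tame (H : RollSetup A e ε C C₄ c₀ φ) (h : InCone C₄ c₀ c V)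
    (hc : |c| ≤ c₀) : Tame A ε V :=
  H.contr.tame V h.smooth h.per (H.derivBound_four h hc)

theorem RollSetup.abs_deriv_le (H : RollSetup A e ε C C₄ c₀ φ) (x : ℝ) : |deriv φ x| ≤ 2 :=
  (H.near_three.abs_deriv_le (by omega) x).trans (by linarith [H.e_bounds.2.2.1])

theorem RollSetup.inCone_const (H : RollSetup A e ε C C₄ c₀ φ) (c : ℝ) :
    InCone C₄ c₀ c (fun _ => c) := by
  have := H.pos
  have := H.sharp_nonneg
  refine ⟨contDiff_const, fun _ => rfl, rfl, fun x => ?_, fun x => ?_⟩ <;>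
  · rw [iteratedDeriv_const]; simp; positivity

theorem RollSetup.inCone_theta (H : RollSetup A e ε C C₄ c₀ φ) (h : InCone C₄ c₀ c V)
    (hc : |c| ≤ c₀) : InCone C₄ c₀ c (theta A φ c V) := by
  obtain ⟨e1, e2, e3, e4⟩ := H.e_bounds
  have T := H.tame h hc
  have S := H.contr.scale
  have hc0 := H.pos
  have sφ := H.near.smooth
  refine ⟨theta_smooth S T sφ c, theta_periodic A H.near.add_one c V, theta_zero A φ c V,
    fun x => ?_, fun x => ?_⟩
  · have b0 : DerivBound 0 4 e (fun _ : ℝ => (0:ℝ)) := fun j _ _ x => by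
      rw [iteratedDeriv_const]; simp [e4.le]
    have h1 := (H.contr.contract V (fun _ => 0) φ (5 / 4 * c₀) h.smooth contDiff_const h.per
      (fun _ => rfl) (H.derivBound_four h hc) b0 H.near_three
      ((h.derivBound_three hc).congr_fun fun x => sub_zero _)).2 x
    have T0 := H.contr.tame _ contDiff_const (fun _ => rfl) b0
    rw [iteratedDeriv_sub_fun ((rollS_smooth S T).comp_fun sφ) ((rollS_smooth S T0).comp_fun sφ),
      ← iteratedDeriv_theta S T sφ c (by omega)] at h1
    simp only [rollS_zero S.four_le] at h1
    have h2 := H.near.bound_two 3 (by omega) (by omega) x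
    have h3 := abs_add_le (iteratedDeriv 3 (theta A φ c V) x - iteratedDeriv 3 φ x)
      (iteratedDeriv 3 φ x)
    rw [sub_add_cancel] at h3
    linarith
  · rw [iteratedDeriv_theta S T sφ c (by omega)]
    have h1 := H.sharp V φ (5 / 4 * c₀) (5 / 2 * C₄ * c₀) T H.abs_deriv_le
      ⟨sφ, H.near.add_one, H.near.bound.mono le_rfl le_rfl (by linarith)⟩ (by linarith)
      (h.derivBound_three hc) h.fourth x
    linarith

/-- The iterates of `theta`. -/
def thetaIter (A : ℕ) (φ : ℝ → ℝ) (c : ℝ) : ℕ → ℝ → ℝ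
  | 0 => fun _ => c
  | n + 1 => theta A φ c (thetaIter A φ c n)

theorem RollSetup.inCone_iter (H : RollSetup A e ε C C₄ c₀ φ) (hc : |c| ≤ c₀) (n : ℕ) :
    InCone C₄ c₀ c (thetaIter A φ c n) := by
  induction n with
  | zero => exact H.inCone_const c
  | succ n ih => exact H.inCone_theta ih hc

theorem RollSetup.iter_step (H : RollSetup A e ε C C₄ c₀ φ) (hc : |c| ≤ c₀) {m : ℕ}
    {B C' β : ℝ} (hC' : 0 ≤ C') (hs : SharpConst A ε m B C') (hβ : β ≤ B)
    (hφ : NearId (m + 2) β φ) (h : ∀ n, DerivBound 0 (m + 1) β (thetaIter A φ c n)) (n : ℕ) :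
    DerivBound 0 (m + 2) ((1 + 2 * C') * β) (thetaIter A φ c n) := by
  have hβ0 := (h 0).nonneg (by omega)
  have h0 : 0 ≤ C' * β := by positivity
  have key : ∀ n x, |iteratedDeriv (m + 2) (thetaIter A φ c n) x| ≤ 2 * (C' * β) := fun n => by
    induction n with
    | zero => intro x; simp only [thetaIter]; rw [iteratedDeriv_const]; simp; linarith
    | succ n ih =>
      intro x
      have I := H.inCone_iter hc n
      have T := H.tame I hc
      rw [thetaIter, iteratedDeriv_theta H.contr.scale T hφ.smooth c (by omega)]
      have := hs _ φ β _ T H.abs_deriv_le hφ hβ (h n) ih x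
      linarith
  intro j _ hj x
  rcases Nat.lt_or_ge j (m + 2) with h' | h'
  · exact (h n j (by omega) (by omega) x).trans (by linarith)
  · obtain rfl : j = m + 2 := by omega
    exact (key n x).trans (by linarith)

end

theorem exists_nearId {φ : ℝ → ℝ} (sφ : IsSmooth φ) (h : ∀ x, φ (x + 1) = φ x + 1) (k : ℕ) :
    ∃ B : ℝ, NearId k B φ := by
  have s : IsSmooth (fun x => φ x - x) := sφ.sub smooth_id
  obtain ⟨B, -, hB⟩ := exists_derivBound_of_forall (f := fun x => φ x - x) k fun j =>
    periodic_bounded (s.iter j).continuous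
      (periodic_iteratedDeriv (fun x => by rw [h]; ring) j)
  exact ⟨B, sφ, h, hB.mono (Nat.zero_le _) le_rfl le_rfl⟩

theorem NearId.mono {k k' : ℕ} {b b' : ℝ} {φ : ℝ → ℝ} (h : NearId k b φ) (hk : k' ≤ k)
    (hb : b ≤ b') : NearId k' b' φ :=
  ⟨h.smooth, h.add_one, h.bound.mono le_rfl hk hb⟩

section

variable {A : ℕ} {e ε C C₄ c₀ c : ℝ} {φ V : ℝ → ℝ}

theorem RollSetup.iter_bounded (H : RollSetup A e ε C C₄ c₀ φ) (hA : 2048 ≤ A) (hc : |c| ≤ c₀)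
    (k : ℕ) : ∃ B : ℝ, ∀ n, DerivBound 0 (k + 4) B (thetaIter A φ c n) := by
  induction k with
  | zero => exact ⟨e, fun n => H.derivBound_four (H.inCone_iter hc n) hc⟩
  | succ k ih =>
    obtain ⟨B, hB⟩ := ih
    obtain ⟨B', hB'⟩ := exists_nearId H.near.smooth H.near.add_one (k + 3 + 2)
    have h0 : 0 ≤ max B B' := ((hB 0).nonneg (by omega)).trans (le_max_left _ _)
    obtain ⟨C', hC', hs⟩ := rollS_sharp hA (m := k + 3) (by omega) H.contr.scale h0
    exact ⟨_, H.iter_step hc hC' hs le_rfl (hB'.mono le_rfl (le_max_right _ _))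
      fun n => (hB n).mono le_rfl (by omega) (le_max_left _ _)⟩

theorem exists_iter_small (hA : 2048 ≤ A) (S : TameScale A ε) (r : ℕ) :
    ∀ δ > (0:ℝ), ∃ τ > (0:ℝ), ∀ (c₀ c : ℝ) (φ : ℝ → ℝ), RollSetup A e ε C C₄ c₀ φ → |c| ≤ c₀ →
      c₀ ≤ τ → NearId (r + 3) τ φ → ∀ n, DerivBound 0 (r + 3) δ (thetaIter A φ c n) := by
  induction r with
  | zero =>
    intro δ hδ
    refine ⟨δ / 2, by positivity, fun c₀ c φ H hc hτ _ n => ?_⟩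
    exact ((H.inCone_iter hc n).derivBound_three hc).mono le_rfl le_rfl (by linarith)
  | succ r ih =>
    intro δ hδ
    obtain ⟨C', hC', hs⟩ := rollS_sharp hA (m := r + 2) (by omega) S zero_le_one
    obtain ⟨τ, hτ, h⟩ := ih (min 1 (δ / (1 + 2 * C'))) (by positivity)
    refine ⟨min τ (min 1 (δ / (1 + 2 * C'))), by positivity, fun c₀ c φ H hc hτ' hφ n => ?_⟩
    have h1 := h c₀ c φ H hc (hτ'.trans (min_le_left _ _)) (hφ.mono (by omega) (min_le_left _ _))
    refine (H.iter_step hc hC' hs (min_le_left _ _) (hφ.mono le_rfl (min_le_right _ _)) h1 n).mono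
      le_rfl le_rfl ?_
    have h2 : min 1 (δ / (1 + 2 * C')) ≤ δ / (1 + 2 * C') := min_le_right _ _
    rw [le_div_iff₀ (by positivity)] at h2
    linarith

theorem RollSetup.theta_sub (H : RollSetup A e ε C C₄ c₀ φ) {c c' d : ℝ} {V V' : ℝ → ℝ}
    (h : InCone C₄ c₀ c V) (h' : InCone C₄ c₀ c' V') (hc : |c| ≤ c₀) (hc' : |c'| ≤ c₀)
    (hd : DerivBound 0 3 d (fun x => V x - V' x)) :
    DerivBound 0 3 (|c - c'| + d / 8) (fun x => theta A φ c V x - theta A φ c' V' x) := by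
  have I := H.inCone_theta h hc
  have I' := H.inCone_theta h' hc'
  refine periodic_derivBound_zero (I.smooth.sub I'.smooth) (fun x => by rw [I.per, I'.per])
    (by rw [I.zero, I'.zero]) fun x => ?_
  rw [iteratedDeriv_theta_sub A V V' φ c c' (by omega)]
  exact (H.contr.contract V V' φ d h.smooth h'.smooth h.per h'.per (H.derivBound_four h hc)
    (H.derivBound_four h' hc') H.near_three hd).2 x

theorem RollSetup.iter_sub (H : RollSetup A e ε C C₄ c₀ φ) (hc : |c| ≤ c₀) (n : ℕ) :
    DerivBound 0 3 (2 * e * (1 / 8) ^ n)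
      (fun x => thetaIter A φ c (n + 1) x - thetaIter A φ c n x) := by
  induction n with
  | zero =>
    have h1 := H.inCone_iter hc 1
    have h0 := H.inCone_iter hc 0
    exact ((H.derivBound_four h1 hc).sub (H.derivBound_four h0 hc) h1.smooth h0.smooth).mono
      le_rfl (by omega) (by linarith)
  | succ n ih =>
    exact (H.theta_sub (H.inCone_iter hc (n + 1)) (H.inCone_iter hc n) hc hc ih).mono
      le_rfl le_rfl (by rw [sub_self, abs_zero, pow_succ]; linarith)

theorem RollSetup.geoDecay (H : RollSetup A e ε C C₄ c₀ φ) (hA : 2048 ≤ A) (hc : |c| ≤ c₀)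
    (k : ℕ) : GeoDecay (fun n x => thetaIter A φ c (n + 1) x - thetaIter A φ c n x) k := by
  have si := fun n => (H.inCone_iter hc n).smooth
  induction k with
  | zero => exact ⟨2 * e, 1 / 8, by linarith [H.e_bounds.2.2.2], by norm_num, by norm_num,
      fun n => H.iter_sub hc n 0 le_rfl (by omega)⟩
  | succ k ih =>
    obtain ⟨B, hB⟩ := H.iter_bounded hA hc k
    exact ih.succ (fun n => (si _).sub (si _)) (fun n =>
      (hB (n + 1)).sub (hB n) (si _) (si _) (k + 2) (by omega) (by omega))

theorem RollSetup.iter_sub_far (H : RollSetup A e ε C C₄ c₀ φ) (hc : |c| ≤ c₀) (n p : ℕ) :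
    DerivBound 0 3 (4 * e * (1 / 8) ^ n - 4 * e * (1 / 8) ^ (n + p))
      (fun x => thetaIter A φ c (n + p) x - thetaIter A φ c n x) := by
  have si := fun n => (H.inCone_iter hc n).smooth
  have he := H.e_bounds.2.2.2
  induction p with
  | zero =>
    intro j _ _ x
    rw [iteratedDeriv_sub_fun (si _) (si _), add_zero, sub_self, abs_zero]
    have : 0 ≤ e * (1 / 8) ^ n := by positivity
    linarith
  | succ p ih =>
    have h1 := (ih.add (H.iter_sub hc (n + p)) ((si _).sub (si _)) ((si _).sub (si _)))
    refine (h1.mono le_rfl le_rfl ?_).congr_fun (fun x => by rw [← add_assoc]; ring)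
    have : 0 ≤ e * (1 / 8) ^ (n + p) := by positivity
    rw [← add_assoc, pow_succ (1 / 8 : ℝ) (n + p)]
    linarith

/-- Existence of the fixed points of `theta`, together with bounds inherited from the iterates. -/
theorem RollSetup.exists_fixed (H : RollSetup A e ε C C₄ c₀ φ) (hA : 2048 ≤ A) (hc : |c| ≤ c₀) :
    ∃ V : ℝ → ℝ, InCone C₄ c₀ c V ∧ (∀ x, theta A φ c V x = V x) ∧
      ∀ (r : ℕ) (δ : ℝ), (∀ n, DerivBound 0 r δ (thetaIter A φ c n)) → DerivBound 0 r δ V := by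
  have I := H.inCone_iter (c := c) hc
  have si := fun n => (I n).smooth
  obtain ⟨V, sV, hV⟩ := exists_smooth_limit si (H.geoDecay hA hc)
  have hV0 : ∀ x, Tendsto (fun n => thetaIter A φ c n x) atTop (nhds (V x)) := fun x => by
    simpa using hV 0 x
  have bd : ∀ (k : ℕ) (x δ : ℝ), (∀ n, |iteratedDeriv k (thetaIter A φ c n) x| ≤ δ) →
      |iteratedDeriv k V x| ≤ δ := fun k x δ h =>
    le_of_tendsto' (hV k x).abs h
  have IV : InCone C₄ c₀ c V := by
    refine ⟨sV, fun x => ?_, ?_, fun x => bd 3 x _ fun n => (I n).third x,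
      fun x => bd 4 x _ fun n => (I n).fourth x⟩
    · exact tendsto_nhds_unique (hV0 (x + 1)) ((hV0 x).congr fun n => ((I n).per x).symm)
    · exact tendsto_nhds_unique (hV0 0) (tendsto_const_nhds.congr fun n => (I n).zero.symm)
  refine ⟨V, IV, fun x => ?_, fun r δ h j h1 h2 x => bd j x δ fun n => h n j h1 h2 x⟩
  have he := H.e_bounds.2.2.2
  have far : ∀ n, DerivBound 0 3 (4 * e * (1 / 8) ^ n)
      (fun x => V x - thetaIter A φ c n x) := fun n j h1 h2 x => by
    rw [iteratedDeriv_sub_fun sV (si n)]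
    have t : Tendsto (fun p => iteratedDeriv j (thetaIter A φ c (n + p)) x) atTop
        (nhds (iteratedDeriv j V x)) :=
      (hV j x).comp (tendsto_add_atTop_nat n |>.congr fun p => add_comm _ _)
    refine le_of_tendsto' (t.sub_const _).abs fun p => ?_
    rw [← iteratedDeriv_sub_fun (si _) (si n)]
    refine (H.iter_sub_far hc n p j h1 h2 x).trans ?_
    have : 0 ≤ e * (1 / 8) ^ (n + p) := by positivity
    linarith
  have key : ∀ n, |theta A φ c V x - thetaIter A φ c (n + 1) x| ≤ e * (1 / 8) ^ n := fun n => by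
    have := (H.theta_sub IV (I n) hc hc (far n)).apply_zero x
    rw [sub_self, abs_zero] at this
    refine this.trans ?_
    have : 0 ≤ e * (1 / 8) ^ n := by positivity
    linarith
  have t1 : Tendsto (fun n : ℕ => e * (1 / 8 : ℝ) ^ n) atTop (nhds 0) := by
    have := (tendsto_pow_atTop_nhds_zero_of_lt_one (r := (1 / 8 : ℝ)) (by norm_num)
      (by norm_num)).const_mul e
    simpa using this
  have t2 : Tendsto (fun n => thetaIter A φ c (n + 1) x) atTop (nhds (theta A φ c V x)) :=
    tendsto_iff_dist_tendsto_zero.2 (squeeze_zero (fun n => dist_nonneg)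
    (fun n => by rw [dist_comm]; exact key n) t1)
  exact tendsto_nhds_unique t2 ((tendsto_add_atTop_iff_nat 1).2 (hV0 x))

theorem RollSetup.fixed_sub (H : RollSetup A e ε C C₄ c₀ φ) {c c' : ℝ} {V V' : ℝ → ℝ}
    (h : InCone C₄ c₀ c V) (h' : InCone C₄ c₀ c' V') (hc : |c| ≤ c₀) (hc' : |c'| ≤ c₀)
    (hV : ∀ x, theta A φ c V x = V x) (hV' : ∀ x, theta A φ c' V' x = V' x) :
    |rollS A V (φ 0) - rollS A V' (φ 0)| ≤ C * (2 * |c - c'|) := by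
  have he := H.e_bounds.2.2.2
  have key : ∀ n : ℕ, DerivBound 0 3 (8 / 7 * |c - c'| + 2 * e * (1 / 8) ^ n)
      (fun x => V x - V' x) := fun n => by
    induction n with
    | zero =>
      exact ((H.derivBound_four h hc).sub (H.derivBound_four h' hc') h.smooth h'.smooth).mono
        le_rfl (by omega) (by linarith [abs_nonneg (c - c')])
    | succ n ih =>
      refine ((H.theta_sub h h' hc hc' ih).congr_fun fun x => by rw [hV, hV']).mono
        le_rfl le_rfl ?_
      rw [pow_succ]; linarith
  have t1 : Tendsto (fun n : ℕ => 8 / 7 * |c - c'| + 2 * e * (1 / 8 : ℝ) ^ n) atTop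
      (nhds (8 / 7 * |c - c'|)) := by
    have := ((tendsto_pow_atTop_nhds_zero_of_lt_one (r := (1 / 8 : ℝ)) (by norm_num)
      (by norm_num)).const_mul (2 * e)).const_add (8 / 7 * |c - c'|)
    simpa using this
  have b : DerivBound 0 3 (2 * |c - c'|) (fun x => V x - V' x) := fun j h1 h2 x => by
    have := ge_of_tendsto' t1 fun n => key n j h1 h2 x
    linarith [abs_nonneg (c - c')]
  exact (H.contr.contract V V' φ _ h.smooth h'.smooth h.per h'.per (H.derivBound_four h hc)
    (H.derivBound_four h' hc') H.near_three b).1.apply_zero 0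

end

theorem hmap_of_le {V : ℝ → ℝ} {x : ℝ} (hx : x ≤ 1 / 4) : hmap V x = x := by
  simp [hmap, chi_zero hx]

theorem hmap_of_ge {V : ℝ → ℝ} {x : ℝ} (hx : 3 / 4 ≤ x) : hmap V x = x + V x := by
  simp [hmap, chi_one hx]

section

variable {V : ℝ → ℝ}

theorem Admissible.amap_mid (h : Admissible V) {x : ℝ} (h1 : 3 / 4 ≤ x) (h2 : x + V x ≤ 5 / 4) :
    amap V x = x + V x := by
  rw [amap, hmap_of_ge h1, h.imap_eq (y := x + V x - 1) (hmap_of_le (by linarith))]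
  ring

theorem Admissible.le_amap (h : Admissible V) (pV : ∀ x, V (x + 1) = V x) (hV : ∀ x, 0 ≤ V x)
    (x : ℝ) : x ≤ amap V x := by
  have h1 : hmap V (x - 1) ≤ hmap V x - 1 := by
    have e : V (x - 1) = V x := by rw [← pV, sub_add_cancel]
    have := chi_mono (show x - 1 ≤ x by linarith)
    have := hV x
    simp only [hmap, e]
    nlinarith
  have h2 := h.imap_mono.monotone h1
  rw [h.imap_hmap] at h2
  rw [amap]; linarith

theorem Admissible.amap_le (h : Admissible V) (pV : ∀ x, V (x + 1) = V x) (hV : ∀ x, V x ≤ 0)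
    (x : ℝ) : amap V x ≤ x := by
  have h1 : hmap V x - 1 ≤ hmap V (x - 1) := by
    have e : V (x - 1) = V x := by rw [← pV, sub_add_cancel]
    have := chi_mono (show x - 1 ≤ x by linarith)
    have := hV x
    simp only [hmap, e]
    nlinarith
  have h2 := h.imap_mono.monotone h1
  rw [h.imap_hmap] at h2
  rw [amap]; linarith

end

section

variable {F : ℝ → ℝ} {A : ℕ} {l : ℕ}

/-- The orbit of a point of the fundamental domain passes through the middle zone. -/
theorem Rollable.exists_hit (h : Rollable F A l) (hA : 4 ≤ A) (hF : ∀ x, F x ≤ x + 1 / 8) {x : ℝ}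
    (h0 : 0 ≤ x) (h1 : x < 1) : ∃ i < l, 3 / 4 * (A:ℝ) ≤ giter F i x + 1 ∧
      giter F i x + 1 ≤ 3 / 4 * A + 9 / 8 := by
  classical
  have hA' : (4:ℝ) ≤ A := by exact_mod_cast hA
  have ex : ∃ i, 3 / 4 * (A:ℝ) ≤ giter F i x + 1 :=
    ⟨A, by linarith [h.giter_lower A x]⟩
  have hl : A < l := by
    have := h.len
    have : (A:ℝ) < l := by linarith
    exact_mod_cast this
  refine ⟨Nat.find ex, lt_of_le_of_lt (Nat.find_min' ex ?_) hl, Nat.find_spec ex, ?_⟩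
  · linarith [h.giter_lower A x]
  · rcases hn : Nat.find ex with _ | n
    · simp only [giter]; linarith
    · have := Nat.find_min ex (m := n) (by omega)
      have := hF (giter F n x + 1)
      rw [giter]; linarith

theorem giter_mono_sub {F : ℝ → ℝ} (hF : ∀ x, x ≤ F x) (x : ℝ) {i j : ℕ} (hij : i ≤ j) :
    giter F i x - i ≤ giter F j x - j := by
  induction j, hij using Nat.le_induction with
  | base => exact le_rfl
  | succ j _ ih =>
    have := hF (giter F j x + 1)
    rw [giter]; push_cast; linarith

theorem giter_anti_sub {F : ℝ → ℝ} (hF : ∀ x, F x ≤ x) (x : ℝ) {i j : ℕ} (hij : i ≤ j) :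
    giter F j x - j ≤ giter F i x - i := by
  induction j, hij using Nat.le_induction with
  | base => exact le_rfl
  | succ j _ ih =>
    have := hF (giter F j x + 1)
    rw [giter]; push_cast; linarith

theorem Rollable.le_rollMap (h : Rollable F A l) (hA : 4 ≤ A) (hF : ∀ x, F x ≤ x + 1 / 8)
    (hF' : ∀ x, x ≤ F x) {δ : ℝ} (hδ : ∀ x, 3 / 4 * (A:ℝ) ≤ x → x ≤ 3 / 4 * A + 9 / 8 →
      x + δ ≤ F x) (x : ℝ) : x + δ ≤ rollMap F l x := by
  obtain ⟨i, hi, h1, h2⟩ := h.exists_hit hA hF (Int.fract_nonneg x) (Int.fract_lt_one x)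
  have a1 := giter_mono_sub hF' (Int.fract x) (Nat.zero_le i)
  have a2 := giter_mono_sub hF' (Int.fract x) (Nat.succ_le_of_lt hi)
  have a3 := hδ _ h1 h2
  rw [Nat.succ_eq_add_one, giter] at a2
  simp only [giter] at a1
  push_cast at a1 a2
  rw [rollMap]
  linarith [Int.fract_add_floor x]

theorem Rollable.rollMap_le (h : Rollable F A l) (hA : 4 ≤ A)
    (hF' : ∀ x, F x ≤ x) {δ : ℝ} (hδ : ∀ x, 3 / 4 * (A:ℝ) ≤ x → x ≤ 3 / 4 * A + 9 / 8 →
      F x ≤ x - δ) (x : ℝ) : rollMap F l x ≤ x - δ := by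
  obtain ⟨i, hi, h1, h2⟩ := h.exists_hit hA (fun x => (hF' x).trans (by linarith))
    (Int.fract_nonneg x) (Int.fract_lt_one x)
  have a1 := giter_anti_sub hF' (Int.fract x) (Nat.zero_le i)
  have a2 := giter_anti_sub hF' (Int.fract x) (Nat.succ_le_of_lt hi)
  have a3 := hδ _ h1 h2
  rw [Nat.succ_eq_add_one, giter] at a2
  simp only [giter] at a1
  push_cast at a1 a2
  rw [rollMap]
  linarith [Int.fract_add_floor x]

end

section

variable {A : ℕ} {e ε C C₄ c₀ c : ℝ} {φ V : ℝ → ℝ}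

theorem InCone.abs_sub_le (h : InCone C₄ c₀ c V) (x : ℝ) : |V x - c| ≤ c₀ / 4 := by
  have := periodic_abs_sub_le h.smooth h.per (periodic_derivBound h.smooth h.per h.third).deriv_le x
  rwa [h.zero] at this

theorem amapS_mid {A : ℕ} (hA : 32 ≤ A) (h : Admissible V) (hV : ∀ x, V x ≤ 1 / 8) {x : ℝ}
    (h1 : 3 / 4 * (A:ℝ) ≤ x) (h2 : x ≤ 3 / 4 * A + 9 / 8) :
    amapS A V x = x + A * V (x / A) := by
  have hA' : (32:ℝ) ≤ A := by exact_mod_cast hA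
  have hA0 : (0:ℝ) < A := by linarith
  have k1 : 3 / 4 ≤ x / A := by rwa [le_div_iff₀ hA0]
  have k2 : x / A ≤ 9 / 8 := by rw [div_le_iff₀ hA0]; linarith
  rw [amapS, dilate, h.amap_mid k1 (by linarith [hV (x / A)])]
  field_simp

theorem RollSetup.lt_roll (H : RollSetup A e ε C C₄ c₀ φ) (hA : 32 ≤ A) (h1 : c₀ ≤ 1 / 10)
    (h : InCone C₄ c₀ c₀ V) : c₀ < rollS A V (φ 0) := by
  have hc0 := H.pos
  have S := H.contr.scale
  have T := H.tame h (abs_of_pos hc0).le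
  have R := T.rollable S.four_le S.mul_le
  have hV : ∀ x, 3 / 4 * c₀ ≤ V x := fun x => by
    linarith [(abs_le.1 (h.abs_sub_le x)).1]
  have hA' : (32:ℝ) ≤ A := by exact_mod_cast hA
  have hle : ∀ x, x ≤ amapS A V x := fun x => by
    have := T.adm.le_amap h.per (fun x => by linarith [hV x]) (x / A)
    have h2 : (A:ℝ) * (x / A) ≤ A * amap V (x / A) := by gcongr
    rwa [mul_div_cancel₀ _ (by linarith)] at h2
  have hup : ∀ x, amapS A V x ≤ x + 1 / 8 := fun x => by
    linarith [(abs_le.1 (T.abs_amapS_sub_le (by omega) x)).2, S.mul_le]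
  have key := R.le_rollMap S.four_le hup hle (δ := 32 * (3 / 4 * c₀)) (fun x h1 h2 => by
    rw [amapS_mid hA T.adm (fun x => by linarith [(abs_le.1 (h.abs_sub_le x)).2]) h1 h2]
    have := hV (x / A)
    gcongr) (φ 0)
  have := (abs_le.1 H.near_zero).1
  rw [rollS]
  linarith

theorem RollSetup.roll_lt (H : RollSetup A e ε C C₄ c₀ φ) (hA : 32 ≤ A)
    (h : InCone C₄ c₀ (-c₀) V) : rollS A V (φ 0) < -c₀ := by
  have hc0 := H.pos
  have S := H.contr.scale
  have T := H.tame h (by rw [abs_neg, abs_of_pos hc0])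
  have R := T.rollable S.four_le S.mul_le
  have hV : ∀ x, V x ≤ -(3 / 4 * c₀) := fun x => by
    linarith [(abs_le.1 (h.abs_sub_le x)).2]
  have hA' : (32:ℝ) ≤ A := by exact_mod_cast hA
  have hle : ∀ x, amapS A V x ≤ x := fun x => by
    have := T.adm.amap_le h.per (fun x => by linarith [hV x]) (x / A)
    have h2 : (A:ℝ) * amap V (x / A) ≤ A * (x / A) := by gcongr
    rwa [mul_div_cancel₀ _ (by linarith)] at h2
  have key := R.rollMap_le S.four_le hle (δ := 32 * (3 / 4 * c₀)) (fun x h1 h2 => by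
    rw [amapS_mid hA T.adm (fun x => by linarith [hV x]) h1 h2]
    have := hV (x / A)
    nlinarith) (φ 0)
  have := (abs_le.1 H.near_zero).2
  rw [rollS]
  linarith

/-- By the intermediate value theorem, the constant may be chosen so that `V` solves the
functional equation exactly. -/
theorem RollSetup.exists_solution (H : RollSetup A e ε C C₄ c₀ φ) (hA : 2048 ≤ A)
    (h1 : c₀ ≤ 1 / 10) : ∃ c V, |c| ≤ c₀ ∧ InCone C₄ c₀ c V ∧ (∀ x, rollS A V (φ x) = x + V x) ∧
      ∀ (r : ℕ) (δ : ℝ), (∀ n, DerivBound 0 r δ (thetaIter A φ c n)) → DerivBound 0 r δ V := by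
  have hc0 := H.pos
  choose! V hV1 hV2 hV3 using fun (c : ℝ) (hc : |c| ≤ c₀) => H.exists_fixed hA hc
  have cont : ContinuousOn (fun c => rollS A (V c) (φ 0)) (Icc (-c₀) c₀) := by
    refine LipschitzOnWith.continuousOn (K := (C * 2).toNNReal) ?_
    refine LipschitzOnWith.of_dist_le_mul fun c hc c' hc' => ?_
    have k1 := abs_le.2 hc
    have k2 := abs_le.2 hc'
    have := H.fixed_sub (hV1 c k1) (hV1 c' k2) k1 k2 (hV2 c k1) (hV2 c' k2)
    rw [Real.coe_toNNReal _ (by linarith [H.contr.nonneg]), Real.dist_eq, Real.dist_eq]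
    linarith
  have e1 : |c₀| ≤ c₀ := (abs_of_pos hc0).le
  have e2 : |-c₀| ≤ c₀ := by rw [abs_neg]; exact e1
  have m := intermediate_value_Icc (by linarith : -c₀ ≤ c₀) (cont.sub continuousOn_id)
  obtain ⟨c, hc, he⟩ := m (show (0:ℝ) ∈ _ from
    ⟨by have := H.roll_lt (by omega) (hV1 _ e2); simp; linarith,
     by have := H.lt_roll (by omega) h1 (hV1 _ e1); simpa using this.le⟩)
  have hc' := abs_le.2 hc
  refine ⟨c, V c, hc', hV1 c hc', fun x => ?_, hV3 c hc'⟩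
  have := hV2 c hc' x
  rw [theta] at this
  simp only [Pi.sub_apply, id] at he
  linarith

end

/-- Small circle diffeomorphisms are trivialised by rolling up a small germ. -/
theorem exists_roll_solution : ∃ A₀ : ℕ, ∀ A ≥ A₀, 4 ≤ A ∧ ∀ (r : ℕ) (δ : ℝ), 0 < δ →
    ∃ s : ℕ, ∃ η > (0:ℝ), ∀ φ : ℝ → ℝ, IsSmooth φ → (∀ x, φ (x + 1) = φ x + 1) →
      DerivBound 0 s η (fun x => φ x - x) → ∃ V : ℝ → ℝ, IsSmooth V ∧ (∀ x, V (x + 1) = V x) ∧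
        DerivBound 0 r δ V ∧ Admissible V ∧ Rollable (amapS A V) A (2 * A + 4) ∧
        ∀ x, rollS A V (φ x) = x + V x := by
  obtain ⟨A₀, h⟩ := rollS_contraction
  refine ⟨max A₀ 2048, fun A hA => ?_⟩
  have hA2 : 2048 ≤ A := (le_max_right _ _).trans hA
  obtain ⟨e, he, he1, ε, C, S, hC, ht, hc⟩ := h A ((le_max_left _ _).trans hA)
  have K : Contracting A e ε C := ⟨S, hC, he1, ht, hc⟩
  obtain ⟨C₄, hC₄, hs⟩ := rollS_sharp hA2 (m := 2) le_rfl S zero_le_one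
  refine ⟨S.four_le, fun r δ hδ => ?_⟩
  obtain ⟨τ, hτ, hsm⟩ := exists_iter_small (C := C) (C₄ := C₄) (e := e) hA2 S r δ hδ
  have hq : 0 < 5 / 4 + 5 / 2 * C₄ := by positivity
  set c₀ := min (e / (5 / 4 + 5 / 2 * C₄)) (min τ (1 / 10)) with hc₀
  have c0pos : 0 < c₀ := by positivity
  refine ⟨max (r + 3) 4, min (c₀ / 16) τ, by positivity, fun φ sφ pφ hφ => ?_⟩
  have H : RollSetup A e ε C C₄ c₀ φ :=
    { contr := K, sharp := hs, sharp_nonneg := hC₄, pos := c0pos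
      le := by
        have : c₀ ≤ e / (5 / 4 + 5 / 2 * C₄) := min_le_left _ _
        rw [le_div_iff₀ hq] at this; linarith
      near := ⟨sφ, pφ, hφ.mono (Nat.zero_le _) (le_max_right _ _) (min_le_left _ _)⟩
      near_zero := by
        have := hφ 0 le_rfl (Nat.zero_le _) 0
        simp only [iteratedDeriv_zero, sub_zero] at this
        exact this.trans (min_le_left _ _) }
  obtain ⟨c, V, hc, hV, hsol, hb⟩ := H.exists_solution hA2
    ((min_le_right _ _).trans (min_le_right _ _))
  have T := H.tame hV hc
  exact ⟨V, hV.smooth, hV.per, hb r δ fun n => (hsm c₀ c φ H hc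
    ((min_le_right _ _).trans (min_le_left _ _))
    ⟨sφ, pφ, hφ.mono (Nat.zero_le _) (le_max_left _ _) (min_le_right _ _)⟩ n).mono le_rfl
      (by omega) le_rfl, T.adm, T.rollable S.four_le S.mul_le, hsol⟩

theorem DerivBound.sub_comm {i k : ℕ} {c : ℝ} {f g : ℝ → ℝ} (h : DerivBound i k c fun x => f x - g x)
    (sf : IsSmooth f) (sg : IsSmooth g) : DerivBound i k c fun x => g x - f x :=
  fun j h1 h2 x => by
    rw [iteratedDeriv_sub_fun sg sf, abs_sub_comm, ← iteratedDeriv_sub_fun sf sg]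
    exact h j h1 h2 x

theorem derivBound_id (k : ℕ) : DerivBound 1 k 1 (fun x => x) := fun j h1 _ x => by
  rcases eq_or_lt_of_le h1 with h | h
  · rw [← h, iteratedDeriv_fun_id_one, abs_one]
  · rw [iteratedDeriv_fun_id_two h, abs_zero]; exact zero_le_one

theorem DerivBound.one_of_sub_id {k : ℕ} {c : ℝ} {f : ℝ → ℝ} (sf : IsSmooth f)
    (h : DerivBound 0 k c (fun x => f x - x)) : DerivBound 1 k (c + 1) f :=
  ((h.mono zero_le_one le_rfl le_rfl).add (derivBound_id k) (sf.sub smooth_id) smooth_id).congr_fun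
    fun x => by ring

/-- An increasing smooth diffeomorphism of the line. -/
structure IsDiffeo (e : Equiv.Perm ℝ) : Prop where
  smooth : IsSmooth e
  inv_smooth : IsSmooth (e⁻¹ : Equiv.Perm ℝ)
  mono : StrictMono e

namespace IsDiffeo

variable {e e' : Equiv.Perm ℝ}

theorem one : IsDiffeo 1 := ⟨smooth_id, smooth_id, strictMono_id⟩

theorem mul (h : IsDiffeo e) (h' : IsDiffeo e') : IsDiffeo (e * e') :=
  ⟨h.smooth.comp_fun h'.smooth, by rw [mul_inv_rev]; exact h'.inv_smooth.comp_fun h.inv_smooth,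
    fun _ _ hxy => h.mono (h'.mono hxy)⟩

theorem inv (h : IsDiffeo e) : IsDiffeo e⁻¹ :=
  ⟨h.inv_smooth, by rw [inv_inv]; exact h.smooth, fun x y hxy => by
    by_contra hc
    have := h.mono.monotone (not_lt.1 hc)
    simp only [Equiv.Perm.coe_inv, Equiv.apply_symm_apply] at this
    exact absurd this (not_le.2 hxy)⟩

theorem pow (h : IsDiffeo e) (n : ℕ) : IsDiffeo (e ^ n) := by
  induction n with
  | zero => simpa using one
  | succ n ih => rw [pow_succ]; exact ih.mul h

theorem conj (h : IsDiffeo e) (h' : IsDiffeo e') : IsDiffeo (e * e' * e⁻¹) := (h.mul h').mul h.inv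

end IsDiffeo

/-- A sequence of diffeomorphisms of the line converging to the identity with all derivatives. -/
structure TendsToId (e : ℕ → Equiv.Perm ℝ) : Prop where
  diffeo : ∀ n, IsDiffeo (e n)
  bound : ∀ (r : ℕ) (ε : ℝ), 0 < ε → ∀ᶠ n in atTop, DerivBound 0 r ε (fun x => e n x - x)

/-- A diffeomorphism all of whose derivatives are bounded, together with those of its inverse. -/
structure IsTame (e : Equiv.Perm ℝ) : Prop where
  diffeo : IsDiffeo e
  bound : ∀ k, ∃ b, DerivBound 1 k b e
  inv_bound : ∀ k, ∃ b, DerivBound 1 k b (e⁻¹ : Equiv.Perm ℝ)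

theorem IsTame.inv {e : Equiv.Perm ℝ} (h : IsTame e) : IsTame e⁻¹ :=
  ⟨h.diffeo.inv, h.inv_bound, by rw [inv_inv]; exact h.bound⟩

theorem IsTame.one : IsTame 1 := ⟨IsDiffeo.one, fun k => ⟨1, derivBound_id k⟩,
  fun k => ⟨1, derivBound_id k⟩⟩

theorem IsTame.mul {e e' : Equiv.Perm ℝ} (h : IsTame e) (h' : IsTame e') : IsTame (e * e') := by
  refine ⟨h.diffeo.mul h'.diffeo, fun k => ?_, fun k => ?_⟩
  · obtain ⟨b, hb⟩ := h.bound k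
    obtain ⟨b', hb'⟩ := h'.bound k
    obtain ⟨C, -, hC⟩ := derivBound_comp_one k b'
    exact ⟨_, hC b e e' h.diffeo.smooth h'.diffeo.smooth hb hb'⟩
  · obtain ⟨b, hb⟩ := h.inv_bound k
    obtain ⟨b', hb'⟩ := h'.inv_bound k
    obtain ⟨C, -, hC⟩ := derivBound_comp_one k b
    rw [mul_inv_rev]
    exact ⟨_, hC b' (e'⁻¹ : Equiv.Perm ℝ) (e⁻¹ : Equiv.Perm ℝ) h'.diffeo.inv_smooth h.diffeo.inv_smooth hb' hb⟩

theorem IsTame.pow {e : Equiv.Perm ℝ} (h : IsTame e) (n : ℕ) : IsTame (e ^ n) := by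
  induction n with
  | zero => simpa using IsTame.one
  | succ n ih => rw [pow_succ]; exact ih.mul h

namespace TendsToId

variable {e e' : ℕ → Equiv.Perm ℝ}

theorem one : TendsToId fun _ => 1 := ⟨fun _ => IsDiffeo.one, fun r ε hε =>
  Eventually.of_forall fun n j _ _ x => by simp [hε.le]⟩

theorem mul (h : TendsToId e) (h' : TendsToId e') : TendsToId fun n => e n * e' n := by
  refine ⟨fun n => (h.diffeo n).mul (h'.diffeo n), fun r ε hε => ?_⟩
  obtain ⟨C, hC, hc⟩ := derivBound_comp r 2
  have hC0 : 0 < C := by linarith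
  filter_upwards [h.bound r (ε / (2 * C)) (by positivity), h'.bound r 1 one_pos,
    h'.bound r (ε / 2) (by positivity)] with n h1 h2 h3
  have s := (h.diffeo n).smooth
  have s' := (h'.diffeo n).smooth
  have h4 := hc _ _ _ (s.sub smooth_id) s' h1 (h2.one_of_sub_id s' |>.mono le_rfl le_rfl (by norm_num))
  refine ((h4.add h3 (IsSmooth.comp_fun (s.sub smooth_id) s') (s'.sub smooth_id)).mono le_rfl le_rfl
    (by field_simp; linarith)).congr_fun fun x => ?_
  simp

theorem inv (h : TendsToId e) : TendsToId fun n => (e n)⁻¹ := by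
  refine ⟨fun n => (h.diffeo n).inv, fun r ε hε => ?_⟩
  obtain ⟨C, hC, hc⟩ := inverse_derivBound r 1 zero_le_one
  obtain ⟨C', hC', hc'⟩ := derivBound_comp r (2 + C * 1)
  have hC0 : 0 < C' := by linarith
  filter_upwards [h.bound (r + 1) (1 / 2) (by positivity), h.bound r (ε / C') (by positivity)]
    with n h1 h2
  have s := (h.diffeo n).smooth
  have s' := (h.diffeo n).inv_smooth
  have hi : ∀ x, e n ((e n)⁻¹ x) = x := fun x => by simp
  have hd : ∀ x, 1 / 2 ≤ deriv (e n) x := fun x => by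
    have := (h1.mono zero_le_one le_rfl le_rfl).deriv_le x
    rw [deriv_fun_sub (s.diffAt x) differentiableAt_fun_id] at this
    simp only [deriv_id''] at this
    linarith [(abs_le.1 this).1]
  have k1 := hc 1 _ _ zero_le_one le_rfl s s' hi hd
    ((h1.of_sub_id s).mono le_rfl le_rfl (by norm_num))
  have k2 := DerivBound.one_of_two (abs_deriv_inverse_le s s' hi hd) k1 (by linarith) (by norm_num)
  have k3 := hc' _ _ _ (smooth_id.sub s) s' (h2.sub_comm s smooth_id)
    (k2.mono le_rfl (Nat.le_succ _) le_rfl)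
  refine (k3.mono le_rfl le_rfl (by field_simp; rfl)).congr_fun fun x => ?_
  simp

theorem conj (h : TendsToId e) {S : Equiv.Perm ℝ} (hS : IsTame S) :
    TendsToId fun n => S * e n * S⁻¹ := by
  refine ⟨fun n => hS.diffeo.conj (h.diffeo n), fun r ε hε => ?_⟩
  obtain ⟨b, hb⟩ := hS.bound (r + 1)
  obtain ⟨b', hb'⟩ := hS.inv_bound r
  obtain ⟨C, hC, hc⟩ := derivBound_comp r b'
  obtain ⟨C', hC', hc'⟩ := derivBound_comp_sub r 2
  have hb0 : 0 ≤ b := hb.nonneg (by omega)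
  have hq : 0 < C * (C' * (b + 1)) := by positivity
  filter_upwards [h.bound r (ε / (C * (C' * (b + 1)))) (by positivity), h.bound r 1 one_pos]
    with n h1 h2
  have s := (h.diffeo n).smooth
  have sS := hS.diffeo.smooth
  have k1 := hc' (b + 1) _ _ _ _ sS s smooth_id (hb.mono le_rfl le_rfl (by linarith))
    ((h2.one_of_sub_id s).mono le_rfl le_rfl (by norm_num))
    ((derivBound_id r).mono le_rfl le_rfl (by norm_num)) h1
  have k2 := hc _ _ _ ((sS.comp_fun s).sub sS) hS.diffeo.inv_smooth k1 hb'
  refine (k2.mono le_rfl le_rfl (by field_simp; rfl)).congr_fun fun x => ?_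
  simp

end TendsToId

/-- The unit translation. -/
def unitShift : Equiv.Perm ℝ := Equiv.addRight 1

theorem unitShift_apply (x : ℝ) : unitShift x = x + 1 := rfl

theorem unitShift_inv_apply (x : ℝ) : unitShift⁻¹ x = x - 1 := by
  simp [unitShift, sub_eq_add_neg]

/-- The permutation `(F T)^N T^{-N}` where `T` is the unit translation. -/
def rollPerm (F : Equiv.Perm ℝ) : ℕ → Equiv.Perm ℝ
  | 0 => 1
  | N + 1 => F * (unitShift * rollPerm F N * unitShift⁻¹)

theorem rollPerm_succ_apply (F : Equiv.Perm ℝ) (N : ℕ) (x : ℝ) :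
    rollPerm F (N + 1) x = F (rollPerm F N (x - 1) + 1) := by
  simp [rollPerm, unitShift, sub_eq_add_neg]

theorem rollPerm_apply (F : Equiv.Perm ℝ) (N : ℕ) (x : ℝ) :
    rollPerm F N x = giter F N (x - N) := by
  induction N generalizing x with
  | zero => simp [rollPerm, giter]
  | succ N ih => rw [rollPerm_succ_apply, ih, giter]; push_cast; ring_nf

theorem rollPerm_of_le {F : Equiv.Perm ℝ} {c : ℝ} (h : ∀ x ≤ c, F x = x) (N : ℕ) {x : ℝ}
    (hx : x ≤ c) : rollPerm F N x = x := by
  induction N generalizing x with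
  | zero => rfl
  | succ N ih => rw [rollPerm_succ_apply, ih (by linarith), sub_add_cancel, h x hx]

theorem rollPerm_add_one {F : Equiv.Perm ℝ} {c : ℝ} (h : ∀ x ≤ c, F x = x) {N : ℕ} {x : ℝ}
    (hx : x + 1 - N ≤ c) : rollPerm F N (x + 1) = F (rollPerm F N x + 1) := by
  have h1 := rollPerm_succ_apply F N (x + 1)
  rw [add_sub_cancel_right] at h1
  rw [← h1, rollPerm_apply, rollPerm_apply, giter_succ', h _ (by push_cast; linarith)]
  congr 1; push_cast; ring

theorem commute_of_le {a b : Equiv.Perm ℝ} {c : ℝ} (ha : ∀ x, c ≤ x → a x = x)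
    (hb : ∀ x ≤ c, b x = x) : Commute a b :=
  Equiv.Perm.Disjoint.commute fun x => (le_total c x).imp (ha x) (hb x)

theorem rollPerm_mul {F G : Equiv.Perm ℝ} {c : ℝ} (hG : ∀ x, c ≤ x → G x = x)
    (hF : ∀ x ≤ c, F x = x) (N : ℕ) : rollPerm (F * G) N = rollPerm F N * rollPerm G N := by
  induction N with
  | zero => rfl
  | succ N ih =>
    have hc : Commute G (unitShift * rollPerm F N * unitShift⁻¹) :=
      commute_of_le hG fun x hx => by
        rw [Equiv.Perm.mul_apply, Equiv.Perm.mul_apply, unitShift_inv_apply,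
          rollPerm_of_le hF N (by linarith), unitShift_apply, sub_add_cancel]
    have e : unitShift * (rollPerm F N * rollPerm G N) * unitShift⁻¹ =
        (unitShift * rollPerm F N * unitShift⁻¹) * (unitShift * rollPerm G N * unitShift⁻¹) := by
      group
    rw [rollPerm, rollPerm, rollPerm, ih, e, mul_assoc F G, ← mul_assoc G, hc.eq]
    simp only [mul_assoc]

theorem rollPerm_conj (h : Equiv.Perm ℝ) (N : ℕ) :
    rollPerm (h⁻¹ * unitShift * h * unitShift⁻¹) N =
      h⁻¹ * unitShift ^ N * h * (unitShift⁻¹) ^ N := by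
  induction N with
  | zero => simp [rollPerm]
  | succ N ih => rw [rollPerm, ih, pow_succ', pow_succ]; group

theorem unitShift_pow_apply (N : ℕ) (x : ℝ) : (unitShift ^ N) x = x + N := by
  induction N with
  | zero => simp
  | succ N ih => rw [pow_succ', Equiv.Perm.mul_apply, ih, unitShift_apply]; push_cast; ring

theorem unitShift_inv_pow_apply (N : ℕ) (x : ℝ) : (unitShift⁻¹ ^ N) x = x - N := by
  rw [inv_pow, Equiv.Perm.inv_eq_iff_eq, unitShift_pow_apply]; ring

theorem isTame_unitShift : IsTame unitShift := by
  have e : ⇑(unitShift⁻¹ : Equiv.Perm ℝ) = fun x => x - 1 := funext unitShift_inv_apply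
  refine ⟨⟨smooth_id.add contDiff_const, by rw [e]; exact smooth_id.sub contDiff_const,
    fun x y h => by rw [unitShift_apply, unitShift_apply]; linarith⟩, fun k => ⟨1, ?_⟩,
    fun k => ⟨1, ?_⟩⟩
  · exact (derivBound_id k).add_const le_rfl 1
  · rw [e]; exact (derivBound_id k).sub_const le_rfl 1

theorem TendsToId.rollPerm {F : ℕ → Equiv.Perm ℝ} (h : TendsToId F) (N : ℕ) :
    TendsToId fun n => rollPerm (F n) N := by
  induction N with
  | zero => exact TendsToId.one
  | succ N ih => exact h.mul (ih.conj isTame_unitShift)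

theorem IsDiffeo.rollPerm {F : Equiv.Perm ℝ} (h : IsDiffeo F) (N : ℕ) :
    IsDiffeo (rollPerm F N) := by
  induction N with
  | zero => exact IsDiffeo.one
  | succ N ih => exact h.mul (isTame_unitShift.diffeo.conj ih)

section giter

variable {F : ℝ → ℝ}

theorem giter_add (F : ℝ → ℝ) (i j : ℕ) (x : ℝ) : giter F (i + j) x = giter F j (giter F i x) := by
  induction j with
  | zero => rfl
  | succ j ih => rw [← add_assoc, giter, ih, giter]

theorem giter_of_le {c : ℝ} (h : ∀ x ≤ c, F x = x) (j : ℕ) {x : ℝ} (hx : x + j ≤ c) :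
    giter F j x = x + j := by
  induction j with
  | zero => simp [giter]
  | succ j ih =>
    push_cast at hx ⊢
    rw [giter, ih (by linarith), h _ (by linarith)]; ring

theorem giter_of_ge {c : ℝ} (h : ∀ x, c ≤ x → F x = x) (j : ℕ) {x : ℝ} (hx : c ≤ x + 1) :
    giter F j x = x + j := by
  induction j with
  | zero => simp [giter]
  | succ j ih =>
    have : (0:ℝ) ≤ j := by positivity
    push_cast
    rw [giter, ih, h _ (by linarith)]; ring

theorem giter_eq_rollMap {c : ℝ} {i l N : ℕ} (h1 : ∀ x ≤ 1, F x = x) (h2 : ∀ x, c ≤ x → F x = x)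
    (hi : ∀ y, 0 ≤ y → y < 1 → c ≤ giter F i y + 1) (hl : i ≤ l) {x : ℝ} (hx : (i:ℝ) ≤ x)
    (hN : x < N + 1) : giter F N (x - N) = rollMap F l x := by
  obtain ⟨m, hm⟩ : ∃ m : ℕ, (m:ℤ) = ⌊x⌋ :=
    ⟨⌊x⌋.toNat, Int.toNat_of_nonneg (Int.floor_nonneg.2 ((Nat.cast_nonneg i).trans hx))⟩
  have hm' : (m:ℝ) = ⌊x⌋ := by rw [← hm]; simp
  have hfx : x = Int.fract x + m := by rw [hm']; exact (Int.fract_add_floor x).symm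
  have f0 := Int.fract_nonneg x
  have f1 := Int.fract_lt_one x
  have him : i ≤ m := by
    have : (i:ℝ) < m + 1 := by linarith
    have : i < m + 1 := by exact_mod_cast this
    omega
  have hmN : m ≤ N := by
    have : (m:ℝ) < N + 1 := by linarith
    have : m < N + 1 := by exact_mod_cast this
    omega
  obtain ⟨j, rfl⟩ := Nat.exists_eq_add_of_le' hmN
  obtain ⟨p, rfl⟩ := Nat.exists_eq_add_of_le him
  obtain ⟨q, rfl⟩ := Nat.exists_eq_add_of_le hl
  have k := hi _ f0 f1
  rw [giter_add, giter_of_le h1 j (by push_cast at hfx ⊢; linarith)]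
  have e : x - ((j + (i + p) : ℕ):ℝ) + j = Int.fract x := by push_cast at hfx ⊢; linarith
  rw [e, giter_add, giter_of_ge h2 p k, rollMap, giter_add, giter_of_ge h2 q k, ← hm']
  push_cast; ring

theorem abs_giter_sub_le {κ : ℝ} (h : ∀ x, |F x - x| ≤ κ) (i : ℕ) (x : ℝ) :
    |giter F i x - x - i| ≤ κ * i := by
  induction i with
  | zero => simp [giter]
  | succ i ih =>
    have := h (giter F i x + 1)
    rw [abs_le] at *
    push_cast
    rw [giter]
    constructor <;> linarith [this.1, this.2, ih.1, ih.2]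

theorem abs_rollMap_sub_le {κ : ℝ} (h : ∀ x, |F x - x| ≤ κ) (l : ℕ) (x : ℝ) :
    |rollMap F l x - x| ≤ κ * l := by
  have := abs_giter_sub_le h l (Int.fract x)
  have e := Int.fract_add_floor x
  rw [rollMap]
  convert this using 2
  linarith

theorem giter_shift (F : ℝ → ℝ) (D : ℝ) (i : ℕ) (x : ℝ) :
    giter (fun x => F (x - D) + D) i x = giter F i (x - D) + D := by
  induction i with
  | zero => simp [giter]
  | succ i ih => rw [giter, ih, giter]; ring_nf

theorem rollMap_add_nat (F : ℝ → ℝ) (l D : ℕ) (x : ℝ) :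
    rollMap F l (x + D) = rollMap F l x + D := by
  induction D with
  | zero => simp
  | succ D ih => push_cast; rw [← add_assoc, rollMap_add_one, ih]; ring

end giter

/-- A diffeomorphism equal to the identity on an interval splits into two pieces. -/
theorem exists_cut {W : Equiv.Perm ℝ} (hW : IsDiffeo W) {c d : ℝ} (hcd : c < d)
    (h : ∀ x, c ≤ x → x ≤ d → W x = x) : ∃ w : Equiv.Perm ℝ, IsDiffeo w ∧
      (∀ x ≤ d, w x = W x) ∧ (∀ x, c ≤ x → w x = x) ∧ ∀ (r : ℕ) (ε : ℝ), 0 ≤ ε →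
      DerivBound 0 r ε (fun x => W x - x) → DerivBound 0 r ε (fun x => w x - x) := by
  classical
  have hWi : ∀ x, c ≤ x → x ≤ d → W⁻¹ x = x := fun x h1 h2 => by
    rw [Equiv.Perm.inv_eq_iff_eq, h x h1 h2]
  have key : ∀ U : Equiv.Perm ℝ, IsDiffeo U → (∀ x, c ≤ x → x ≤ d → U x = x) →
      (∀ x ≤ c, U x ≤ c) ∧ (∀ x ≤ d, (if x ≤ c then U x else x) = U x) ∧
      IsSmooth (fun x => if x ≤ c then U x else x) := fun U hU h => by
    have k1 : ∀ x ≤ d, (if x ≤ c then U x else x) = U x := fun x hx => by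
      split_ifs with hc
      · rfl
      · rw [h x (not_le.1 hc).le hx]
    refine ⟨fun x hx => ?_, k1, contDiff_iff_contDiffAt.2 fun x => ?_⟩
    · have := hU.mono.monotone hx
      rwa [h c le_rfl hcd.le] at this
    · rcases lt_or_ge x d with hx | hx
      · refine hU.smooth.contDiffAt.congr_of_eventuallyEq ?_
        filter_upwards [Iio_mem_nhds hx] with y hy using k1 y (le_of_lt hy)
      · refine contDiffAt_id.congr_of_eventuallyEq ?_
        filter_upwards [Ioi_mem_nhds (hcd.trans_le hx)] with y hy
        rw [if_neg (not_le.2 hy)]; rfl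
  obtain ⟨a1, a2, a3⟩ := key W hW h
  obtain ⟨b1, b2, b3⟩ := key W⁻¹ hW.inv hWi
  let w : Equiv.Perm ℝ :=
    { toFun := fun x => if x ≤ c then W x else x
      invFun := fun x => if x ≤ c then W⁻¹ x else x
      left_inv := fun x => by
        by_cases hx : x ≤ c
        · simp only [if_pos hx, if_pos (a1 x hx)]; simp
        · simp only [if_neg hx]
      right_inv := fun x => by
        by_cases hx : x ≤ c
        · simp only [if_pos hx, if_pos (b1 x hx)]; simp
        · simp only [if_neg hx] }
  have hw : ∀ x, w x = if x ≤ c then W x else x := fun x => rfl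
  have hge : ∀ x, c ≤ x → w x = x := fun x hx => by
    rw [hw]
    split_ifs with hc
    · exact h x hx (hc.trans hcd.le)
    · rfl
  refine ⟨w, ⟨a3, b3, fun x y hxy => ?_⟩, a2, hge, fun r ε hε hb j h1 h2 x => ?_⟩
  · rcases le_total y c with hy | hy
    · rw [hw, hw, if_pos hy, if_pos (hxy.le.trans hy)]; exact hW.mono hxy
    · rw [hge y hy]
      rcases le_total x c with hx | hx
      · rcases eq_or_lt_of_le hx with e | e
        · rw [hge x e.ge]; exact hxy
        · have := hW.mono e
          rw [h c le_rfl hcd.le] at this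
          rw [hw, if_pos hx]; linarith
      · rwa [hge x hx]
  · rcases lt_or_ge x d with hx | hx
    · have : (fun x => w x - x) =ᶠ[nhds x] fun x => W x - x := by
        filter_upwards [Iio_mem_nhds hx] with y hy
        rw [show w y = W y from a2 y (le_of_lt hy)]
      rw [this.iteratedDeriv_eq]
      exact hb j h1 h2 x
    · have : (fun x => w x - x) =ᶠ[nhds x] fun _ => 0 := by
        filter_upwards [Ioi_mem_nhds (hcd.trans_le hx)] with y hy
        rw [hge y (le_of_lt hy), sub_self]
      rw [this.iteratedDeriv_eq]
      simp [hε]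

section

variable {V : ℝ → ℝ}

/-- The diffeomorphism `hmap V`. -/
def hPerm (h : Admissible V) : Equiv.Perm ℝ := ⟨hmap V, imap V, h.imap_hmap, h.hmap_imap⟩

/-- The diffeomorphism `amap V`. -/
def aPerm (h : Admissible V) : Equiv.Perm ℝ :=
  unitShift * (hPerm h)⁻¹ * unitShift⁻¹ * hPerm h

theorem hPerm_apply (h : Admissible V) (x : ℝ) : hPerm h x = hmap V x := rfl

theorem hPerm_inv_apply (h : Admissible V) (x : ℝ) : (hPerm h)⁻¹ x = imap V x := rfl

theorem aPerm_apply (h : Admissible V) (x : ℝ) : aPerm h x = amap V x := by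
  rw [aPerm, Equiv.Perm.mul_apply, Equiv.Perm.mul_apply, Equiv.Perm.mul_apply,
    unitShift_inv_apply, unitShift_apply, hPerm_inv_apply, hPerm_apply, amap]

theorem aPerm_inv (h : Admissible V) :
    (aPerm h)⁻¹ = (hPerm h)⁻¹ * unitShift * hPerm h * unitShift⁻¹ := by
  rw [aPerm]; group

theorem isDiffeo_hPerm (h : Admissible V) : IsDiffeo (hPerm h) :=
  ⟨hmap_smooth h.smooth, h.imap_smooth, h.bij.1⟩

theorem isDiffeo_aPerm (h : Admissible V) : IsDiffeo (aPerm h) :=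
  isTame_unitShift.diffeo.conj (isDiffeo_hPerm h).inv |>.mul (isDiffeo_hPerm h)

theorem aPerm_inv_of_le (h : Admissible V) {x : ℝ} (hx : x ≤ 1 / 4) : (aPerm h)⁻¹ x = x := by
  rw [Equiv.Perm.inv_eq_iff_eq, aPerm_apply, h.amap_of_le hx]

theorem aPerm_inv_of_ge (h : Admissible V) (per : ∀ x, V (x + 1) = V x) {x : ℝ}
    (hx : 7 / 4 ≤ x) : (aPerm h)⁻¹ x = x := by
  rw [Equiv.Perm.inv_eq_iff_eq, aPerm_apply, h.amap_of_ge per hx]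

theorem rollPerm_aPerm_inv (h : Admissible V) (N : ℕ) {x : ℝ} (hx : x - N ≤ 1 / 4) :
    rollPerm (aPerm h)⁻¹ N x = imap V x := by
  rw [aPerm_inv, rollPerm_conj]
  simp only [Equiv.Perm.mul_apply, unitShift_pow_apply, unitShift_inv_pow_apply, hPerm_apply,
    hPerm_inv_apply]
  rw [hmap_of_le hx, sub_add_cancel]

end

section

variable {V : ℝ → ℝ} {A D : ℕ} {f at' : Equiv.Perm ℝ}

/-- At the far right, the product of rolled-up maps is trivial. -/
theorem rollPerm_core (adm : Admissible V) (per : ∀ x, V (x + 1) = V x) (hV : ∀ x, |V x| ≤ 1 / 8)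
    (R : Rollable (amapS A V) A (2 * A + 4)) (hD : 2 ≤ D) (f2 : ∀ x ≤ 2, f x = x)
    (fD : ∀ x, (D:ℝ) ≤ x → f x = x) {κ : ℝ} (hκ : ∀ x, |f x - x| ≤ κ)
    (hκD : κ * ((2 * D + 4 : ℕ) : ℝ) ≤ 1)
    (sol : ∀ x, rollS A V (rollMap f (2 * D + 4) x) = x + V x)
    (hat : ∀ x, at' x = amapS A V (x - D) + D) {N : ℕ} {x : ℝ}
    (hx : (D:ℝ) + 2 * A + 6 ≤ x) (hN : x ≤ N - 2) :
    rollPerm (at' * f * (aPerm adm)⁻¹) N x = x := by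
  have hD' : (2:ℝ) ≤ D := by exact_mod_cast hD
  have hA0 : (0:ℝ) ≤ A := by positivity
  have hat1 : ∀ x ≤ (D:ℝ), at' x = x := fun x hx => by
    rw [hat, R.left _ (by linarith)]; ring
  rw [rollPerm_mul (c := 2) (fun x hx => aPerm_inv_of_ge adm per (by linarith)) (fun x hx => by
    rw [Equiv.Perm.mul_apply, f2 x hx, hat1 x (by linarith)]), rollPerm_mul (c := D) fD hat1,
    Equiv.Perm.mul_apply, Equiv.Perm.mul_apply, rollPerm_aPerm_inv adm N (by linarith)]
  set y := imap V x with hy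
  have hyx : hmap V y = x := adm.hmap_imap x
  have hy1 : 3 / 4 ≤ y := by
    by_contra hc
    have := adm.bij.1 (not_le.1 hc)
    rw [hyx, hmap_of_ge le_rfl] at this
    linarith [(abs_le.1 (hV (3 / 4))).2]
  rw [hmap_of_ge hy1] at hyx
  have hVy := abs_le.1 (hV y)
  have hk0 : 0 ≤ κ := (abs_nonneg _).trans (hκ 0)
  have hφ := abs_le.1 ((abs_rollMap_sub_le hκ (2 * D + 4) y).trans hκD)
  have e1 : rollPerm f N y = rollMap f (2 * D + 4) y := by
    rw [rollPerm_apply]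
    refine giter_eq_rollMap (c := D) (i := D + 1) (fun x hx => f2 x (by linarith)) fD
      (fun z h0 _ => ?_) (by omega) (by push_cast; linarith) (by linarith)
    have := abs_le.1 (abs_giter_sub_le hκ (D + 1) z)
    push_cast at this hκD
    nlinarith
  rw [e1]
  set z := rollMap f (2 * D + 4) y with hz
  have e2 : rollPerm at' N z = rollS A V z := by
    rw [rollPerm_apply, show (at' : ℝ → ℝ) = fun x => amapS A V (x - D) + D from funext hat,
      giter_shift, show z - N - (D:ℝ) = z - D - N by ring,
      giter_eq_rollMap (c := 7 / 4 * A) (i := 2 * A + 4) (l := 2 * A + 4)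
        (fun x hx => R.left x hx) (fun x hx => R.right x hx)
      (fun u h0 _ => ?_) le_rfl (by push_cast; linarith) (by linarith), ← rollMap_add_nat,
      sub_add_cancel, rollS]
    have := R.giter_lower (2 * A + 4) u
    push_cast at this
    linarith
  rw [e2, hz, sol, hyx]

/-- The map `at' * f * a⁻¹` is a commutator with any map agreeing with a translation. -/
theorem exists_core_commutator (adm : Admissible V) (per : ∀ x, V (x + 1) = V x)
    (hV : ∀ x, |V x| ≤ 1 / 8)
    (R : Rollable (amapS A V) A (2 * A + 4)) (hD : 2 ≤ D) (hf : IsDiffeo f) (f2 : ∀ x ≤ 2, f x = x)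
    (fD : ∀ x, (D:ℝ) ≤ x → f x = x) {κ : ℝ} (hκ : ∀ x, |f x - x| ≤ κ)
    (hκD : κ * ((2 * D + 4 : ℕ) : ℝ) ≤ 1)
    (sol : ∀ x, rollS A V (rollMap f (2 * D + 4) x) = x + V x)
    (hat : ∀ x, at' x = amapS A V (x - D) + D) (dat : IsDiffeo at') {t : Equiv.Perm ℝ}
    (t1 : ∀ x, x ≤ t x) (t2 : ∀ x ≤ -1, t x ≤ 0)
    (t3 : ∀ x, -1 ≤ x → x ≤ (D:ℝ) + 2 * A + 6 → t x = x + 1) :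
    ∃ w : Equiv.Perm ℝ, IsDiffeo w ∧ (∀ x ≤ 0, w x = x) ∧ (∀ x, (D:ℝ) + 2 * A + 6 ≤ x → w x = x) ∧
      (∀ (r : ℕ) (ε : ℝ), 0 ≤ ε → DerivBound 0 r ε
        (fun x => rollPerm (at' * f * (aPerm adm)⁻¹) (D + 2 * A + 10) x - x) →
        DerivBound 0 r ε (fun x => w x - x)) ∧
      at' * f * (aPerm adm)⁻¹ = w * t * w⁻¹ * t⁻¹ := by
  have hD' : (2:ℝ) ≤ D := by exact_mod_cast hD
  have hA0 : (0:ℝ) ≤ A := by positivity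
  set F := at' * f * (aPerm adm)⁻¹ with hF
  have dF : IsDiffeo F := (dat.mul hf).mul (isDiffeo_aPerm adm).inv
  have F0 : ∀ x ≤ 0, F x = x := fun x hx => by
    rw [hF, Equiv.Perm.mul_apply, Equiv.Perm.mul_apply, aPerm_inv_of_le adm (by linarith),
      f2 x (by linarith), hat, R.left _ (by linarith)]; ring
  have F1 : ∀ x, (D:ℝ) + 2 * A + 6 ≤ x → F x = x := fun x hx => by
    rw [hF, Equiv.Perm.mul_apply, Equiv.Perm.mul_apply, aPerm_inv_of_ge adm per (by linarith),
      fD x (by linarith), hat, R.right _ (by linarith)]; ring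
  set B : ℝ := (D:ℝ) + 2 * A + 6 with hB
  obtain ⟨N, hN⟩ : ∃ N, N = D + 2 * A + 10 := ⟨_, rfl⟩
  have hNB : (N:ℝ) = B + 4 := by rw [hN, hB]; push_cast; ring
  rw [← hN]
  obtain ⟨w, dw, w1, w2, w3⟩ := exists_cut (dF.rollPerm N) (c := B) (d := B + 2) (by linarith)
    fun x h1 h2 => rollPerm_core adm per hV R hD f2 fD hκ hκD sol hat h1 (by linarith)
  have w0 : ∀ x ≤ 0, w x = x := fun x hx => by
    rw [w1 x (by linarith), rollPerm_of_le F0 N hx]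
  refine ⟨w, dw, w0, w2, w3, ?_⟩
  rw [eq_mul_inv_iff_mul_eq, eq_mul_inv_iff_mul_eq]
  ext x
  simp only [Equiv.Perm.mul_apply]
  rcases le_total x (-1) with h1 | h1
  · rw [w0 x (by linarith), F0 _ (t2 x h1), w0 _ (t2 x h1)]
  · rcases le_total x B with h2 | h2
    · have k1 : -1 ≤ w x := by
        have := dw.mono.monotone h1
        rwa [w0 _ (by norm_num)] at this
      have k2 : w x ≤ B := by
        have := dw.mono.monotone h2
        rwa [w2 _ le_rfl] at this
      rw [t3 x h1 h2, t3 _ k1 k2, w1 x (by linarith), w1 (x + 1) (by linarith),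
        rollPerm_add_one F0 (by linarith)]
    · have := t1 x
      rw [w2 x h2, F1 _ (by linarith), w2 _ (by linarith)]

end

/-- The product `a (S a S⁻¹) ⋯ (S^(M-1) a S^(1-M))`. -/
def conjProd (a S : Equiv.Perm ℝ) : ℕ → Equiv.Perm ℝ
  | 0 => 1
  | M + 1 => a * (S * conjProd a S M * S⁻¹)

theorem conjProd_succ (a S : Equiv.Perm ℝ) (M : ℕ) :
    conjProd a S (M + 1) = conjProd a S M * (S ^ M * a * (S ^ M)⁻¹) := by
  induction M with
  | zero => simp [conjProd]
  | succ M ih =>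
    have h : conjProd a S (M + 1 + 1) = a * (S * conjProd a S (M + 1) * S⁻¹) := rfl
    have h' : conjProd a S (M + 1) = a * (S * conjProd a S M * S⁻¹) := rfl
    rw [h]
    nth_rewrite 1 [ih]
    rw [h', pow_succ']; group

theorem conjProd_commutator {a S : Equiv.Perm ℝ} {M : ℕ}
    (h : Commute (conjProd a S M) (S ^ M * a * (S ^ M)⁻¹)) :
    conjProd a S M * S * (conjProd a S M)⁻¹ * S⁻¹ = (S ^ M * a * (S ^ M)⁻¹)⁻¹ * a := by
  have e : S * conjProd a S M * S⁻¹ = a⁻¹ * conjProd a S M * (S ^ M * a * (S ^ M)⁻¹) := by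
    rw [mul_assoc a⁻¹, ← conjProd_succ, conjProd]; group
  have e2 : conjProd a S M * S * (conjProd a S M)⁻¹ * S⁻¹ =
      conjProd a S M * (S * conjProd a S M * S⁻¹)⁻¹ := by group
  rw [e2, e, mul_assoc a⁻¹, h.eq]; group

theorem IsDiffeo.conjProd {a S : Equiv.Perm ℝ} (ha : IsDiffeo a) (hS : IsDiffeo S) (M : ℕ) :
    IsDiffeo (conjProd a S M) := by
  induction M with
  | zero => exact IsDiffeo.one
  | succ M ih => exact ha.mul (hS.conj ih)

theorem TendsToId.conjProd {a : ℕ → Equiv.Perm ℝ} {S : Equiv.Perm ℝ} (ha : TendsToId a)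
    (hS : IsTame S) (M : ℕ) : TendsToId fun n => conjProd (a n) S M := by
  induction M with
  | zero => exact TendsToId.one
  | succ M ih => exact ha.mul (ih.conj hS)

/-- `S` agrees on `[0, D + 2 * A + 6]` with the scaling by `lam` centred at `-n`, where
`lam ^ M = A`, and `t` agrees with the unit translation on `[-1, D + 2 * A + 6]`. -/
structure Scaffold (A D n M : ℕ) (lam : ℝ) (S t : Equiv.Perm ℝ) : Prop where
  four_le : 4 ≤ A
  one_lt : 1 < lam
  pow_eq : lam ^ M = A
  gap : 2 ≤ (lam - 1) * n
  D_eq : (D : ℝ) = A * n - n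
  two_le : 2 ≤ D
  tame_S : IsTame S
  tame_t : IsTame t
  S_eq : ∀ x, 0 ≤ x → x ≤ (D:ℝ) + 2 * A + 6 → S x = lam * (x + n) - n
  t_ge : ∀ x, x ≤ t x
  t_neg : ∀ x ≤ -1, t x ≤ 0
  t_eq : ∀ x, -1 ≤ x → x ≤ (D:ℝ) + 2 * A + 6 → t x = x + 1

namespace Scaffold

variable {A D n M : ℕ} {lam : ℝ} {S t : Equiv.Perm ℝ}

theorem S_pow (H : Scaffold A D n M lam S t) {x : ℝ} (h0 : 0 ≤ x) (h2 : x ≤ 2) {j : ℕ}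
    (hj : j ≤ M) : (S ^ j) x = lam ^ j * (x + n) - n := by
  induction j with
  | zero => simp
  | succ j ih =>
    have hn : (0:ℝ) ≤ n := by positivity
    have h1 : 1 ≤ lam ^ j := one_le_pow₀ H.one_lt.le
    have h3 : lam ^ j ≤ A := H.pow_eq ▸ pow_le_pow_right₀ H.one_lt.le (by omega)
    have h4 : lam ^ j * (x + n) ≤ A * (2 + n) := by gcongr
    have h5 : 1 * (x + n) ≤ lam ^ j * (x + n) := by gcongr
    have := H.D_eq
    rw [pow_succ', Equiv.Perm.mul_apply, ih (by omega), H.S_eq _ (by linarith) (by linarith)]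
    ring

theorem S_pow_eq (H : Scaffold A D n M lam S t) {x : ℝ} (h0 : 0 ≤ x) (h2 : x ≤ 2) :
    (S ^ M) x = A * x + D := by
  rw [H.S_pow h0 h2 le_rfl, H.pow_eq, H.D_eq]; ring

variable {V : ℝ → ℝ}

theorem conj_apply (H : Scaffold A D n M lam S t) (adm : Admissible V)
    (per : ∀ x, V (x + 1) = V x) (R : Rollable (amapS A V) A (2 * A + 4)) (x : ℝ) :
    (S ^ M * aPerm adm * (S ^ M)⁻¹) x = amapS A V (x - D) + D := by
  have hA : (4:ℝ) ≤ A := by exact_mod_cast H.four_le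
  have dS := H.tame_S.diffeo.pow M
  obtain ⟨y, rfl⟩ := (S ^ M).surjective x
  simp only [Equiv.Perm.mul_apply, Equiv.Perm.coe_inv, Equiv.symm_apply_apply, aPerm_apply]
  rcases lt_or_ge y 0 with h0 | h0
  · have := dS.mono h0
    rw [H.S_pow_eq le_rfl zero_le_two] at this
    rw [adm.amap_of_le (by linarith), R.left _ (by linarith)]; ring
  · rcases lt_or_ge 2 y with h2 | h2
    · have := dS.mono h2
      rw [H.S_pow_eq zero_le_two le_rfl] at this
      rw [adm.amap_of_ge per (by linarith), R.right _ (by linarith)]; ring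
    · have k0 : 0 ≤ amap V y := by
        have := adm.amap_mono.monotone h0
        rwa [adm.amap_of_le (x := 0) (by norm_num)] at this
      have k2 : amap V y ≤ 2 := by
        have := adm.amap_mono.monotone h2
        rwa [adm.amap_of_ge per (x := 2) (by norm_num)] at this
      rw [H.S_pow_eq h0 h2, H.S_pow_eq k0 k2, amapS, dilate, add_sub_cancel_right,
        mul_div_cancel_left₀ _ (by linarith)]

theorem conjProd_of_le (H : Scaffold A D n M lam S t) (adm : Admissible V) (j : ℕ) {x : ℝ}
    (hx : x ≤ 0) : conjProd (aPerm adm) S j x = x := by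
  induction j generalizing x with
  | zero => rfl
  | succ j ih =>
    have h1 : S⁻¹ x ≤ 0 := by
      by_contra hc
      have h2 := H.tame_S.diffeo.mono (not_le.1 hc)
      rw [H.S_eq 0 le_rfl (by positivity)] at h2
      have := H.gap
      simp only [Equiv.Perm.coe_inv, Equiv.apply_symm_apply] at h2
      linarith
    rw [conjProd, Equiv.Perm.mul_apply, Equiv.Perm.mul_apply, Equiv.Perm.mul_apply, ih h1,
      aPerm_apply]
    simp only [Equiv.Perm.coe_inv, Equiv.apply_symm_apply]
    exact adm.amap_of_le (by linarith)

theorem conjProd_of_ge (H : Scaffold A D n M lam S t) (adm : Admissible V)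
    (per : ∀ x, V (x + 1) = V x) {j : ℕ} (hj : j ≤ M) {x : ℝ} (hx : lam ^ j * n - n ≤ x) :
    conjProd (aPerm adm) S j x = x := by
  induction j generalizing x with
  | zero => rfl
  | succ j ih =>
    have hn : (0:ℝ) ≤ n := by positivity
    have h1 : 1 ≤ lam ^ j := one_le_pow₀ H.one_lt.le
    have h3 : lam ^ j ≤ A := H.pow_eq ▸ pow_le_pow_right₀ H.one_lt.le (by omega)
    have h4 : lam ^ j * n ≤ A * n := by gcongr
    have h5 : 1 * (n:ℝ) ≤ lam ^ j * n := by gcongr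
    have h6 : lam * n ≤ lam * (lam ^ j * n) := by nlinarith [H.one_lt]
    have hD := H.D_eq
    have gap := H.gap
    have h7 : lam ^ j * n - n ≤ S⁻¹ x := by
      by_contra hc
      have h2 := H.tame_S.diffeo.mono (not_le.1 hc)
      simp only [Equiv.Perm.coe_inv, Equiv.apply_symm_apply] at h2
      rw [H.S_eq (lam ^ j * n - n) (by linarith) (by linarith)] at h2
      rw [pow_succ] at hx
      linarith
    rw [conjProd, Equiv.Perm.mul_apply, Equiv.Perm.mul_apply, Equiv.Perm.mul_apply,
      ih (by omega) h7, aPerm_apply]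
    simp only [Equiv.Perm.coe_inv, Equiv.apply_symm_apply]
    refine adm.amap_of_ge per ?_
    rw [pow_succ] at hx
    linarith

/-- The conclusion of the factorisation into two commutators. -/
def Factors (B : ℝ) (S t : Equiv.Perm ℝ) (r : ℕ) (ε : ℝ) (f : Equiv.Perm ℝ) : Prop :=
  ∃ k w : Equiv.Perm ℝ, IsDiffeo k ∧ IsDiffeo w ∧ (∀ x, x ≤ 0 ∨ B ≤ x → k x = x) ∧
    (∀ x, x ≤ 0 ∨ B ≤ x → w x = x) ∧ DerivBound 0 r ε (fun x => k x - x) ∧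
    DerivBound 0 r ε (fun x => w x - x) ∧ f = k * S * k⁻¹ * S⁻¹ * (w * t * w⁻¹ * t⁻¹)

end Scaffold

theorem tendsToId_aPerm {V : ℕ → ℝ → ℝ} (adm : ∀ m, Admissible (V m))
    (hV : ∀ (r : ℕ) (ε : ℝ), 0 < ε → ∀ᶠ m in atTop, DerivBound 0 r ε (V m)) :
    TendsToId fun m => aPerm (adm m) := by
  have h : TendsToId fun m => hPerm (adm m) := by
    refine ⟨fun m => isDiffeo_hPerm _, fun r ε hε => ?_⟩
    obtain ⟨C, hC, hc⟩ := chi_derivBound r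
    filter_upwards [hV r (ε / (2 ^ r * C)) (by positivity)] with m hm
    refine ((hc.mul hm chi_smooth (adm m).smooth).mono le_rfl le_rfl
      (by field_simp; rfl)).congr_fun fun x => ?_
    rw [hPerm_apply, hmap]; ring
  exact (h.inv.conj isTame_unitShift).mul h

namespace Scaffold

variable {A D n M : ℕ} {lam : ℝ} {S t : Equiv.Perm ℝ}

theorem eventually_factors (H : Scaffold A D n M lam S t) {V : ℕ → ℝ → ℝ} {f : ℕ → Equiv.Perm ℝ}
    (adm : ∀ m, Admissible (V m)) (per : ∀ m x, V m (x + 1) = V m x)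
    (R : ∀ m, Rollable (amapS A (V m)) A (2 * A + 4))
    (sol : ∀ m x, rollS A (V m) (rollMap (f m) (2 * D + 4) x) = x + V m x)
    (hV : ∀ (r : ℕ) (ε : ℝ), 0 < ε → ∀ᶠ m in atTop, DerivBound 0 r ε (V m))
    (hf : TendsToId f) (f2 : ∀ m, ∀ x ≤ 2, f m x = x) (fD : ∀ m x, (D:ℝ) ≤ x → f m x = x)
    (r : ℕ) {ε : ℝ} (hε : 0 < ε) :
    ∀ᶠ m in atTop, Factors ((D:ℝ) + 2 * A + 6) S t r ε (f m) := by
  have ha := tendsToId_aPerm adm hV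
  have hat := ha.conj (H.tame_S.pow M)
  have hW := ((hat.mul hf).mul ha.inv).rollPerm (D + 2 * A + 10)
  have hA : (4:ℝ) ≤ A := by exact_mod_cast H.four_le
  have hD : (2:ℝ) ≤ D := by exact_mod_cast H.two_le
  filter_upwards [hV 0 (1 / 8) (by norm_num),
    hf.bound 0 (1 / ((2 * D + 4 : ℕ) : ℝ)) (by positivity), hW.bound r ε hε,
    (ha.conjProd H.tame_S M).bound r ε hε] with m h1 h2 h3 h4
  obtain ⟨w, dw, w0, w1, w2, e⟩ := exists_core_commutator (adm m) (per m) h1.apply_zero (R m)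
    H.two_le (hf.diffeo m) (f2 m) (fD m) h2.apply_zero (by field_simp; rfl) (sol m)
    (H.conj_apply (adm m) (per m) (R m)) (hat.diffeo m) H.t_ge H.t_neg H.t_eq
  set a := aPerm (adm m) with hadef
  set b := S ^ M * a * (S ^ M)⁻¹ with hb
  have b1 : ∀ x ≤ (D:ℝ), b x = x := fun x hx => by
    rw [hb, H.conj_apply (adm m) (per m) (R m), (R m).left _ (by linarith)]; ring
  have k1 : ∀ x, (D:ℝ) ≤ x → conjProd a S M x = x := fun x hx =>
    H.conjProd_of_ge (adm m) (per m) le_rfl (by rw [H.pow_eq]; linarith [H.D_eq])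
  have a1 : ∀ x, 2 ≤ x → a x = x := fun x hx => by
    rw [hadef, aPerm_apply, (adm m).amap_of_ge (per m) (by linarith)]
  have c1 : Commute a b := commute_of_le (c := D) (fun x hx => a1 x (by linarith)) b1
  have c2 : Commute a (f m) := commute_of_le a1 (f2 m)
  refine ⟨conjProd a S M, w, (ha.diffeo m).conjProd H.tame_S.diffeo M, dw, fun x hx => ?_,
    fun x hx => hx.elim (w0 x) (w1 x), h4, w2 r ε hε.le h3, ?_⟩
  · exact hx.elim (H.conjProd_of_le (adm m) M) fun h => k1 x (by linarith)
  · rw [conjProd_commutator (commute_of_le k1 b1), ← hb, ← e]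
    have : b⁻¹ * a * (b * f m * a⁻¹) = b⁻¹ * (a * b) * (f m * a⁻¹) := by group
    rw [this, c1.eq]
    have : b⁻¹ * (b * a) * (f m * a⁻¹) = (a * f m) * a⁻¹ := by group
    rw [this, c2.eq]; group

end Scaffold

theorem TendsToId.of_bound {e : ℕ → Equiv.Perm ℝ} (hd : ∀ n, IsDiffeo (e n))
    (h : ∀ n : ℕ, DerivBound 0 n (1 / ((n:ℝ) + 1)) (fun x => e n x - x)) : TendsToId e := by
  refine ⟨hd, fun r ε hε => ?_⟩
  filter_upwards [eventually_ge_atTop r,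
    (tendsto_one_div_add_atTop_nhds_zero_nat (𝕜 := ℝ)).eventually (gt_mem_nhds hε)] with n h1 h2
  exact (h n).mono le_rfl h1 h2.le

theorem TendsToId.comp {e : ℕ → Equiv.Perm ℝ} (h : TendsToId e) {m : ℕ → ℕ}
    (hm : Tendsto m atTop atTop) : TendsToId fun j => e (m j) :=
  ⟨fun j => h.diffeo (m j), fun r ε hε => hm.eventually (h.bound r ε hε)⟩

/-- A property holds near the identity as soon as it holds somewhere along every sequence
converging to the identity. -/
theorem exists_near_of_seq {Q C : Equiv.Perm ℝ → Prop}
    (h : ∀ f : ℕ → Equiv.Perm ℝ, (∀ n, C (f n)) → TendsToId f → ∃ n, Q (f n)) :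
    ∃ s : ℕ, ∃ η > (0:ℝ), ∀ f, IsDiffeo f → C f → DerivBound 0 s η (fun x => f x - x) → Q f := by
  by_contra! hc
  choose f hd hC hb hQ using fun n : ℕ => hc n (1 / ((n:ℝ) + 1)) (by positivity)
  obtain ⟨n, hn⟩ := h f hC (TendsToId.of_bound hd hb)
  exact hQ n hn

theorem DerivBound.comp_add_const {i k : ℕ} {c : ℝ} {f : ℝ → ℝ} (h : DerivBound i k c f) (a : ℝ) :
    DerivBound i k c (fun x => f (x + a)) := fun j h1 h2 x => by
  rw [iteratedDeriv_comp_add_const]; exact h j h1 h2 _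

theorem giter_id (l : ℕ) (x : ℝ) : giter (fun x => x) l x = x + l :=
  giter_of_le (c := x + l) (fun _ _ => rfl) l le_rfl

theorem rollMap_id (l : ℕ) (x : ℝ) : rollMap (fun x => x) l x = x := by
  have := Int.fract_add_floor x
  rw [rollMap, giter_id]; linarith

theorem TendsToId.rollMap {f : ℕ → Equiv.Perm ℝ} (hf : TendsToId f) {D : ℕ}
    (hR : ∀ᶠ m in atTop, Rollable (f m) D (2 * D + 4)) (r : ℕ) {ε : ℝ} (hε : 0 < ε) :
    ∀ᶠ m in atTop, DerivBound 0 r ε (fun x => rollMap (f m) (2 * D + 4) x - x) := by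
  filter_upwards [(hf.rollPerm (2 * D + 4)).bound r ε hε, hR] with m h1 h2
  have h3 : Rollable (fun x => x) D (2 * D + 4) :=
    ⟨smooth_id, fun _ _ => rfl, fun _ _ => rfl, fun x => by linarith, h2.len⟩
  refine (h2.rollMap_sub_derivBound h3 (Nat.cast_nonneg _) (i := 0) (k := r) (c := ε)
    ((h1.comp_add_const (2 * D + 4 : ℕ)).congr_fun fun x => ?_)).congr_fun fun x => ?_
  · rw [rollPerm_apply, giter_id, add_sub_cancel_right]
  · rw [rollMap_id]

theorem exists_scaffold_factors : ∃ A₀ : ℕ, ∀ A ≥ A₀, 4 ≤ A ∧ ∀ (D n M : ℕ) (lam : ℝ)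
    (S t : Equiv.Perm ℝ), Scaffold A D n M lam S t → ∀ (r : ℕ) (ε : ℝ), 0 < ε →
    ∃ s : ℕ, ∃ η > (0:ℝ), ∀ f, IsDiffeo f → (∀ x, x ≤ 2 ∨ (D:ℝ) ≤ x → f x = x) →
      DerivBound 0 s η (fun x => f x - x) →
      Scaffold.Factors ((D:ℝ) + 2 * A + 6) S t r ε f := by
  obtain ⟨A₀, h⟩ := exists_roll_solution
  refine ⟨A₀, fun A hA => ⟨(h A hA).1, fun D n M lam S t H r ε hε => ?_⟩⟩
  refine exists_near_of_seq (C := fun f => ∀ x, x ≤ 2 ∨ (D:ℝ) ≤ x → f x = x) fun f hC hf => ?_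
  have hR : ∀ᶠ m in atTop, Rollable (f m) D (2 * D + 4) := by
    filter_upwards [hf.bound 0 (1 / 8) (by norm_num)] with m hm
    refine ⟨(hf.diffeo m).smooth, fun x hx => hC m x (.inl (by linarith)),
      fun x hx => hC m x (.inr ?_), fun x => ?_, by push_cast; exact le_rfl⟩
    · have : (0:ℝ) ≤ D := by positivity
      linarith
    · have := abs_le.1 (hm.apply_zero x)
      linarith
  have key : ∀ j : ℕ, ∃ m ≥ j, ∃ V : ℝ → ℝ, (∀ x, V (x + 1) = V x) ∧
      DerivBound 0 j (1 / ((j:ℝ) + 1)) V ∧ Admissible V ∧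
      Rollable (amapS A V) A (2 * A + 4) ∧
      ∀ x, rollS A V (rollMap (f m) (2 * D + 4) x) = x + V x := by
    intro j
    obtain ⟨s, η, hη, hs⟩ := (h A hA).2 j (1 / ((j:ℝ) + 1)) (by positivity)
    obtain ⟨m, ⟨h1, h2⟩, h3⟩ :=
      (((hf.rollMap hR s hη).and hR).and (eventually_ge_atTop j)).exists
    obtain ⟨V, -, v1, v2, v3, v4, v5⟩ := hs _ (h2.rollMap_smooth (Nat.cast_nonneg _))
      (rollMap_add_one _ _) h1
    exact ⟨m, h3, V, v1, v2, v3, v4, v5⟩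
  choose m hm V per bV adm R sol using key
  have hV : ∀ (r : ℕ) (ε : ℝ), 0 < ε → ∀ᶠ j in atTop, DerivBound 0 r ε (V j) := fun r ε hε => by
    filter_upwards [eventually_ge_atTop r,
      (tendsto_one_div_add_atTop_nhds_zero_nat (𝕜 := ℝ)).eventually (gt_mem_nhds hε)] with n h1 h2
    exact (bV n).mono le_rfl h1 h2.le
  obtain ⟨j, hj⟩ := (H.eventually_factors adm per R sol hV
    (hf.comp (tendsto_atTop_mono hm tendsto_id)) (fun j x hx => hC _ x (.inl hx))
    (fun j x hx => hC _ x (.inr hx)) r hε).exists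
  exact ⟨_, hj⟩

theorem half_le_deriv {f : ℝ → ℝ} (sf : IsSmooth f)
    (h : DerivBound 0 1 (1 / 2) (fun x => f x - x)) (x : ℝ) : 1 / 2 ≤ deriv f x := by
  have := (h.mono zero_le_one le_rfl le_rfl).deriv_le x
  rw [deriv_fun_sub (sf.diffAt x) differentiableAt_fun_id] at this
  simp only [deriv_id''] at this
  linarith [(abs_le.1 this).1]

theorem exists_isDiffeo {f : ℝ → ℝ} (sf : IsSmooth f) (h : ∀ x, 1 / 2 ≤ deriv f x) :
    ∃ e : Equiv.Perm ℝ, IsDiffeo e ∧ ∀ x, e x = f x := by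
  obtain ⟨hm, hb⟩ := bijective_of_deriv f sf h
  have hi : ∀ x, f ((Equiv.ofBijective f hb).symm x) = x := (Equiv.ofBijective f hb).apply_symm_apply
  exact ⟨Equiv.ofBijective f hb,
    ⟨sf, smooth_inverse f _ sf (fun x => by linarith [h x]) hi, hm⟩, fun x => rfl⟩

theorem exists_isTame {f : ℝ → ℝ} (sf : IsSmooth f)
    (h : DerivBound 0 1 (1 / 2) (fun x => f x - x))
    (hk : ∀ k, ∃ C, DerivBound 0 k C (fun x => f x - x)) :
    ∃ e : Equiv.Perm ℝ, IsTame e ∧ ∀ x, e x = f x := by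
  have hd := half_le_deriv sf h
  obtain ⟨e, he, hef⟩ := exists_isDiffeo sf hd
  obtain rfl : ⇑e = f := funext hef
  refine ⟨e, ⟨he, fun k => ?_, fun k => ?_⟩, hef⟩
  · obtain ⟨C, hC⟩ := hk k
    exact ⟨_, hC.one_of_sub_id sf⟩
  · obtain ⟨C, hC⟩ := hk (k + 1)
    have hC0 := hC.nonneg (Nat.zero_le _)
    obtain ⟨C', hC', h'⟩ := inverse_derivBound k C hC0
    have hi : ∀ x, e (e⁻¹ x) = x := fun x => by simp
    have := h' C _ _ hC0 le_rfl sf he.inv_smooth hi hd (hC.of_sub_id sf)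
    exact ⟨_, (DerivBound.one_of_two (abs_deriv_inverse_le sf he.inv_smooth hi hd) this
      (by positivity) (by norm_num)).mono le_rfl (Nat.le_succ k) le_rfl⟩

theorem exists_derivBound_of_eq_zero {f : ℝ → ℝ} (sf : IsSmooth f) {a b : ℝ}
    (h : ∀ x, x ≤ a ∨ b ≤ x → f x = 0) (k : ℕ) : ∃ C : ℝ, 1 ≤ C ∧ DerivBound 0 k C f := by
  refine exists_derivBound_of_forall k fun j => ?_
  obtain ⟨C, hC⟩ := (isCompact_Icc (a := a) (b := b)).exists_bound_of_continuousOn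
    (sf.iter j).continuous.continuousOn
  refine ⟨max C 0, fun x => ?_⟩
  have h0 : f =ᶠ[nhds x] (fun _ => 0) → |iteratedDeriv j f x| ≤ max C 0 := fun h => by
    rw [h.iteratedDeriv_eq]; simp
  rcases lt_or_ge x a with hx | hx
  · exact h0 (by filter_upwards [Iio_mem_nhds hx] with y hy using h y (.inl (le_of_lt hy)))
  rcases lt_or_ge b x with hx' | hx'
  · exact h0 (by filter_upwards [Ioi_mem_nhds hx'] with y hy using h y (.inr (le_of_lt hy)))
  · exact (hC x ⟨hx, hx'⟩).trans (le_max_left _ _)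

theorem DerivBound.const_mul {i k : ℕ} {C : ℝ} {f : ℝ → ℝ} (h : DerivBound i k C f) (c : ℝ) :
    DerivBound i k (|c| * C) (fun x => c * f x) := fun j h1 h2 x => by
  rw [iteratedDeriv_const_mul_field, abs_mul]
  exact mul_le_mul_of_nonneg_left (h j h1 h2 x) (abs_nonneg c)

/-- Small multiples of a compactly supported function give diffeomorphisms close to the
identity. -/
theorem exists_isTame_add {u : ℝ → ℝ} (su : IsSmooth u) {a b : ℝ}
    (hu : ∀ x, x ≤ a ∨ b ≤ x → u x = 0) (r : ℕ) {ε : ℝ} (hε : 0 < ε) :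
    ∃ c₀ > (0:ℝ), ∀ c, 0 ≤ c → c ≤ c₀ → ∃ e : Equiv.Perm ℝ, IsTame e ∧ (∀ x, e x = x + c * u x) ∧
      DerivBound 0 r ε (fun x => e x - x) := by
  choose C hC hb using exists_derivBound_of_eq_zero su hu
  have h1 := hC 1
  have hr := hC r
  refine ⟨min (1 / (2 * C 1)) (ε / C r), by positivity, fun c hc0 hc => ?_⟩
  have e1 : ∀ k, DerivBound 0 k (c * C k) (fun x => x + c * u x - x) := fun k => by
    have := (hb k).const_mul c
    rw [abs_of_nonneg hc0] at this
    exact this.congr_fun fun x => by ring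
  have b1 : c * C 1 ≤ 1 / 2 := by
    have := mul_le_mul_of_nonneg_right (hc.trans (min_le_left _ _)) (by linarith : 0 ≤ C 1)
    refine this.trans (by field_simp; rfl)
  have b2 : c * C r ≤ ε := by
    have := mul_le_mul_of_nonneg_right (hc.trans (min_le_right _ _)) (by linarith : 0 ≤ C r)
    refine this.trans (by field_simp; rfl)
  obtain ⟨e, he, hef⟩ := exists_isTame (smooth_id.add (contDiff_const.mul su))
    ((e1 1).mono le_rfl le_rfl b1) (fun k => ⟨_, e1 k⟩)
  exact ⟨e, he, hef, ((e1 r).mono le_rfl le_rfl b2).congr_fun fun x => by rw [hef x]⟩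

/-- A smooth plateau equal to one on `[a', b']` and to zero outside `(a, b)`. -/
theorem exists_plateau {a a' b' b : ℝ} (ha : a < a') (hb : b' < b) : ∃ ζ : ℝ → ℝ, IsSmooth ζ ∧
    (∀ x, a' ≤ x → x ≤ b' → ζ x = 1) ∧ (∀ x, x ≤ a ∨ b ≤ x → ζ x = 0) ∧ (∀ x, 0 ≤ ζ x) ∧
    ∀ x, ζ x ≤ 1 := by
  refine ⟨fun x => Real.smoothTransition ((x - a) / (a' - a)) *
    Real.smoothTransition ((b - x) / (b - b')), ?_, fun x h1 h2 => ?_, fun x hx => ?_, fun x => ?_,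
    fun x => ?_⟩
  · exact (Real.smoothTransition.contDiff.comp ((contDiff_id.sub contDiff_const).div_const _)).mul
      (Real.smoothTransition.contDiff.comp ((contDiff_const.sub contDiff_id).div_const _))
  · simp only
    rw [Real.smoothTransition.one_of_one_le, Real.smoothTransition.one_of_one_le, one_mul]
    · rw [one_le_div (by linarith)]; linarith
    · rw [one_le_div (by linarith)]; linarith
  · rcases hx with hx | hx
    · simp only
      rw [Real.smoothTransition.zero_of_nonpos, zero_mul]
      exact div_nonpos_of_nonpos_of_nonneg (by linarith) (by linarith)
    · simp only
      rw [mul_comm, Real.smoothTransition.zero_of_nonpos, zero_mul]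
      exact div_nonpos_of_nonpos_of_nonneg (by linarith) (by linarith)
  · exact mul_nonneg (Real.smoothTransition.nonneg _) (Real.smoothTransition.nonneg _)
  · exact mul_le_one₀ (Real.smoothTransition.le_one _) (Real.smoothTransition.nonneg _)
      (Real.smoothTransition.le_one _)

/-- Conjugation by a tame diffeomorphism is continuous at the identity. -/
theorem exists_conj_derivBound {S : Equiv.Perm ℝ} (hS : IsTame S) (r : ℕ) {ε : ℝ} (hε : 0 < ε) :
    ∃ s : ℕ, ∃ η > (0:ℝ), ∀ f, IsDiffeo f → DerivBound 0 s η (fun x => f x - x) →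
      DerivBound 0 r ε (fun x => (S * f * S⁻¹) x - x) := by
  obtain ⟨s, η, hη, h⟩ := exists_near_of_seq (C := fun _ => True)
    (Q := fun f => DerivBound 0 r ε (fun x => (S * f * S⁻¹) x - x))
    fun f _ hf => ((hf.conj hS).bound r ε hε).exists
  exact ⟨s, η, hη, fun f hf hb => h f hf trivial hb⟩

/-- The affine diffeomorphism `x ↦ κ x + c`. -/
def affinePerm (κ c : ℝ) (hκ : 0 < κ) : Equiv.Perm ℝ where
  toFun x := κ * x + c
  invFun x := (x - c) / κ
  left_inv x := by field_simp; ring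
  right_inv x := by field_simp; ring

theorem affinePerm_apply {κ c : ℝ} (hκ : 0 < κ) (x : ℝ) : affinePerm κ c hκ x = κ * x + c := rfl

theorem affinePerm_inv_apply {κ c : ℝ} (hκ : 0 < κ) (x : ℝ) :
    (affinePerm κ c hκ)⁻¹ x = (x - c) / κ := rfl

theorem isTame_affinePerm {κ c : ℝ} (hκ : 0 < κ) : IsTame (affinePerm κ c hκ) := by
  have e : ⇑(affinePerm κ c hκ)⁻¹ = fun x => κ⁻¹ * (x - c) := funext fun x => by
    rw [affinePerm_inv_apply]; ring
  refine ⟨⟨(contDiff_const.mul contDiff_id).add contDiff_const, ?_, fun x y h => ?_⟩, fun k => ?_,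
    fun k => ?_⟩
  · rw [e]; exact contDiff_const.mul (contDiff_id.sub contDiff_const)
  · simp only [affinePerm_apply]; nlinarith
  · exact ⟨_, ((derivBound_id k).const_mul κ).add_const le_rfl c⟩
  · rw [e]; exact ⟨_, ((derivBound_id k).sub_const le_rfl c).const_mul κ⁻¹⟩

/-- A diffeomorphism supported in `[a, b]` and close to the identity. -/
structure SmallIn (a b : ℝ) (r : ℕ) (ε : ℝ) (g : Equiv.Perm ℝ) : Prop where
  diffeo : IsDiffeo g
  fixed : ∀ x, x ≤ a ∨ b ≤ x → g x = x
  bound : DerivBound 0 r ε (fun x => g x - x)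

theorem exists_pow_eq {A : ℕ} (hA : 4 ≤ A) {δ : ℝ} (hδ : 0 < δ) :
    ∃ (M : ℕ) (lam : ℝ), 1 < lam ∧ lam < 1 + δ ∧ lam ^ M = A := by
  have h1 : Tendsto (fun M : ℕ => Real.exp (Real.log A / M)) atTop (nhds 1) := by
    rw [← Real.exp_zero]
    exact (Real.continuous_exp.tendsto 0).comp (tendsto_const_div_atTop_nhds_zero_nat _)
  obtain ⟨M, hM, hM1⟩ :=
    ((h1.eventually (gt_mem_nhds (show (1:ℝ) < 1 + δ by linarith))).and
      (eventually_ge_atTop 1)).exists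
  have hA' : (4:ℝ) ≤ A := by exact_mod_cast hA
  have hM' : (0:ℝ) < M := by exact_mod_cast hM1
  have hlog : 0 < Real.log A := Real.log_pos (by linarith)
  refine ⟨M, Real.exp (Real.log A / M), Real.one_lt_exp_iff.2 (by positivity), hM, ?_⟩
  rw [← Real.exp_nat_mul, mul_div_cancel₀ _ hM'.ne', Real.exp_log (by linarith)]

theorem exists_scaffold {z x₀ b' b : ℝ} {A : ℕ} (hA : 4 ≤ A) (hx : 0 < x₀) (hz : z + A * x₀ = b')
    (hb : b' < b) (r : ℕ) {ε : ℝ} (hε : 0 < ε) : ∃ (n M : ℕ) (κ lam : ℝ) (hκ : 0 < κ)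
      (S t : Equiv.Perm ℝ), 2 ≤ n ∧ κ * n = x₀ ∧ κ * (2 * A + 6) ≤ b - b' ∧
      SmallIn z b r ε S ∧ SmallIn z b r ε t ∧
      Scaffold A ((A - 1) * n) n M lam
        ((affinePerm κ (z + x₀) hκ)⁻¹ * S * affinePerm κ (z + x₀) hκ)
        ((affinePerm κ (z + x₀) hκ)⁻¹ * t * affinePerm κ (z + x₀) hκ) := by
  have hA' : (4:ℝ) ≤ A := by exact_mod_cast hA
  obtain ⟨ζ, sζ, ζ1, ζ0, ζn, -⟩ := exists_plateau (a := z) (a' := z + x₀ / 2) (b' := (b' + b) / 2)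
    (b := b) (by linarith) (by linarith)
  obtain ⟨c₁, hc₁, h₁⟩ := exists_isTame_add sζ ζ0 r hε
  obtain ⟨c₂, hc₂, h₂⟩ := exists_isTame_add (u := fun y => (y - z) * ζ y) (a := z) (b := b)
    ((contDiff_id.sub contDiff_const).mul sζ) (fun x hx => by simp [ζ0 x hx]) r hε
  obtain ⟨M, lam, l1, l2, l3⟩ := exists_pow_eq hA hc₂
  have hlim := tendsto_const_div_atTop_nhds_zero_nat (𝕜 := ℝ) x₀
  obtain ⟨n, ⟨⟨n1, n2⟩, n3⟩, n4⟩ := ((((hlim.eventually (gt_mem_nhds hc₁)).and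
    (hlim.eventually (gt_mem_nhds (show 0 < (b - b') / 2 / (2 * A + 6) by
      have : 0 < b - b' := by linarith
      positivity)))).and (eventually_ge_atTop 2)).and
    ((tendsto_natCast_atTop_atTop.const_mul_atTop (sub_pos.2 l1)).eventually
      (eventually_ge_atTop (2:ℝ)))).exists
  have hn : (2:ℝ) ≤ n := by exact_mod_cast n3
  obtain ⟨κ, hκe⟩ : ∃ κ, κ = x₀ / n := ⟨_, rfl⟩
  have hκ : 0 < κ := by rw [hκe]; positivity
  have hκn : κ * n = x₀ := by rw [hκe]; field_simp
  rw [← hκe] at n1 n2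
  rw [lt_div_iff₀ (by positivity)] at n2
  obtain ⟨t, ht, te, tb⟩ := h₁ κ hκ.le n1.le
  obtain ⟨S, hS, Se, Sb⟩ := h₂ (lam - 1) (by linarith) (by linarith)
  have hL := isTame_affinePerm (c := z + x₀) hκ
  have hD : (((A - 1) * n : ℕ) : ℝ) = A * n - n := by
    rw [Nat.cast_mul, Nat.cast_sub (by omega)]; push_cast; ring
  have conj : ∀ (e : Equiv.Perm ℝ) (x : ℝ),
      ((affinePerm κ (z + x₀) hκ)⁻¹ * e * affinePerm κ (z + x₀) hκ) x =
      (e (κ * x + (z + x₀)) - (z + x₀)) / κ := fun e x => rfl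
  have one : ∀ x, -1 ≤ x → x ≤ (((A - 1) * n : ℕ) : ℝ) + 2 * A + 6 →
      ζ (κ * x + (z + x₀)) = 1 := fun x h1 h2 => by
    refine ζ1 _ ?_ ?_
    · have := mul_le_mul_of_nonneg_left h1 hκ.le
      have h3 := mul_le_mul_of_nonneg_left hn hκ.le
      linarith
    · have := mul_le_mul_of_nonneg_left h2 hκ.le
      rw [hD] at this
      have e : κ * (A * n - n + 2 * A + 6) = A * (κ * n) - κ * n + κ * (2 * A + 6) := by ring
      rw [e, hκn] at this
      linarith
  have teq : ∀ x, -1 ≤ x → x ≤ (((A - 1) * n : ℕ) : ℝ) + 2 * A + 6 →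
      ((affinePerm κ (z + x₀) hκ)⁻¹ * t * affinePerm κ (z + x₀) hκ) x = x + 1 :=
    fun x h1 h2 => by
      rw [conj, te, one x h1 h2]; field_simp; ring
  have tame : ∀ e : Equiv.Perm ℝ, IsTame e →
      IsTame ((affinePerm κ (z + x₀) hκ)⁻¹ * e * affinePerm κ (z + x₀) hκ) := fun e he =>
    (hL.inv.mul he).mul hL
  refine ⟨n, M, κ, lam, hκ, S, t, n3, hκn, by linarith,
    ⟨hS.diffeo, fun x hx => by rw [Se, ζ0 x hx]; ring, Sb⟩,
    ⟨ht.diffeo, fun x hx => by rw [te, ζ0 x hx]; ring, tb⟩, hA, l1, l3, n4, hD, ?_, tame S hS,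
    tame t ht, fun x h1 h2 => ?_, fun x => ?_, fun x h1 => ?_, teq⟩
  · calc 2 ≤ 1 * n := by omega
      _ ≤ (A - 1) * n := Nat.mul_le_mul_right _ (by omega)
  · rw [conj, Se, one x (by linarith) h2, ← hκn]; field_simp; ring
  · rw [conj, te, le_div_iff₀ hκ]
    have := mul_nonneg hκ.le (ζn (κ * x + (z + x₀)))
    linarith
  · have h2 := (tame t ht).diffeo.mono.monotone h1
    rw [teq (-1) le_rfl (by
      have : (0:ℝ) ≤ (((A - 1) * n : ℕ) : ℝ) := by positivity
      linarith)] at h2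
    linarith

/-- Perfection on the line: a diffeomorphism supported in `[p, q]` and close to the identity is a
product of two commutators of small diffeomorphisms supported in a larger interval. -/
theorem exists_line_commutators {a p q b : ℝ} (ha : a < p) (hpq : p < q) (hb : q < b) (r : ℕ)
    {ε : ℝ} (hε : 0 < ε) : ∃ s : ℕ, ∃ η > (0:ℝ), ∀ f, SmallIn p q s η f →
      ∃ g g' h h', SmallIn a b r ε g ∧ SmallIn a b r ε g' ∧ SmallIn a b r ε h ∧
        SmallIn a b r ε h' ∧ f = g * g' * g⁻¹ * g'⁻¹ * (h * h' * h⁻¹ * h'⁻¹) := by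
  obtain ⟨A₀, hA₀⟩ := exists_scaffold_factors
  obtain ⟨A₁, hA₁⟩ := exists_nat_gt (3 * (q - a) / (p - a))
  set A := max A₀ A₁ with hA
  obtain ⟨h4, hfac⟩ := hA₀ A (le_max_left _ _)
  have hA4 : (4:ℝ) ≤ A := by exact_mod_cast h4
  have hAx : 3 * (q - a) / (p - a) < A := hA₁.trans_le (by exact_mod_cast le_max_right _ _)
  rw [div_lt_iff₀ (by linarith)] at hAx
  obtain ⟨x₀, hx₀e⟩ : ∃ x₀, x₀ = (q - a) / A := ⟨_, rfl⟩
  have hx₀ : 0 < x₀ := by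
    have : 0 < q - a := by linarith
    rw [hx₀e]; positivity
  have hAx₀ : A * x₀ = q - a := by rw [hx₀e]; field_simp
  have hx3 : 3 * x₀ ≤ p - a := by
    rw [hx₀e, mul_div_assoc', div_le_iff₀ (by linarith)]; linarith
  obtain ⟨n, M, κ, lam, hκ, S, t, n2, hκn, hκA, hS, ht, H⟩ :=
    exists_scaffold h4 hx₀ (z := a) (b' := q) (by linarith) hb r hε
  have hn : (2:ℝ) ≤ n := by exact_mod_cast n2
  set L := affinePerm κ (a + x₀) hκ with hL
  have tL : IsTame L := isTame_affinePerm hκ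
  obtain ⟨s₁, η₁, hη₁, h₁⟩ := exists_conj_derivBound tL r hε
  obtain ⟨s₂, η₂, hη₂, h₂⟩ := hfac _ n M lam _ _ H s₁ η₁ hη₁
  obtain ⟨s₃, η₃, hη₃, h₃⟩ := exists_conj_derivBound tL.inv s₂ hη₂
  refine ⟨s₃, η₃, hη₃, fun f hf => ?_⟩
  have hD : (((A - 1) * n : ℕ) : ℝ) = A * n - n := H.D_eq
  have f0 : ∀ x, x ≤ 2 ∨ (((A - 1) * n : ℕ) : ℝ) ≤ x → (L⁻¹ * f * L⁻¹⁻¹) x = x := fun x hx => by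
    have : f (L x) = L x := by
      refine hf.fixed _ ?_
      rw [hL, affinePerm_apply]
      refine hx.imp (fun h => ?_) fun h => ?_
      · have := mul_le_mul_of_nonneg_left h hκ.le
        have := mul_le_mul_of_nonneg_left hn hκ.le
        linarith
      · have := mul_le_mul_of_nonneg_left h hκ.le
        rw [hD] at this
        have e : κ * (A * n - n) = A * (κ * n) - κ * n := by ring
        rw [e, hκn] at this
        linarith
    rw [inv_inv, Equiv.Perm.mul_apply, Equiv.Perm.mul_apply, this]; simp
  obtain ⟨k, w, dk, dw, k0, w0, bk, bw, e⟩ := h₂ (L⁻¹ * f * L⁻¹⁻¹) (tL.inv.diffeo.conj hf.diffeo)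
    f0 (h₃ f hf.diffeo hf.bound)
  have sm : ∀ e : Equiv.Perm ℝ, IsDiffeo e →
      (∀ x, x ≤ 0 ∨ (((A - 1) * n : ℕ) : ℝ) + 2 * A + 6 ≤ x → e x = x) →
      DerivBound 0 s₁ η₁ (fun x => e x - x) →
      SmallIn a b r ε (L * e * L⁻¹) := fun e de e0 be => by
    refine ⟨tL.diffeo.conj de, fun x hx => ?_, h₁ e de be⟩
    have : e (L⁻¹ x) = L⁻¹ x := by
      refine e0 _ ?_
      rw [hL, affinePerm_inv_apply, div_le_iff₀ hκ, le_div_iff₀ hκ, hD]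
      refine hx.imp (fun h => by linarith) fun h => ?_
      have e : (A * n - n + 2 * A + 6) * κ = A * (κ * n) - κ * n + κ * (2 * A + 6) := by ring
      rw [e, hκn]
      linarith
    rw [Equiv.Perm.mul_apply, Equiv.Perm.mul_apply, this]; simp
  refine ⟨L * k * L⁻¹, S, L * w * L⁻¹, t, sm k dk k0 bk, hS, sm w dw w0 bw, ht, ?_⟩
  have : f = L * (L⁻¹ * f * L⁻¹⁻¹) * L⁻¹ := by group
  rw [this, e]; group

/-- The diffeomorphisms of the line supported in `[a, b]`. -/
def lineSupp (a b : ℝ) : Subgroup (Equiv.Perm ℝ) where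
  carrier := {e | IsDiffeo e ∧ ∀ x, x ≤ a ∨ b ≤ x → e x = x}
  one_mem' := ⟨IsDiffeo.one, fun _ _ => rfl⟩
  mul_mem' {e e'} h h' := ⟨h.1.mul h'.1, fun x hx => by
    rw [Equiv.Perm.mul_apply, h'.2 x hx, h.2 x hx]⟩
  inv_mem' {e} h := ⟨h.1.inv, fun x hx => by rw [Equiv.Perm.inv_eq_iff_eq, h.2 x hx]⟩

/-- The periodic extension of the restriction of `e` to `[a, a + 1)`. -/
def wrapFun (a : ℝ) (e : ℝ → ℝ) (x : ℝ) : ℝ := e (x - ⌊x - a⌋) + ⌊x - a⌋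

theorem sub_floor_mem (a x : ℝ) : a ≤ x - ⌊x - a⌋ ∧ x - ⌊x - a⌋ < a + 1 :=
  ⟨by linarith [Int.floor_le (x - a)], by linarith [Int.lt_floor_add_one (x - a)]⟩

theorem wrapFun_eq {a : ℝ} (e : ℝ → ℝ) {x : ℝ} (n : ℤ) (h1 : a + n ≤ x) (h2 : x < a + 1 + n) :
    wrapFun a e x = e (x - n) + n := by
  have : ⌊x - a⌋ = n := Int.floor_eq_iff.2 ⟨by linarith, by linarith⟩
  rw [wrapFun, this]

section wrap

variable {a b : ℝ}

theorem lineSupp_mem_Ico (hb : b < a + 1) (e : lineSupp a b) {y : ℝ} (h : a ≤ y ∧ y < a + 1) :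
    a ≤ (e : Equiv.Perm ℝ) y ∧ (e : Equiv.Perm ℝ) y < a + 1 := by
  have h1 := e.2.1.mono.monotone h.1
  have h2 := e.2.1.mono h.2
  rw [e.2.2 a (.inl le_rfl)] at h1
  rw [e.2.2 (a + 1) (.inr hb.le)] at h2
  exact ⟨h1, h2⟩

theorem wrapFun_mul (hb : b < a + 1) (e : Equiv.Perm ℝ) (e' : lineSupp a b) (x : ℝ) :
    wrapFun a (e * (e' : Equiv.Perm ℝ) : Equiv.Perm ℝ) x =
      wrapFun a e (wrapFun a (e' : Equiv.Perm ℝ) x) := by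
  obtain ⟨h1, h2⟩ := lineSupp_mem_Ico hb e' (sub_floor_mem a x)
  rw [wrapFun_eq e (x := wrapFun a (e' : Equiv.Perm ℝ) x) ⌊x - a⌋ (by rw [wrapFun]; linarith)
    (by rw [wrapFun]; linarith), wrapFun, wrapFun, add_sub_cancel_right, Equiv.Perm.mul_apply]

theorem wrapFun_one (x : ℝ) : wrapFun a (1 : Equiv.Perm ℝ) x = x := by simp [wrapFun]

/-- Diffeomorphisms supported in an interval of length less than one, as lifts of circle
diffeomorphisms. -/
def wrap (hb : b < a + 1) : lineSupp a b →* Equiv.Perm ℝ :=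
  MonoidHom.mk' (fun e =>
    { toFun := wrapFun a (e : Equiv.Perm ℝ)
      invFun := wrapFun a ((e⁻¹ : lineSupp a b) : Equiv.Perm ℝ)
      left_inv := fun x => by rw [← wrapFun_mul hb, ← Subgroup.coe_mul, inv_mul_cancel,
        Subgroup.coe_one, wrapFun_one]
      right_inv := fun x => by rw [← wrapFun_mul hb, ← Subgroup.coe_mul, mul_inv_cancel,
        Subgroup.coe_one, wrapFun_one] }) fun e e' => by
    ext x; exact wrapFun_mul hb e e' x

variable (hb : b < a + 1) (e : lineSupp a b)

theorem wrap_apply (x : ℝ) : wrap hb e x = wrapFun a (e : Equiv.Perm ℝ) x := rfl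

theorem wrap_eventuallyEq (x : ℝ) : ∃ n : ℤ,
    wrap hb e =ᶠ[nhds x] fun y => (e : Equiv.Perm ℝ) (y - n) + n := by
  obtain ⟨h1, h2⟩ := sub_floor_mem a x
  refine ⟨⌊x - a⌋, ?_⟩
  filter_upwards [Ioo_mem_nhds (a := b - 1 + ⌊x - a⌋) (b := a + 1 + ⌊x - a⌋) (by linarith)
    (by linarith), Ioi_mem_nhds (show a - 1 + ⌊x - a⌋ < x by linarith)] with y hy hy'
  rw [wrap_apply]
  rcases le_or_gt (a + ⌊x - a⌋) y with h | h
  · exact wrapFun_eq _ _ h hy.2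
  · rw [e.2.2 (y - ⌊x - a⌋) (.inl (by linarith)), sub_add_cancel,
      wrapFun_eq _ (⌊x - a⌋ - 1) (by push_cast; linarith [mem_Ioi.1 hy']) (by push_cast; linarith),
      e.2.2 _ (.inr (by push_cast; linarith [hy.1])), sub_add_cancel]

theorem wrap_smooth : IsSmooth (wrap hb e) := contDiff_iff_contDiffAt.2 fun x => by
  obtain ⟨n, hn⟩ := wrap_eventuallyEq hb e x
  refine ContDiffAt.congr_of_eventuallyEq ?_ hn
  have : IsSmooth fun y => (e : Equiv.Perm ℝ) (y - n) + n :=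
    (e.2.1.smooth.comp (contDiff_id.sub contDiff_const)).add contDiff_const
  exact this.contDiffAt

theorem isDiffeo_wrap : IsDiffeo (wrap hb e) := by
  refine ⟨wrap_smooth hb e, by rw [← map_inv]; exact wrap_smooth hb e⁻¹, fun x y hxy => ?_⟩
  have h1 := lineSupp_mem_Ico hb e (sub_floor_mem a x)
  have h2 := lineSupp_mem_Ico hb e (sub_floor_mem a y)
  rw [wrap_apply, wrap_apply, wrapFun, wrapFun]
  rcases (Int.floor_mono (sub_le_sub_right hxy.le a)).eq_or_lt with h | h
  · rw [h]
    have := e.2.1.mono (sub_lt_sub_right hxy (⌊y - a⌋ : ℝ))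
    linarith
  · have : (⌊x - a⌋ : ℝ) + 1 ≤ ⌊y - a⌋ := by exact_mod_cast h
    linarith [h1.2, h2.1]

theorem wrap_derivBound {r : ℕ} {ε : ℝ}
    (h : DerivBound 0 r ε (fun x => (e : Equiv.Perm ℝ) x - x)) :
    DerivBound 0 r ε (fun x => wrap hb e x - x) := fun j h1 h2 x => by
  obtain ⟨n, hn⟩ := wrap_eventuallyEq hb e x
  have : (fun x => wrap hb e x - x) =ᶠ[nhds x]
      fun y => (fun x => (e : Equiv.Perm ℝ) x - x) (y - n) := by
    filter_upwards [hn] with y hy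
    rw [hy]; ring
  rw [this.iteratedDeriv_eq, iteratedDeriv_comp_sub_fun (fun x => (e : Equiv.Perm ℝ) x - x)]
  exact h j h1 h2 _

theorem wrap_add_one (x : ℝ) : wrap hb e (x + 1) = wrap hb e x + 1 := by
  obtain ⟨h1, h2⟩ := sub_floor_mem a x
  rw [wrap_apply, wrap_apply, wrapFun_eq _ (⌊x - a⌋ + 1) (by push_cast; linarith)
    (by push_cast; linarith), wrapFun]
  push_cast
  rw [add_sub_add_right_eq_sub]; ring

theorem wrap_of_mem {x : ℝ} (h1 : a ≤ x) (h2 : x < a + 1) :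
    wrap hb e x = (e : Equiv.Perm ℝ) x := by
  rw [wrap_apply, wrapFun_eq _ 0 (by simpa using h1) (by simpa using h2)]; simp

theorem wrap_of_notMem {x : ℝ} (h : ∀ m : ℤ, x + m ∉ Ioo a b) : wrap hb e x = x := by
  rw [wrap_apply, wrapFun, e.2.2, sub_add_cancel]
  by_contra! hc
  refine h (-⌊x - a⌋) ⟨?_, ?_⟩ <;> push_cast <;> linarith [hc.1, hc.2]

end wrap

theorem SmallIn.mem {a b ε : ℝ} {r : ℕ} {e : Equiv.Perm ℝ} (h : SmallIn a b r ε e) :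
    e ∈ lineSupp a b := ⟨h.diffeo, h.fixed⟩

/-- Cutting off a diffeomorphism close to the identity. -/
theorem exists_cutoff {p c d q : ℝ} (hp : p < c) (hq : d < q) (r : ℕ) {ε : ℝ} (hε : 0 < ε) :
    ∃ s : ℕ, ∃ η > (0:ℝ), ∀ F, IsDiffeo F → DerivBound 0 s η (fun x => F x - x) →
      ∃ f, SmallIn p q r ε f ∧ ∀ x, c ≤ x → x ≤ d → f x = F x := by
  obtain ⟨ζ, sζ, ζ1, ζ0, -⟩ := exists_plateau hp hq
  obtain ⟨C, hC, hb⟩ := exists_derivBound_of_eq_zero sζ ζ0 (max r 1)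
  refine ⟨max r 1, min ε (1 / 2) / (2 ^ max r 1 * C), by positivity, fun F hF hFb => ?_⟩
  have h1 : DerivBound 0 (max r 1) (min ε (1 / 2)) (fun x => x + ζ x * (F x - x) - x) :=
    ((hb.mul hFb sζ (hF.smooth.sub smooth_id)).mono le_rfl le_rfl
      (by field_simp; rfl)).congr_fun fun x => by ring
  have s1 : IsSmooth (fun x => x + ζ x * (F x - x)) :=
    smooth_id.add (sζ.mul (hF.smooth.sub smooth_id))
  obtain ⟨f, df, hf⟩ := exists_isDiffeo s1
    (half_le_deriv s1 (h1.mono le_rfl (le_max_right _ _) (min_le_right _ _)))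
  refine ⟨f, ⟨df, fun x hx => by rw [hf, ζ0 x hx]; ring,
    (h1.mono le_rfl (le_max_left _ _) (min_le_left _ _)).congr_fun fun x => by rw [hf]⟩,
    fun x h1 h2 => by rw [hf, ζ1 x h1 h2]; ring⟩

/-- Cutting a diffeomorphism close to the identity which is the identity on two intervals. -/
theorem exists_cut_two {c₀ d₀ c₁ d₁ : ℝ} (h₀ : c₀ < d₀) (h : d₀ < c₁) (h₁ : c₁ < d₁) (r : ℕ)
    {ε : ℝ} (hε : 0 < ε) : ∃ s : ℕ, ∃ η > (0:ℝ), ∀ W, IsDiffeo W →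
      ((∀ x, c₀ ≤ x → x ≤ d₀ → W x = x) ∧ ∀ x, c₁ ≤ x → x ≤ d₁ → W x = x) →
      DerivBound 0 s η (fun x => W x - x) →
      ∃ w, SmallIn d₀ c₁ r ε w ∧ ∀ x, c₀ ≤ x → x ≤ d₁ → w x = W x := by
  refine exists_near_of_seq fun W hW tW => ?_
  choose u du uW u1 ub using fun n => exists_cut (tW.diffeo n) h₀ (hW n).1
  choose v dv vW v1 vb using fun n => exists_cut (tW.diffeo n) h₁ (hW n).2
  have tu : TendsToId u := ⟨du, fun r ε hε => (tW.bound r ε hε).mono fun n => ub n r ε hε.le⟩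
  have tv : TendsToId v := ⟨dv, fun r ε hε => (tW.bound r ε hε).mono fun n => vb n r ε hε.le⟩
  obtain ⟨n, hn⟩ := ((tu.inv.mul tv).bound r ε hε).exists
  refine ⟨n, (u n)⁻¹ * v n, ⟨(du n).inv.mul (dv n), fun x hx => ?_, hn⟩, fun x hx hx' => ?_⟩
  · rw [Equiv.Perm.mul_apply, Equiv.Perm.inv_eq_iff_eq]
    rcases hx with hx | hx
    · rw [vW n x (by linarith), uW n x hx]
    · rw [v1 n x hx, u1 n x (by linarith)]
  · rw [Equiv.Perm.mul_apply, Equiv.Perm.inv_eq_iff_eq, vW n x hx', u1]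
    have := (tW.diffeo n).mono.monotone hx
    rwa [(hW n).1 c₀ le_rfl h₀.le] at this

/-- The bijections of the line commuting with the unit translation. -/
def liftPerm : Subgroup (Equiv.Perm ℝ) where
  carrier := {e | ∀ x, e (x + 1) = e x + 1}
  one_mem' _ := rfl
  mul_mem' {e e'} h h' x := by
    rw [Equiv.Perm.mul_apply, Equiv.Perm.mul_apply, h' x, h]
  inv_mem' {e} h x := by
    rw [Equiv.Perm.inv_eq_iff_eq, h, Equiv.Perm.coe_inv, Equiv.apply_symm_apply]

theorem wrap_mem_liftPerm {a b : ℝ} (hb : b < a + 1) (e : lineSupp a b) :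
    wrap hb e ∈ liftPerm := wrap_add_one hb e

theorem liftPerm_add_int {e : Equiv.Perm ℝ} (h : e ∈ liftPerm) (x : ℝ) (n : ℤ) :
    e (x + n) = e x + n := by
  have h1 : Function.Periodic (fun x => e x - x) 1 := fun x => by
    simp only [show e (x + 1) = e x + 1 from h x]; ring
  have := h1.int_mul n x
  simp only [mul_one] at this
  linarith

/-- Two lifts which agree on a fundamental domain are equal. -/
theorem liftPerm_ext {e e' : Equiv.Perm ℝ} (h : e ∈ liftPerm) (h' : e' ∈ liftPerm) (a : ℝ)
    (heq : ∀ x, a ≤ x → x < a + 1 → e x = e' x) : e = e' := by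
  ext x
  obtain ⟨h1, h2⟩ := sub_floor_mem a x
  have := heq _ h1 h2
  rw [← sub_add_cancel x (⌊x - a⌋ : ℝ), liftPerm_add_int h, liftPerm_add_int h', this]

/-- Stripping two small commutators from a small diffeomorphism leaves a small one. -/
theorem exists_strip_derivBound (s : ℕ) {η : ℝ} (hη : 0 < η) : ∃ t : ℕ, ∃ θ > (0:ℝ),
    ∀ F g g' h h' : Equiv.Perm ℝ,
      (IsDiffeo F ∧ DerivBound 0 t θ (fun x => F x - x)) →
      (IsDiffeo g ∧ DerivBound 0 t θ (fun x => g x - x)) →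
      (IsDiffeo g' ∧ DerivBound 0 t θ (fun x => g' x - x)) →
      (IsDiffeo h ∧ DerivBound 0 t θ (fun x => h x - x)) →
      (IsDiffeo h' ∧ DerivBound 0 t θ (fun x => h' x - x)) →
      DerivBound 0 s η (fun x => ((g * g' * g⁻¹ * g'⁻¹)⁻¹ * F * (h * h' * h⁻¹ * h'⁻¹)⁻¹ :
        Equiv.Perm ℝ) x - x) ∧
      DerivBound 0 s η (fun x => ((h * h' * h⁻¹ * h'⁻¹)⁻¹ : Equiv.Perm ℝ) x - x) := by
  by_contra! hc
  choose F g g' h h' hF hg hg' hh hh' hX using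
    fun n : ℕ => hc n (1 / ((n:ℝ) + 1)) (by positivity)
  have tF := TendsToId.of_bound (fun n => (hF n).1) fun n => (hF n).2
  have tg := TendsToId.of_bound (fun n => (hg n).1) fun n => (hg n).2
  have tg' := TendsToId.of_bound (fun n => (hg' n).1) fun n => (hg' n).2
  have th := TendsToId.of_bound (fun n => (hh n).1) fun n => (hh n).2
  have th' := TendsToId.of_bound (fun n => (hh' n).1) fun n => (hh' n).2
  have t1 := (((tg.mul tg').mul tg.inv).mul tg'.inv).inv
  have t2 := (((th.mul th').mul th.inv).mul th'.inv).inv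
  obtain ⟨n, h1, h2⟩ := ((((t1.mul tF).mul t2).bound s η hη).and (t2.bound s η hη)).exists
  exact hX n h1 h2

/-- A lift close to the identity is a product of four commutators of small lifts supported
alternately in two given arcs. -/
theorem exists_circle_factors {α β δ : ℝ} (hδ : 0 < δ) (h : β ≤ α) (hb₁ : α + 4 * δ < β - 4 * δ + 1)
    (hδ' : α - 1 + δ < β - δ) (hb₂ : β - δ / 2 < α - 1 + δ / 2 + 1) (r : ℕ) {ε : ℝ} (hε : 0 < ε) :
    ∃ s : ℕ, ∃ η > (0:ℝ), ∀ F, IsDiffeo F → F ∈ liftPerm → DerivBound 0 s η (fun x => F x - x) →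
      ∃ g₁ g₁' g₄ g₄' : lineSupp (β - 4 * δ) (α + 4 * δ),
      ∃ g₂ g₂' g₃ g₃' : lineSupp (α - 1 + δ / 2) (β - δ / 2),
        ((∀ e ∈ [g₁, g₁', g₄, g₄'], DerivBound 0 r ε (fun x => wrap hb₁ e x - x)) ∧
        ∀ e ∈ [g₂, g₂', g₃, g₃'], DerivBound 0 r ε (fun x => wrap hb₂ e x - x)) ∧
        F = wrap hb₁ (g₁ * g₁' * g₁⁻¹ * g₁'⁻¹) * wrap hb₂ (g₂ * g₂' * g₂⁻¹ * g₂'⁻¹) *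
          wrap hb₂ (g₃ * g₃' * g₃⁻¹ * g₃'⁻¹) * wrap hb₁ (g₄ * g₄' * g₄⁻¹ * g₄'⁻¹) := by
  obtain ⟨s₃, η₃, hη₃, H₃⟩ := exists_line_commutators (a := α - 1 + δ / 2) (p := α - 1 + δ)
    (q := β - δ) (b := β - δ / 2) (by linarith) hδ' (by linarith) r hε
  obtain ⟨s₂, η₂, hη₂, H₂⟩ := exists_cut_two (c₀ := β - 1 - δ) (d₀ := α - 1 + δ) (c₁ := β - δ)
    (d₁ := α + δ) (by linarith) hδ' (by linarith) s₃ hη₃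
  obtain ⟨t, θ, hθ, Ht⟩ := exists_strip_derivBound s₂ (lt_min hη₂ hδ)
  obtain ⟨s₁, η₁, hη₁, H₁⟩ := exists_line_commutators (a := β - 4 * δ) (p := β - 3 * δ)
    (q := α + 3 * δ) (b := α + 4 * δ) (by linarith) (by linarith) (by linarith) (max r t)
    (lt_min hε hθ)
  obtain ⟨s₀, η₀, hη₀, H₀⟩ := exists_cutoff (p := β - 3 * δ) (c := β - 2 * δ) (d := α + 2 * δ)
    (q := α + 3 * δ) (by linarith) (by linarith) s₁ hη₁
  refine ⟨max s₀ t, min η₀ θ, lt_min hη₀ hθ, fun F dF pF bF => ?_⟩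
  obtain ⟨f, hf, hfF⟩ := H₀ F dF (bF.mono le_rfl (le_max_left _ _) (min_le_left _ _))
  obtain ⟨g₁, g₁', g₄, g₄', b₁, b₁', b₄, b₄', rfl⟩ := H₁ f hf
  lift g₁ to lineSupp (β - 4 * δ) (α + 4 * δ) using b₁.mem
  lift g₁' to lineSupp (β - 4 * δ) (α + 4 * δ) using b₁'.mem
  lift g₄ to lineSupp (β - 4 * δ) (α + 4 * δ) using b₄.mem
  lift g₄' to lineSupp (β - 4 * δ) (α + 4 * δ) using b₄'.mem
  have small {e : lineSupp (β - 4 * δ) (α + 4 * δ)} (he : SmallIn (β - 4 * δ) (α + 4 * δ) (max r t)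
      (min ε θ) e) : IsDiffeo (wrap hb₁ e) ∧ DerivBound 0 t θ (fun x => wrap hb₁ e x - x) :=
    ⟨isDiffeo_wrap hb₁ e,
      wrap_derivBound hb₁ e (he.bound.mono le_rfl (le_max_right _ _) (min_le_right _ _))⟩
  have small' {e : lineSupp (β - 4 * δ) (α + 4 * δ)} (he : SmallIn (β - 4 * δ) (α + 4 * δ)
      (max r t) (min ε θ) e) : DerivBound 0 r ε (fun x => wrap hb₁ e x - x) :=
    wrap_derivBound hb₁ e (he.bound.mono le_rfl (le_max_left _ _) (min_le_left _ _))
  obtain ⟨hX, hC⟩ := Ht F _ _ _ _ ⟨dF, bF.mono le_rfl (le_max_right _ _) (min_le_right _ _)⟩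
    (small b₁) (small b₁') (small b₄) (small b₄')
  simp only [← map_mul, ← map_inv] at hX hC
  generalize hc₁ : g₁ * g₁' * g₁⁻¹ * g₁'⁻¹ = c₁ at *
  generalize hc₄ : g₄ * g₄' * g₄⁻¹ * g₄'⁻¹ = c₄ at *
  have hfc (x : ℝ) (h1 : β - 2 * δ ≤ x) (h2 : x ≤ α + 2 * δ) :
      wrap hb₁ c₁ (wrap hb₁ c₄ x) = F x := by
    rw [← Equiv.Perm.mul_apply, ← map_mul, wrap_of_mem hb₁ _ (by linarith) (by linarith),
      ← hfF x h1 h2, ← hc₁, ← hc₄]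
    simp only [Subgroup.coe_mul, Subgroup.coe_inv]
  set X := wrap hb₁ c₁⁻¹ * F * wrap hb₁ c₄⁻¹ with hXdef
  have dX : IsDiffeo X := ((isDiffeo_wrap hb₁ _).mul dF).mul (isDiffeo_wrap hb₁ _)
  have pX : X ∈ liftPerm := mul_mem (mul_mem (wrap_mem_liftPerm _ _) pF) (wrap_mem_liftPerm _ _)
  have X₁ (x : ℝ) (h1 : β - δ ≤ x) (h2 : x ≤ α + δ) : X x = x := by
    have := abs_le.1 ((hC.mono le_rfl le_rfl (min_le_right _ _)).apply_zero x)
    rw [hXdef, Equiv.Perm.mul_apply, Equiv.Perm.mul_apply, ← hfc _ (by linarith) (by linarith),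
      map_inv, map_inv, Equiv.Perm.coe_inv, Equiv.Perm.coe_inv, Equiv.apply_symm_apply,
      Equiv.symm_apply_apply]
  have X₀ (x : ℝ) (h1 : β - 1 - δ ≤ x) (h2 : x ≤ α - 1 + δ) : X x = x := by
    have := X₁ (x + 1) (by linarith) (by linarith)
    rw [pX x] at this
    linarith
  obtain ⟨w, hw, hwX⟩ := H₂ X dX ⟨X₀, X₁⟩ (hX.mono le_rfl le_rfl (min_le_left _ _))
  obtain ⟨g₂, g₂', g₃, g₃', b₂, b₂', b₃, b₃', rfl⟩ := H₃ w hw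
  lift g₂ to lineSupp (α - 1 + δ / 2) (β - δ / 2) using b₂.mem
  lift g₂' to lineSupp (α - 1 + δ / 2) (β - δ / 2) using b₂'.mem
  lift g₃ to lineSupp (α - 1 + δ / 2) (β - δ / 2) using b₃.mem
  lift g₃' to lineSupp (α - 1 + δ / 2) (β - δ / 2) using b₃'.mem
  have key : X = wrap hb₂ (g₂ * g₂' * g₂⁻¹ * g₂'⁻¹ * (g₃ * g₃' * g₃⁻¹ * g₃'⁻¹)) := by
    refine liftPerm_ext pX (wrap_mem_liftPerm _ _) (α - 1 + δ / 2) fun x h1 h2 => ?_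
    rw [wrap_of_mem hb₂ _ h1 h2, ← hwX x (by linarith) (by linarith)]
    simp only [Subgroup.coe_mul, Subgroup.coe_inv]
  refine ⟨g₁, g₁', g₄, g₄', g₂, g₂', g₃, g₃', ⟨?_, ?_⟩, ?_⟩
  · simpa using ⟨small' b₁, small' b₁', small' b₄, small' b₄'⟩
  · simpa using ⟨wrap_derivBound hb₂ _ b₂.bound, wrap_derivBound hb₂ _ b₂'.bound,
      wrap_derivBound hb₂ _ b₃.bound, wrap_derivBound hb₂ _ b₃'.bound⟩
  · rw [hc₁, hc₄, mul_assoc (wrap hb₁ c₁), ← map_mul, ← key, hXdef, map_inv, map_inv]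
    group

/-- The circle diffeomorphism lifting to a given diffeomorphism of the line. -/
def IsDiffeo.toCircleLift {e : Equiv.Perm ℝ} (h : IsDiffeo e) (hp : e ∈ liftPerm) : CircleLift where
  toFun := e
  invFun := (e⁻¹ : Equiv.Perm ℝ)
  smooth := h.smooth
  smooth_inv := h.inv_smooth
  left_inv := e.left_inv
  right_inv := e.right_inv
  mono := h.mono
  lift := hp

namespace CircleLift

/-- A lift as a bijection of the line. -/
def toPerm (F : CircleLift) : Equiv.Perm ℝ := ⟨F.toFun, F.invFun, F.left_inv, F.right_inv⟩

theorem isDiffeo_toPerm (F : CircleLift) : IsDiffeo F.toPerm := ⟨F.smooth, F.smooth_inv, F.mono⟩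

theorem toPerm_mem_liftPerm (F : CircleLift) : F.toPerm ∈ liftPerm := F.lift

end CircleLift

theorem iteratedDeriv_sub_id {f : ℝ → ℝ} (hf : IsSmooth f) (k : ℕ) (x : ℝ) :
    iteratedDeriv k (fun x => f x - x) x = iteratedDeriv k f x - iteratedDeriv k id x :=
  iteratedDeriv_fun_sub (hf.of_le (by exact_mod_cast le_top)).contDiffAt
    contDiff_id.contDiffAt

theorem CDistLt.derivBound {s : ℕ} {η : ℝ} {F : CircleLift} (h : CDistLt s η F.toFun id) :
    DerivBound 0 s η (fun x => F.toFun x - x) := fun j _ h2 x => by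
  have hp (x : ℝ) : F.toFun (x + 1) - (x + 1) = F.toFun x - x := by rw [F.lift]; ring
  have : Function.Periodic (iteratedDeriv j (fun x => F.toFun x - x)) 1 :=
    periodic_iteratedDeriv hp j
  have := this.sub_int_mul_eq (x := x) ⌊x⌋
  rw [mul_one] at this
  rw [← this, iteratedDeriv_sub_id F.smooth]
  exact (h j h2 _ ⟨Int.fract_nonneg x, (Int.fract_lt_one x).le⟩).le

theorem DerivBound.cDistLt {r : ℕ} {ε η : ℝ} {e : ℝ → ℝ}
    (h : DerivBound 0 r ε (fun x => e x - x)) (he : IsSmooth e) (hη : ε < η) : CDistLt r η e id :=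
  fun k hk x _ => by
    rw [← iteratedDeriv_sub_id he]
    exact (h k (Nat.zero_le _) hk x).trans_lt hη

/-- The circle diffeomorphism given by a diffeomorphism supported in a short interval. -/
def lineSupp.toCircleLift {a b : ℝ} (hb : b < a + 1) (e : lineSupp a b) : CircleLift :=
  (isDiffeo_wrap hb e).toCircleLift (wrap_mem_liftPerm hb e)

theorem commFun_toCircleLift {a b : ℝ} (hb : b < a + 1) (e e' : lineSupp a b) :
    commFun (lineSupp.toCircleLift hb e) (lineSupp.toCircleLift hb e') =
      wrap hb (e * e' * e⁻¹ * e'⁻¹) := by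
  simp only [map_mul, map_inv]; rfl

theorem lineSupp.supportedIn {a b a' b' : ℝ} (hb : b < a + 1) (e : lineSupp a b)
    (m : ℤ) (ha : a' ≤ a + m) (hb' : b + m ≤ b') :
    SupportedIn (lineSupp.toCircleLift hb e) a' b' := fun x hx =>
  wrap_of_notMem hb e fun k hk => hx ⟨k + m, by
    push_cast; constructor <;> linarith [hk.1, hk.2]⟩

/-- Translating the right end of an arc by a nonzero integer leaves the arc. -/
theorem notMem_arcSet_right {a b : ℝ} (h : b ≤ a + 1) : b ∉ arcSet a b := fun ⟨k, hk⟩ => by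
  have h0 : (k:ℝ) < 0 := by linarith [hk.2]
  have h1 : (k:ℝ) + 1 ≤ 0 := by exact_mod_cast h0
  linarith [hk.1]

/-- The overlaps of two arcs covering the circle. -/
theorem exists_overlap {a₁ b₁ a₂ b₂ : ℝ} (h₁' : b₁ ≤ a₁ + 1) (h₂' : b₂ ≤ a₂ + 1)
    (hcover : ∀ x : ℝ, x ∈ arcSet a₁ b₁ ∪ arcSet a₂ b₂) :
    ∃ m : ℤ, a₁ < b₂ + m ∧ b₂ + m ≤ a₂ + m + 1 ∧ a₂ + m + 1 < b₁ := by
  obtain ⟨m, hm⟩ := (hcover b₂).resolve_right (notMem_arcSet_right h₂')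
  obtain ⟨k, hk⟩ := (hcover b₁).resolve_left (notMem_arcSet_right h₁')
  refine ⟨m, hm.1, by linarith, ?_⟩
  have h0 : (k:ℝ) < -m := by linarith [hk.2, hm.2]
  have h1 : (k:ℝ) + 1 ≤ -m := by exact_mod_cast h0
  linarith [hk.1]

/-- Local fragmented perfection of `Diff^∞_+(𝕊¹)` (Avila): given two open arcs `J₁`, `J₂`
covering the circle, any diffeomorphism close enough to the identity is a product of four
commutators of small diffeomorphisms supported alternately in `J₁` and `J₂`. -/
theorem local_fragmented_perfection_circle
    (a₁ b₁ a₂ b₂ : ℝ) (h₁ : a₁ < b₁) (h₁' : b₁ ≤ a₁ + 1) (h₂ : a₂ < b₂) (h₂' : b₂ ≤ a₂ + 1)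
    (hcover : ∀ x : ℝ, x ∈ arcSet a₁ b₁ ∪ arcSet a₂ b₂) :
    ∀ r : ℕ, ∀ η' > (0 : ℝ), ∃ s : ℕ, ∃ η > (0 : ℝ),
      ∀ F : CircleLift, CDistLt s η F.toFun id →
        ∃ g₁ g₁' g₂ g₂' g₃ g₃' g₄ g₄' : CircleLift,
          SupportedIn g₁ a₁ b₁ ∧ SupportedIn g₁' a₁ b₁ ∧
          SupportedIn g₄ a₁ b₁ ∧ SupportedIn g₄' a₁ b₁ ∧
          SupportedIn g₂ a₂ b₂ ∧ SupportedIn g₂' a₂ b₂ ∧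
          SupportedIn g₃ a₂ b₂ ∧ SupportedIn g₃' a₂ b₂ ∧
          CDistLt r η' g₁.toFun id ∧ CDistLt r η' g₁'.toFun id ∧
          CDistLt r η' g₂.toFun id ∧ CDistLt r η' g₂'.toFun id ∧
          CDistLt r η' g₃.toFun id ∧ CDistLt r η' g₃'.toFun id ∧
          CDistLt r η' g₄.toFun id ∧ CDistLt r η' g₄'.toFun id ∧
          ∀ x : ℝ, F.toFun x =
            (commFun g₁ g₁' ∘ commFun g₂ g₂' ∘ commFun g₃ g₃' ∘ commFun g₄ g₄') x := by
 
  intro r η' hη'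
  obtain ⟨m, hm₁, hm₂, hm₃⟩ := exists_overlap h₁' h₂' hcover
  generalize hβ : b₂ + m = β at *
  generalize hα : a₂ + m + 1 = α at *
  obtain ⟨δ, hδ, hδ'⟩ := exists_between (a₁ := (0:ℝ))
    (a₂ := min (min ((β - a₁) / 5) ((b₁ - α) / 5)) ((β - α + 1) / 2))
    (lt_min (lt_min (by linarith) (by linarith)) (by linarith))
  obtain ⟨hδ', h3⟩ := lt_min_iff.1 hδ'
  obtain ⟨h4, h5⟩ := lt_min_iff.1 hδ'
  obtain ⟨s, η, hη, H⟩ := exists_circle_factors hδ hm₂ (by linarith) (by linarith) (by linarith) r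
    (half_pos hη')
  refine ⟨s, η, hη, fun F hF => ?_⟩
  obtain ⟨g₁, g₁', g₄, g₄', g₂, g₂', g₃, g₃', ⟨hJ₁, hJ₂⟩, hF⟩ :=
    H F.toPerm F.isDiffeo_toPerm F.toPerm_mem_liftPerm hF.derivBound
  have S₁ := fun e => lineSupp.supportedIn (a := β - 4 * δ) (b := α + 4 * δ) (a' := a₁) (b' := b₁)
    (by linarith) e 0 (by push_cast; linarith) (by push_cast; linarith)
  have S₂ := fun e => lineSupp.supportedIn (a := α - 1 + δ / 2) (b := β - δ / 2) (a' := a₂)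
    (b' := b₂) (by linarith) e (-m) (by push_cast; linarith) (by push_cast; linarith)
  have lt := half_lt_self hη'
  refine ⟨_, _, _, _, _, _, _, _, S₁ g₁, S₁ g₁', S₁ g₄, S₁ g₄', S₂ g₂, S₂ g₂', S₂ g₃, S₂ g₃',
    (hJ₁ _ (by simp)).cDistLt (wrap_smooth _ _) lt, (hJ₁ _ (by simp)).cDistLt (wrap_smooth _ _) lt,
    (hJ₂ _ (by simp)).cDistLt (wrap_smooth _ _) lt, (hJ₂ _ (by simp)).cDistLt (wrap_smooth _ _) lt,
    (hJ₂ _ (by simp)).cDistLt (wrap_smooth _ _) lt, (hJ₂ _ (by simp)).cDistLt (wrap_smooth _ _) lt,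
    (hJ₁ _ (by simp)).cDistLt (wrap_smooth _ _) lt, (hJ₁ _ (by simp)).cDistLt (wrap_smooth _ _) lt,
    fun x => ?_⟩
  simp only [commFun_toCircleLift]
  exact DFunLike.congr_fun hF x
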